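/- Let p be an odd prime and K a number field containing no primitive p-th root of unity. Let d ≥ 1 and let n₁, …, n_d be positive integers. Then there exist a finite Galois extension L/K with Galois group Gal(L/K) isomorphic to (ℤ/pℤ)^d and distinct nonzero prime ideals 𝔮₁, …, 𝔮_d of 𝓞_K such that: (i) for each i, p^{n_i} divides N(𝔮_i) − 1, where N(𝔮_i) is the cardinality of the residue field 𝓞_K/𝔮_i; (ii) for each i, every prime of 𝓞_L above 𝔮_i has ramification index p and residue degree 1 over 𝔮_i (equivalently, the decomposition group of 𝔮_i in Gal(L/K) is cyclic of order p and equals the inertia group); (iii) every nonzero prime ideal of 𝓞_K not among 𝔮₁, …, 𝔮_d is unramified in 𝓞_L. -/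

import Mathlib

section
open MeasureTheory in
theorem RC_lattice_sum {ι V : Type*} [Finite ι] [NormedAddCommGroup V] [NormedSpace ℝ V]
    [FiniteDimensional ℝ V] [MeasurableSpace V] [BorelSpace V] (μ : Measure V)
    [μ.IsAddHaarMeasure] (b : Module.Basis ι ℝ V) (f : V → ℝ) (k : NNReal)
    (hf : LipschitzWith k f) (R : ℝ) (hR : ∀ x, R < ‖x‖ → f x = 0) (v : V) :
    ∃ C : ℝ, 0 ≤ C ∧ ∀ t : ℝ, 1 ≤ t →
      |(∑' l : Submodule.span ℤ (Set.range b), f (t⁻¹ • (v + l))) *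
          μ.real (ZSpan.fundamentalDomain b) - t ^ Module.finrank ℝ V * ∫ x, f x ∂μ| ≤
        C * t ^ Module.finrank ℝ V / t := by
  classical
  have hD := ZSpan.isAddFundamentalDomain b μ
  set D := ZSpan.fundamentalDomain b with hDdef
  set n := Module.finrank ℝ V with hn
  obtain ⟨δ, hδ⟩ := (ZSpan.fundamentalDomain_isBounded b).exists_norm_le
  have hδ0 : 0 ≤ δ ∨ D = ∅ := by
    by_cases h : D = ∅
    · exact Or.inr h
    · obtain ⟨x, hx⟩ := Set.nonempty_iff_ne_empty.mpr h
      exact Or.inl ((norm_nonneg x).trans (hδ x hx))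
  have hDne : μ D ≠ 0 := ZSpan.measure_fundamentalDomain_ne_zero b
  have hδ0 : 0 ≤ δ := by
    rcases hδ0 with h | h
    · exact h
    · exact absurd (by rw [h]; simp) hDne
  have hDfin : μ D ≠ ⊤ := ((ZSpan.fundamentalDomain_isBounded b).measure_lt_top).ne
  have hfc : Continuous f := hf.continuous
  have hfs : HasCompactSupport f := by
    refine HasCompactSupport.intro (isCompact_closedBall (0 : V) R) fun x hx ↦ hR x ?_
    simpa using hx
  have hfi : Integrable f μ := hfc.integrable_of_hasCompactSupport hfs
  set B := Metric.closedBall (0 : V) (R + δ) with hB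
  let χ : V → ℝ := B.indicator (fun _ ↦ 1)
  have hχi : Integrable χ μ := by
    refine (integrable_indicator_iff measurableSet_closedBall).mpr ?_
    exact integrableOn_const (by exact (isCompact_closedBall _ _).measure_lt_top.ne) (by simp)
  refine ⟨k * δ * μ.real B, by positivity, fun t ht ↦ ?_⟩
  have ht0 : 0 < t := by linarith
  have trans : ∀ g : V → ℝ, Integrable g μ → Integrable (fun x ↦ g (t⁻¹ • (v + x))) μ ∧
      ∫ x, g (t⁻¹ • (v + x)) ∂μ = t ^ n * ∫ x, g x ∂μ := by
    intro g hg
    constructor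
    · exact ((integrable_comp_smul_iff μ g (inv_ne_zero ht0.ne')).mpr hg).comp_add_left v
    · rw [integral_add_left_eq_self (fun x ↦ g (t⁻¹ • x)) v, Measure.integral_comp_smul]
      rw [inv_pow, inv_inv, abs_of_pos (by positivity), smul_eq_mul]
  have : VAddInvariantMeasure (Submodule.span ℤ (Set.range b)) V μ :=
    ⟨fun c s _ ↦ measure_preimage_add μ (c : V) s⟩
  obtain ⟨hfi', hfe⟩ := trans f hfi
  obtain ⟨hχi', hχe⟩ := trans χ hχi
  have e1 := hD.integral_eq_tsum'' _ hfi'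
  have e2 := hD.integral_eq_tsum'' _ hχi'
  rw [hfe] at e1
  rw [hχe] at e2
  have hχint : ∫ x, χ x ∂μ = μ.real B := by
    simp only [χ]
    rw [integral_indicator measurableSet_closedBall]
    simp [hB]
  -- finiteness
  have hfinite : {l : Submodule.span ℤ (Set.range b) | ‖v + (l : V)‖ ≤ t * (|R| + δ + δ) + δ}.Finite := by
    have h0 := ZSpan.setFinite_inter b (s := Metric.closedBall (-v) (t * (|R| + δ + δ) + δ)) Metric.isBounded_closedBall
    refine Set.Finite.of_finite_image (f := (Subtype.val)) (h0.subset ?_) (Subtype.val_injective.injOn)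
    rintro _ ⟨l, hl, rfl⟩
    refine ⟨?_, l.2⟩
    simp only [Metric.mem_closedBall, dist_eq_norm, sub_neg_eq_add]
    rw [add_comm]; exact hl
  have key : ∀ (l : Submodule.span ℤ (Set.range b)), ¬ ‖v + (l : V)‖ ≤ t * (|R| + δ + δ) + δ →
      ∀ x, ‖x‖ ≤ δ → R + δ < ‖t⁻¹ • (v + ((l : V) + x))‖ := by
    intro l hl x hx
    push Not at hl
    rw [norm_smul, norm_inv, Real.norm_of_nonneg ht0.le, inv_mul_eq_div, lt_div_iff₀ ht0]
    have h1 : ‖v + (l : V)‖ ≤ ‖v + ((l : V) + x)‖ + ‖x‖ := by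
      have : v + (l : V) = (v + ((l : V) + x)) - x := by abel
      rw [this]; exact norm_sub_le _ _
    have h2 : (R + δ) * t ≤ t * (|R| + δ + δ) := by
      rw [mul_comm]; refine mul_le_mul_of_nonneg_left ?_ ht0.le
      linarith [le_abs_self R]
    linarith
  have z1 : ∀ l ∉ hfinite.toFinset, f (t⁻¹ • (v + (l : V))) = 0 := by
    intro l hl
    have := key l (by simpa using hl) 0 (by simpa using hδ0)
    rw [add_zero] at this
    exact hR _ (by linarith)
  have vadd : ∀ (l : Submodule.span ℤ (Set.range b)) (x : V), l +ᵥ x = (l : V) + x := fun l x ↦ rfl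
  have z2 : ∀ l ∉ hfinite.toFinset, ∫ x in D, f (t⁻¹ • (v + (l +ᵥ x))) ∂μ = 0 := by
    intro l hl
    refine setIntegral_eq_zero_of_forall_eq_zero fun x hx ↦ hR _ ?_
    have := key l (by simpa using hl) x (hδ x hx)
    rw [vadd]; linarith
  have z3 : ∀ l ∉ hfinite.toFinset, ∫ x in D, χ (t⁻¹ • (v + (l +ᵥ x))) ∂μ = 0 := by
    intro l hl
    refine setIntegral_eq_zero_of_forall_eq_zero fun x hx ↦ ?_
    have := key l (by simpa using hl) x (hδ x hx)
    rw [vadd]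
    refine Set.indicator_of_notMem ?_ _
    simp only [hB, mem_closedBall_zero_iff, not_le]; exact this
  rw [tsum_eq_sum z2] at e1
  rw [tsum_eq_sum z3] at e2
  rw [tsum_eq_sum z1, e1, Finset.sum_mul, ← Finset.sum_sub_distrib]
  calc _ ≤ ∑ l ∈ hfinite.toFinset, |f (t⁻¹ • (v + (l : V))) * μ.real D -
            ∫ x in D, f (t⁻¹ • (v + (l +ᵥ x))) ∂μ| := Finset.abs_sum_le_sum_abs _ _
    _ ≤ ∑ l ∈ hfinite.toFinset, (k * δ / t) * ∫ x in D, χ (t⁻¹ • (v + (l +ᵥ x))) ∂μ := by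
        refine Finset.sum_le_sum fun l _ ↦ ?_
        have c1 : f (t⁻¹ • (v + (l : V))) * μ.real D = ∫ x in D, f (t⁻¹ • (v + (l : V))) ∂μ := by
          simp [mul_comm]
        have sh : ∀ g : V → ℝ, Integrable (fun x ↦ g (t⁻¹ • (v + x))) μ →
            IntegrableOn (fun x ↦ g (t⁻¹ • (v + (l +ᵥ x)))) D μ := by
          intro g hg
          exact (hg.comp_add_left (l : V)).integrableOn
        have ic : Integrable (fun _ : V ↦ f (t⁻¹ • (v + (l : V)))) (μ.restrict D) :=
          integrableOn_const hDfin (by simp)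
        rw [c1, ← integral_sub ic (sh f hfi'), ← integral_const_mul]
        refine (abs_integral_le_integral_abs).trans ?_
        refine setIntegral_mono_on ?_ ?_ (ZSpan.fundamentalDomain_measurableSet b) ?_
        · exact (ic.sub (sh f hfi')).abs
        · exact (sh χ hχi').const_mul _
        · intro x hx
          have hxδ := hδ x hx
          rw [vadd]
          have hdist : dist (t⁻¹ • (v + (l : V))) (t⁻¹ • (v + ((l : V) + x))) ≤ δ / t := by
            rw [dist_eq_norm, ← smul_sub, norm_smul, norm_inv, Real.norm_of_nonneg ht0.le]
            rw [show v + (l : V) - (v + ((l : V) + x)) = - x by abel, norm_neg, inv_mul_eq_div]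
            gcongr
          have hlip := hf.dist_le_mul (t⁻¹ • (v + (l : V))) (t⁻¹ • (v + ((l : V) + x)))
          rw [Real.dist_eq] at hlip
          by_cases hmem : t⁻¹ • (v + ((l : V) + x)) ∈ B
          · simp only [χ, Set.indicator_of_mem hmem, mul_one]
            calc _ ≤ _ := hlip
              _ ≤ k * (δ / t) := by gcongr
              _ = _ := by ring
          · simp only [χ, Set.indicator_of_notMem hmem, mul_zero]
            have hm : R + δ < ‖t⁻¹ • (v + ((l : V) + x))‖ := by
              simpa [hB] using hmem
            have h1 : f (t⁻¹ • (v + ((l : V) + x))) = 0 := hR _ (by linarith)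
            have h2 : f (t⁻¹ • (v + (l : V))) = 0 := by
              refine hR _ ?_
              have hd : δ / t ≤ δ := div_le_self hδ0 ht
              have := norm_sub_norm_le (t⁻¹ • (v + ((l : V) + x))) (t⁻¹ • (v + (l : V)))
              rw [← dist_eq_norm, dist_comm] at this
              linarith
            rw [h1, h2]; simp
    _ = _ := by
        rw [← Finset.mul_sum, ← e2, hχint]; ring
end

section
open NumberField NumberField.mixedEmbedding NumberField.mixedEmbedding.fundamentalCone NumberField.InfinitePlace NumberField.Units NumberField.Units.dirichletUnitTheorem

noncomputable def RC_h (t : ℝ) : ℝ := Real.smoothTransition (t+1) - Real.smoothTransition t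
noncomputable def RC_g (t : ℝ) : ℝ := Real.smoothTransition (t+1) * Real.smoothTransition (1-t)

lemma RC_h_zero {t : ℝ} (ht : 1 ≤ |t|) : RC_h t = 0 := by
  unfold RC_h
  rcases le_abs.1 ht with h | h
  · rw [Real.smoothTransition.one_of_one_le h, Real.smoothTransition.one_of_one_le (by linarith)]; simp
  · rw [Real.smoothTransition.zero_of_nonpos (by linarith), Real.smoothTransition.zero_of_nonpos (by linarith)]; simp
lemma RC_g_zero {t : ℝ} (ht : 1 ≤ |t|) : RC_g t = 0 := by
  unfold RC_g
  rcases le_abs.1 ht with h | h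
  · rw [Real.smoothTransition.zero_of_nonpos (x := 1 - t) (by linarith)]; simp
  · rw [Real.smoothTransition.zero_of_nonpos (x := t+1) (by linarith)]; simp
lemma RC_h_nonneg (t : ℝ) : 0 ≤ RC_h t := sub_nonneg.2 (Real.smoothTransition.monotone (by linarith))
lemma RC_g_nonneg (t : ℝ) : 0 ≤ RC_g t := mul_nonneg (Real.smoothTransition.nonneg _) (Real.smoothTransition.nonneg _)
lemma RC_g_pos : 0 < RC_g 0 := by unfold RC_g; simp
lemma RC_h_smooth : ContDiff ℝ 1 RC_h := by
  unfold RC_h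
  exact (Real.smoothTransition.contDiff.comp (contDiff_id.add contDiff_const)).sub Real.smoothTransition.contDiff
lemma RC_g_smooth : ContDiff ℝ 1 RC_g := by
  unfold RC_g
  exact (Real.smoothTransition.contDiff.comp (contDiff_id.add contDiff_const)).mul (Real.smoothTransition.contDiff.comp (contDiff_const.sub contDiff_id))

lemma RC_h_sum (t : ℝ) : ∃ s : Finset ℤ, (∀ k ∉ s, RC_h (t + k) = 0) ∧ ∑ k ∈ s, RC_h (t + k) = 1 := by
  obtain ⟨N, hN⟩ := exists_nat_gt (|t| + 2)
  have key : ∀ n : ℕ, ∀ a : ℤ, ∑ k ∈ Finset.Ico a (a + n), RC_h (t + k) =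
      Real.smoothTransition (t + a + n) - Real.smoothTransition (t + a) := by
    intro n a
    induction n with
    | zero => simp
    | succ n ih =>
      have : Finset.Ico a (a + (n+1 : ℕ)) = insert (a + n) (Finset.Ico a (a+n)) := by
        ext x; simp only [Finset.mem_Ico, Finset.mem_insert]; push_cast; omega
      rw [this, Finset.sum_insert (by simp), ih, RC_h]
      push_cast
      rw [show t + (a + n) + 1 = t + a + (n+1:ℝ) by ring, show t + (a + n) = t + a + (n:ℝ) by ring]
      ring
  have h1 := neg_abs_le t
  have h2 := le_abs_self t
  refine ⟨Finset.Ico (-N) (-N + (2 * N : ℕ)), ?_, ?_⟩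
  · intro k hk
    apply RC_h_zero
    simp only [Finset.mem_Ico, not_and_or, not_le, not_lt] at hk
    rw [le_abs]
    rcases hk with hk | hk
    · right
      have : (k : ℝ) < -N := by exact_mod_cast hk
      linarith
    · left
      have : (-N + (2 * N : ℕ) : ℝ) ≤ k := by exact_mod_cast hk
      push_cast at this
      linarith
  · rw [key]
    push_cast
    rw [Real.smoothTransition.one_of_one_le (by linarith), Real.smoothTransition.zero_of_nonpos (by linarith)]
    simp

section
variable (F : Type*) [Field F] [NumberField F]

open Classical in
noncomputable def RC_psi (y : realSpace F) : ℝ :=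
  (∏ i : {w : InfinitePlace F // w ≠ w₀}, RC_h ((completeBasis F).repr y i.1)) * RC_g ((completeBasis F).repr y w₀)

open Classical in
noncomputable def RC_phi (r : realSpace F) : ℝ :=
  if ∀ w, 0 < r w then RC_psi F (fun w => w.mult * Real.log (r w)) else 0

lemma RC_phi_nonneg (r) : 0 ≤ RC_phi F r := by
  unfold RC_phi RC_psi
  split_ifs
  · exact mul_nonneg (Finset.prod_nonneg fun _ _ => RC_h_nonneg _) (RC_g_nonneg _)
  · exact le_rfl

lemma RC_psi_contDiff : ContDiff ℝ 1 (RC_psi F) := by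
  classical
  have hc : ∀ i, ContDiff ℝ 1 (fun y : realSpace F => (completeBasis F).repr y i) := fun i =>
    ((completeBasis F).coord i).toContinuousLinearMap.contDiff
  unfold RC_psi
  refine ContDiff.mul ?_ (RC_g_smooth.comp (hc w₀))
  exact contDiff_prod fun i _ => RC_h_smooth.comp (hc i)

lemma RC_psi_bdd : ∃ B : ℝ, ∀ y : realSpace F, RC_psi F y ≠ 0 → ∀ w, |y w| ≤ B := by
  classical
  refine ⟨∑ i, ‖(completeBasis F) i‖, fun y hy w => ?_⟩
  have h1 : ∀ i, |(completeBasis F).repr y i| ≤ 1 := by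
    intro i
    by_contra hcon
    push Not at hcon
    apply hy
    unfold RC_psi
    by_cases hi : i = w₀
    · subst hi
      rw [RC_g_zero hcon.le, mul_zero]
    · rw [Finset.prod_eq_zero (Finset.mem_univ (⟨i, hi⟩ : {w : InfinitePlace F // w ≠ w₀})) (RC_h_zero hcon.le), zero_mul]
  have h2 : ‖y‖ ≤ ∑ i, ‖(completeBasis F) i‖ := by
    conv_lhs => rw [← (completeBasis F).sum_repr y]
    refine (norm_sum_le _ _).trans (Finset.sum_le_sum fun i _ => ?_)
    rw [_root_.norm_smul]
    exact mul_le_of_le_one_left (norm_nonneg _) (h1 i)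
  exact (norm_le_pi_norm y w).trans h2

lemma RC_phi_bdd : ∃ δ R : ℝ, 0 < δ ∧ ∀ r : realSpace F, RC_phi F r ≠ 0 → ∀ w, δ ≤ r w ∧ r w ≤ R := by
  obtain ⟨B, hB⟩ := RC_psi_bdd F
  refine ⟨Real.exp (-B), Real.exp B, Real.exp_pos _, fun r hr w => ?_⟩
  unfold RC_phi at hr
  split_ifs at hr with h
  · have h1 := hB _ hr w
    have h2 : (1:ℝ) ≤ w.mult := by exact_mod_cast Nat.one_le_iff_ne_zero.2 InfinitePlace.mult_ne_zero
    simp only [abs_mul, Nat.abs_cast] at h1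
    have h3 : |Real.log (r w)| ≤ B := le_trans (le_mul_of_one_le_left (abs_nonneg _) h2) h1
    rw [abs_le] at h3
    rw [← Real.le_log_iff_exp_le (h w), ← Real.log_le_iff_le_exp (h w)]
    exact h3
  · exact absurd rfl hr

lemma RC_phi_lip : ∃ k, LipschitzWith k (RC_phi F) := by
  classical
  obtain ⟨δ, R, hδ, hb⟩ := RC_phi_bdd F
  refine ContDiff.lipschitzWith_of_hasCompactSupport (n := 1) (𝕂 := ℝ) ?_ ?_ one_ne_zero
  · apply HasCompactSupport.of_support_subset_isCompact (K := Set.Icc (fun _ => δ) (fun _ => R)) isCompact_Icc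
    intro r hr
    exact ⟨fun w => (hb r hr w).1, fun w => (hb r hr w).2⟩
  · rw [contDiff_iff_contDiffAt]
    intro r
    by_cases h : ∀ w, 0 < r w
    · have hev : RC_phi F =ᶠ[nhds r] fun r => RC_psi F (fun w => w.mult * Real.log (r w)) := by
        have : ∀ᶠ r' in nhds r, ∀ w, 0 < r' w := by
          rw [Filter.eventually_all]
          intro w
          exact (continuous_apply w).continuousAt.eventually (lt_mem_nhds (h w))
        filter_upwards [this] with r' hr'
        unfold RC_phi
        rw [if_pos hr']
      refine ContDiffAt.congr_of_eventuallyEq ?_ hev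
      refine (RC_psi_contDiff F).contDiffAt.comp (f := fun r : realSpace F => (fun w => w.mult * Real.log (r w) : realSpace F)) r ?_
      rw [contDiffAt_pi]
      intro w
      refine contDiffAt_const.mul (ContDiffAt.log ?_ (h w).ne')
      exact contDiffAt_apply ..
    · push Not at h
      obtain ⟨w, hw⟩ := h
      refine ContDiffAt.congr_of_eventuallyEq (f := fun _ => 0) contDiffAt_const ?_
      have : ∀ᶠ r' in nhds r, r' w < δ :=
        (continuous_apply w).continuousAt.eventually (gt_mem_nhds (hw.trans_lt hδ))
      filter_upwards [this] with r' hr'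
      by_contra hcon
      exact absurd (hb r' hcon w).1 (not_le.2 hr')

open Classical in
lemma RC_nap_lip : LipschitzWith 1 (fun x : mixedSpace F => (normAtAllPlaces x : realSpace F)) := by
  apply LipschitzWith.of_dist_le_mul
  intro x y
  rw [NNReal.coe_one, one_mul, dist_pi_le_iff dist_nonneg]
  intro w
  have hxy : dist x y = ‖x - y‖ := dist_eq_norm _ _
  rw [hxy, Real.dist_eq]
  have hsub : normAtPlace w (x - y) ≤ ‖x - y‖ := by
    rw [norm_eq_sup'_normAtPlace]
    exact Finset.le_sup' (f := fun w => normAtPlace w (x - y)) (Finset.mem_univ w)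
  refine le_trans ?_ hsub
  simp only [normAtAllPlaces_apply]
  rw [abs_sub_le_iff]
  constructor
  · have := normAtPlace_add_le w (x - y) y
    simp at this; linarith
  · have := normAtPlace_add_le w (y - x) x
    rw [show y - x = -(x - y) by abel, normAtPlace_neg] at this
    simp at this; linarith

end
end

section
open NumberField NumberField.mixedEmbedding NumberField.mixedEmbedding.fundamentalCone NumberField.InfinitePlace NumberField.Units NumberField.Units.dirichletUnitTheorem
section
variable (F : Type*) [Field F] [NumberField F]

noncomputable def RC_lg (x : mixedSpace F) : realSpace F := fun w => w.mult * Real.log (normAtPlace w x)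

lemma RC_lg_mul {x y : mixedSpace F} (hx : mixedEmbedding.norm x ≠ 0) (hy : mixedEmbedding.norm y ≠ 0) :
    RC_lg F (x * y) = RC_lg F x + RC_lg F y := by
  ext w
  rw [mixedEmbedding.norm_ne_zero_iff] at hx hy
  simp only [RC_lg, map_mul, Pi.add_apply]
  rw [Real.log_mul (hx w) (hy w)]; ring

noncomputable def RC_lu : Additive (𝓞 F)ˣ →+ realSpace F :=
  AddMonoidHom.mk' (fun u => RC_lg F (mixedEmbedding F (u.toMul : 𝓞 F))) (by
    intro a b
    rw [← RC_lg_mul]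
    · simp
    · simp
    · simp)

lemma RC_lu_apply (u : (𝓞 F)ˣ) : RC_lu F (Additive.ofMul u) = RC_lg F (mixedEmbedding F (u : 𝓞 F)) := rfl

lemma RC_lu_tors (u : (𝓞 F)ˣ) (hu : u ∈ torsion F) : RC_lu F (Additive.ofMul u) = 0 := by
  ext w
  rw [RC_lu_apply]
  simp only [RC_lg, normAtPlace_apply, (mem_torsion F).mp hu]
  simp

lemma RC_lu_fund (i : {w : InfinitePlace F // w ≠ w₀}) :
    RC_lu F (Additive.ofMul (fundSystem F (equivFinRank.symm i))) = completeBasis F i := by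
  rw [completeBasis_apply_of_ne]
  rfl

open Classical in
lemma RC_lu_prod (ζ : torsion F) (e : {w : InfinitePlace F // w ≠ w₀} → ℤ) :
    RC_lu F (Additive.ofMul ((ζ : (𝓞 F)ˣ) * ∏ i, (fundSystem F i) ^ (e (equivFinRank i)))) =
      ∑ i, (e i : ℝ) • completeBasis F i.1 := by
  rw [ofMul_mul, map_add, RC_lu_tors F _ ζ.2, zero_add, ofMul_prod, map_sum,
    ← Equiv.sum_comp equivFinRank]
  refine Finset.sum_congr rfl fun i _ => ?_
  rw [ofMul_zpow, map_zsmul, ← RC_lu_fund, Equiv.symm_apply_apply, Int.cast_smul_eq_zsmul]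

noncomputable def RC_unitEquiv : torsion F × ({w : InfinitePlace F // w ≠ w₀} → ℤ) ≃ (𝓞 F)ˣ :=
  Equiv.ofBijective (fun x => (x.1 : (𝓞 F)ˣ) * ∏ i, (fundSystem F i) ^ (x.2 (equivFinRank i))) (by
    constructor
    · rintro ⟨ζ, e⟩ ⟨ζ', e'⟩ h
      have := (exist_unique_eq_mul_prod F ((ζ : (𝓞 F)ˣ) * ∏ i, (fundSystem F i) ^ (e (equivFinRank i)))).unique
        (y₁ := (ζ, fun i => e (equivFinRank i))) (y₂ := (ζ', fun i => e' (equivFinRank i))) rfl h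
      rw [Prod.mk.injEq] at this ⊢
      refine ⟨this.1, ?_⟩
      ext i
      have := congrFun this.2 (equivFinRank.symm i)
      simpa using this
    · intro u
      obtain ⟨⟨ζ, e⟩, h, -⟩ := exist_unique_eq_mul_prod F u
      refine ⟨(ζ, fun i => e (equivFinRank.symm i)), ?_⟩
      simp [h])

lemma RC_phi_eq {x : mixedSpace F} (hx : mixedEmbedding.norm x ≠ 0) :
    RC_phi F (normAtAllPlaces x) = RC_psi F (RC_lg F x) := by
  rw [mixedEmbedding.norm_ne_zero_iff] at hx
  unfold RC_phi
  rw [if_pos]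
  · rfl
  · intro w
    exact lt_of_le_of_ne (normAtPlace_nonneg w x) (hx w).symm

lemma RC_repr_w0 (y : realSpace F) : ∑ w, y w = (completeBasis F).repr y w₀ * Module.finrank ℚ F := by
  classical
  conv_lhs => rw [← (completeBasis F).sum_repr y]
  have : ∀ i, ∑ w, completeBasis F i w = if i = w₀ then (Module.finrank ℚ F : ℝ) else 0 := by
    intro i
    split_ifs with h
    · subst h
      rw [completeBasis_apply_of_eq, ← Nat.cast_sum, sum_mult_eq]
    · have := completeBasis_apply_of_ne F ⟨i, h⟩
      simp only at this
      rw [this, sum_expMap_symm_apply (coe_ne_zero _)]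
      simp
  simp_rw [Finset.sum_apply]
  rw [Finset.sum_comm]
  simp_rw [Pi.smul_apply, smul_eq_mul, ← Finset.mul_sum, this]
  simp

lemma RC_log_norm {x : mixedSpace F} (hx : mixedEmbedding.norm x ≠ 0) :
    Real.log (mixedEmbedding.norm x) = ∑ w, RC_lg F x w := by
  rw [mixedEmbedding.norm_ne_zero_iff] at hx
  rw [mixedEmbedding.norm_apply, Real.log_prod (fun w _ => pow_ne_zero _ (hx w))]
  simp [RC_lg, Real.log_pow]

lemma RC_unit_sum {x : mixedSpace F} (hx : mixedEmbedding.norm x ≠ 0) :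
    HasSum (fun u : (𝓞 F)ˣ => RC_phi F (normAtAllPlaces (u • x)))
      (torsionOrder F * RC_g (Real.log (mixedEmbedding.norm x) / Module.finrank ℚ F)) := by
  classical
  have hn : (Module.finrank ℚ F : ℝ) ≠ 0 := Nat.cast_ne_zero.mpr Module.finrank_pos.ne'
  have h1 : ∀ u : (𝓞 F)ˣ, RC_phi F (normAtAllPlaces (u • x)) =
      RC_psi F (RC_lg F x + RC_lu F (Additive.ofMul u)) := by
    intro u
    rw [RC_phi_eq F (by rw [norm_unit_smul]; exact hx), unitSMul_smul, RC_lg_mul F (by simp) hx, add_comm]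
    rfl
  simp_rw [h1]
  rw [← (RC_unitEquiv F).hasSum_iff]
  have h2 : ∀ z : torsion F × ({w : InfinitePlace F // w ≠ w₀} → ℤ),
      RC_psi F (RC_lg F x + RC_lu F (Additive.ofMul (RC_unitEquiv F z))) =
      (∏ i, RC_h ((completeBasis F).repr (RC_lg F x) i.1 + z.2 i)) * RC_g (Real.log (mixedEmbedding.norm x) / Module.finrank ℚ F) := by
    rintro ⟨ζ, e⟩
    have : RC_lu F (Additive.ofMul (RC_unitEquiv F (ζ, e))) = ∑ i, (e i : ℝ) • completeBasis F i.1 := RC_lu_prod F ζ e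
    rw [this, RC_psi, RC_log_norm F hx, RC_repr_w0, mul_div_cancel_right₀ _ hn]
    have h3 : ∀ j, (completeBasis F).repr (∑ i, (e i : ℝ) • completeBasis F i.1) j = ∑ i, (e i : ℝ) * (if i.1 = j then 1 else 0) := by
      intro j
      simp [Finsupp.single_apply]
    congr 1
    · refine Finset.prod_congr rfl fun j _ => ?_
      rw [map_add, Finsupp.add_apply, h3]
      congr 2
      simp [Subtype.coe_inj]
    · rw [map_add, Finsupp.add_apply, h3]
      congr 1
      simp only [add_eq_left]
      apply Finset.sum_eq_zero
      intro i _
      rw [if_neg i.2, mul_zero]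
  simp only [Function.comp_def, h2]
  refine HasSum.mul_right _ ?_
  have := Fintype.ofFinite (torsion F)
  choose s hs1 hs2 using fun i : {w : InfinitePlace F // w ≠ w₀} => RC_h_sum ((completeBasis F).repr (RC_lg F x) i.1)
  have h4 := hasSum_sum_of_ne_finset_zero (L := SummationFilter.unconditional _)
     (f := fun z : torsion F × ({w : InfinitePlace F // w ≠ w₀} → ℤ) => ∏ i, RC_h ((completeBasis F).repr (RC_lg F x) i.1 + z.2 i))
     (s := Finset.univ ×ˢ Fintype.piFinset s) (by
      rintro ⟨ζ, e⟩ hz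
      simp only [Finset.mem_product, Finset.mem_univ, true_and, Fintype.mem_piFinset, not_forall] at hz
      obtain ⟨i, hi⟩ := hz
      exact Finset.prod_eq_zero (Finset.mem_univ i) (hs1 i _ hi))
  convert! h4
  rw [Finset.sum_product]
  simp only
  rw [← Finset.prod_univ_sum s (fun i k => RC_h ((completeBasis F).repr (RC_lg F x) i.1 + k))]
  simp [hs2, torsionOrder, Nat.card_eq_fintype_card]

open Classical in
/-- the package -/
theorem RC_A2 : ∃ (g : ℝ → ℝ) (f : mixedSpace F → ℝ) (B : ℝ), Continuous g ∧ (∀ t, 0 ≤ g t) ∧ 0 < g 0 ∧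
    (∀ t, B ≤ |t| → g t = 0) ∧ (∃ k, LipschitzWith k f) ∧ (∃ R, ∀ x, R < ‖x‖ → f x = 0) ∧ (∀ x, 0 ≤ f x) ∧
    (∀ x, mixedEmbedding.norm x = 0 → f x = 0) ∧
    ∀ x, mixedEmbedding.norm x ≠ 0 → HasSum (fun u : (𝓞 F)ˣ => f (u • x)) (g (Real.log (mixedEmbedding.norm x))) := by
  have hn : (0:ℝ) < (Module.finrank ℚ F : ℝ) := Nat.cast_pos.mpr Module.finrank_pos
  have ht : (0:ℝ) < (torsionOrder F : ℝ) := Nat.cast_pos.mpr (Nat.pos_of_ne_zero (NeZero.ne _))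
  refine ⟨fun t => torsionOrder F * RC_g (t / Module.finrank ℚ F), fun x => RC_phi F (normAtAllPlaces x),
    Module.finrank ℚ F, ?_, ?_, ?_, ?_, ?_, ?_, ?_, ?_, ?_⟩
  · exact continuous_const.mul (RC_g_smooth.continuous.comp (continuous_id.div_const _))
  · exact fun t => mul_nonneg ht.le (RC_g_nonneg _)
  · simp only [zero_div]; exact mul_pos ht RC_g_pos
  · intro t h
    simp only
    rw [RC_g_zero, mul_zero]
    rw [abs_div, abs_of_pos hn, le_div_iff₀ hn, one_mul]; exact h
  · obtain ⟨k, hk⟩ := RC_phi_lip F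
    exact ⟨_, hk.comp (RC_nap_lip F)⟩
  · obtain ⟨δ, R, hδ, hb⟩ := RC_phi_bdd F
    refine ⟨R, fun x hx => ?_⟩
    by_contra hcon
    rw [norm_eq_sup'_normAtPlace] at hx
    obtain ⟨w, -, hw⟩ := Finset.exists_mem_eq_sup' (Finset.univ_nonempty) (fun w => normAtPlace w x)
    rw [hw] at hx
    exact absurd (hb _ hcon w).2 (not_le.2 hx)
  · exact fun x => RC_phi_nonneg F _
  · intro x hx
    rw [mixedEmbedding.norm_eq_zero_iff] at hx
    obtain ⟨w, hw⟩ := hx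
    simp only [RC_phi]
    rw [if_neg]
    push Not
    exact ⟨w, hw.le⟩
  · exact fun x hx => RC_unit_sum F hx
end
end

section
section
open NumberField NumberField.mixedEmbedding MeasureTheory Module
open scoped nonZeroDivisors Classical
variable (F : Type*) [Field F] [NumberField F]

noncomputable def RC_V0 : ℝ := (volume : Measure (mixedSpace F)).real (ZSpan.fundamentalDomain (latticeBasis F))

lemma RC_V0_pos : 0 < RC_V0 F := by
  unfold RC_V0
  rw [Measure.real, ENNReal.toReal_pos_iff]
  refine ⟨pos_iff_ne_zero.2 (ZSpan.measure_fundamentalDomain_ne_zero _), ?_⟩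
  exact (ZSpan.fundamentalDomain_isBounded _).measure_lt_top

lemma RC_fin (f : mixedSpace F → ℝ) (R : ℝ) (hR : ∀ x, R < ‖x‖ → f x = 0) (t : ℝ) (ht : 0 < t) :
    {x : 𝓞 F | f (t⁻¹ • mixedEmbedding F (x : F)) ≠ 0}.Finite := by
  have h := Embeddings.finite_of_norm_le F ℂ (t * R)
  refine Set.Finite.of_finite_image (f := fun x : 𝓞 F => (x : F)) (h.subset ?_) (RingOfIntegers.coe_injective.injOn)
  rintro _ ⟨x, hx, rfl⟩
  refine ⟨x.isIntegral_coe, fun φ => ?_⟩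
  have h1 : ‖t⁻¹ • mixedEmbedding F (x : F)‖ ≤ R := by
    by_contra hcon
    exact hx (hR _ (not_le.1 hcon))
  rw [_root_.norm_smul, norm_inv, Real.norm_of_nonneg ht.le, inv_mul_le_iff₀ ht] at h1
  refine le_trans ?_ h1
  rw [norm_eq_sup'_normAtPlace]
  refine le_trans (le_of_eq ?_) (Finset.le_sup' (f := fun w => normAtPlace w _) (Finset.mem_univ (InfinitePlace.mk φ)))
  rw [normAtPlace_apply, InfinitePlace.apply]

set_option maxHeartbeats 1000000 in
lemma RC_ideal_sum (f : mixedSpace F → ℝ) (k : NNReal) (hf : LipschitzWith k f) (R : ℝ)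
    (hR : ∀ x, R < ‖x‖ → f x = 0) (c : Ideal (𝓞 F)) (hc : c ≠ ⊥) (v : 𝓞 F) :
    ∃ C, 0 ≤ C ∧ ∀ t, 1 ≤ t →
     |(∑' l : c, f (t⁻¹ • mixedEmbedding F ((v + l : 𝓞 F) : F))) * (Ideal.absNorm c * RC_V0 F) - t ^ finrank ℚ F * ∫ x, f x| ≤
       C * t ^ finrank ℚ F / t := by

  let I : (FractionalIdeal (𝓞 F)⁰ F)ˣ := Units.mk0 (c : FractionalIdeal (𝓞 F)⁰ F) (by simpa using hc)
  obtain ⟨C, hC, h⟩ := RC_lattice_sum volume (fractionalIdealLatticeBasis F I) f k hf R hR (mixedEmbedding F (v : F))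
  refine ⟨C, hC, fun t ht => ?_⟩
  have := h t ht
  rw [mixedEmbedding.finrank] at this
  have hvol : volume.real (ZSpan.fundamentalDomain (fractionalIdealLatticeBasis F I)) = Ideal.absNorm c * RC_V0 F := by
    rw [Measure.real, volume_fundamentalDomain_fractionalIdealLatticeBasis, ENNReal.toReal_mul, RC_V0,
      ENNReal.toReal_ofReal (by exact_mod_cast FractionalIdeal.absNorm_nonneg _)]
    congr 1
    simp only [I, Units.val_mk0]
    rw [FractionalIdeal.coeIdeal_absNorm]
    simp
  rw [hvol] at this
  convert this using 4
  let e : c ≃ Submodule.span ℤ (Set.range (fractionalIdealLatticeBasis F I)) :=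
    Equiv.ofBijective (fun l => ⟨mixedEmbedding F ((l : 𝓞 F) : F), by
      rw [mem_span_fractionalIdealLatticeBasis]
      exact ⟨_, by simpa [I] using l.2, rfl⟩⟩) (by
      constructor
      · intro a b hab
        have := congrArg Subtype.val hab
        exact Subtype.ext (RingOfIntegers.coe_injective (mixedEmbedding_injective F this))
      · rintro ⟨x, hx⟩
        rw [mem_span_fractionalIdealLatticeBasis] at hx
        obtain ⟨y, hy, rfl⟩ := hx
        simp only [I, Units.val_mk0, SetLike.mem_coe, FractionalIdeal.mem_coeIdeal] at hy
        obtain ⟨z, hz, rfl⟩ := hy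
        exact ⟨⟨z, hz⟩, rfl⟩)
  rw [← e.tsum_eq]
  congr 1
  ext l

  congr 2
  change _ = mixedEmbedding F (v : F) + mixedEmbedding F ((l : 𝓞 F) : F)
  rw [← map_add]
  rfl
end
end

section
section
open NumberField
open scoped nonZeroDivisors
variable (F : Type*) [Field F] [NumberField F] (m : ℕ)

def RC_RM : Submonoid (Ideal (𝓞 F)) where
  carrier := {I | I ≠ ⊥ ∧ IsCoprime I (Ideal.span {(m : 𝓞 F)})}
  one_mem' := ⟨one_ne_zero, isCoprime_one_left⟩
  mul_mem' := fun ha hb => ⟨mul_ne_zero ha.1 hb.1, ha.2.mul_left hb.2⟩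

def RC_con : Con (RC_RM F m) where
  r a b := ∃ α β : 𝓞 F, α ≠ 0 ∧ β ≠ 0 ∧ (m : 𝓞 F) ∣ α - 1 ∧ (m : 𝓞 F) ∣ β - 1 ∧
    Ideal.span {α} * (a : Ideal (𝓞 F)) = Ideal.span {β} * b
  iseqv := by
    refine ⟨fun a => ⟨1, 1, one_ne_zero, one_ne_zero, by simp, by simp, rfl⟩, ?_, ?_⟩
    · rintro a b ⟨α, β, h1, h2, h3, h4, h5⟩
      exact ⟨β, α, h2, h1, h4, h3, h5.symm⟩
    · rintro a b c ⟨α, β, h1, h2, h3, h4, h5⟩ ⟨α', β', h1', h2', h3', h4', h5'⟩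
      refine ⟨α * α', β * β', mul_ne_zero h1 h1', mul_ne_zero h2 h2', ?_, ?_, ?_⟩
      · rw [show α * α' - 1 = α' * (α - 1) + (α' - 1) by ring]
        exact dvd_add (h3.mul_left _) h3'
      · rw [show β * β' - 1 = β' * (β - 1) + (β' - 1) by ring]
        exact dvd_add (h4.mul_left _) h4'
      · rw [← Ideal.span_singleton_mul_span_singleton, ← Ideal.span_singleton_mul_span_singleton,
          mul_right_comm, h5, mul_right_comm, mul_assoc, h5', mul_assoc]
  mul' := by
    rintro a b c d ⟨α, β, h1, h2, h3, h4, h5⟩ ⟨α', β', h1', h2', h3', h4', h5'⟩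
    refine ⟨α * α', β * β', mul_ne_zero h1 h1', mul_ne_zero h2 h2', ?_, ?_, ?_⟩
    · rw [show α * α' - 1 = α' * (α - 1) + (α' - 1) by ring]
      exact dvd_add (h3.mul_left _) h3'
    · rw [show β * β' - 1 = β' * (β - 1) + (β' - 1) by ring]
      exact dvd_add (h4.mul_left _) h4'
    · rw [← Ideal.span_singleton_mul_span_singleton, ← Ideal.span_singleton_mul_span_singleton,
        Submonoid.coe_mul, Submonoid.coe_mul, mul_mul_mul_comm, h5, h5', mul_mul_mul_comm]

abbrev RC_G : Type _ := (RC_con F m).Quotient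

variable {F m}

lemma RC_eq_iff {a b : RC_RM F m} : ((a : RC_G F m) = b) ↔ ∃ α β : 𝓞 F, α ≠ 0 ∧ β ≠ 0 ∧ (m : 𝓞 F) ∣ α - 1 ∧ (m : 𝓞 F) ∣ β - 1 ∧
    Ideal.span {α} * (a : Ideal (𝓞 F)) = Ideal.span {β} * b := (RC_con F m).eq

lemma RC_cop_iff {α : 𝓞 F} : IsCoprime (Ideal.span {α}) (Ideal.span {(m : 𝓞 F)}) ↔ ∃ γ, γ ≠ 0 ∧ (m : 𝓞 F) ∣ α * γ - 1 := by
  rw [Ideal.isCoprime_span_singleton_iff]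
  constructor
  · rintro ⟨a, b, h⟩
    by_cases ha : a = 0
    · subst ha
      refine ⟨1, one_ne_zero, dvd_trans ⟨b, ?_⟩ (one_dvd _)⟩
      rw [← h]; ring
    · exact ⟨a, ha, -b, by rw [← h]; ring⟩
  · rintro ⟨γ, -, b, hb⟩
    exact ⟨γ, -b, by linear_combination hb⟩

lemma RC_principal_mem {α : 𝓞 F} (hα : α ≠ 0) {γ : 𝓞 F} (hγ : (m : 𝓞 F) ∣ α * γ - 1) : Ideal.span {α} ∈ RC_RM F m := by
  refine ⟨by simpa using hα, ?_⟩
  rw [Ideal.isCoprime_span_singleton_iff]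
  obtain ⟨b, hb⟩ := hγ
  exact ⟨γ, -b, by linear_combination hb⟩

/-- class of principal ideal depends only on residue -/
lemma RC_principal_congr {a b : RC_RM F m} {α β : 𝓞 F} (ha : (a : Ideal (𝓞 F)) = Ideal.span {α})
    (hb : (b : Ideal (𝓞 F)) = Ideal.span {β}) (h : (m : 𝓞 F) ∣ α - β) : (a : RC_G F m) = b := by
  rw [RC_eq_iff]
  have ha0 := a.2
  have hb0 := b.2
  rw [ha] at ha0
  rw [hb] at hb0
  obtain ⟨γ, hγ, hd⟩ := RC_cop_iff.1 ha0.2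
  have hα : α ≠ 0 := by simpa using ha0.1
  have hβ : β ≠ 0 := by simpa using hb0.1
  refine ⟨β * γ, α * γ, mul_ne_zero hβ hγ, mul_ne_zero hα hγ, ?_, hd, ?_⟩
  · rw [show β * γ - 1 = (α * γ - 1) - (α - β) * γ by ring]
    exact dvd_sub hd (h.mul_right _)
  · rw [ha, hb, Ideal.span_singleton_mul_span_singleton, Ideal.span_singleton_mul_span_singleton]
    congr 2; ring

variable [NeZero m]

instance RC_finq : Finite (𝓞 F ⧸ Ideal.span {(m : 𝓞 F)}) := by
  apply Ideal.finiteQuotientOfFreeOfNeBot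
  simpa using NeZero.ne m

lemma RC_pow_cong {α γ : 𝓞 F} (h : (m : 𝓞 F) ∣ α * γ - 1) : ∃ k, 0 < k ∧ (m : 𝓞 F) ∣ α ^ k - 1 := by
  let q := Ideal.Quotient.mk (Ideal.span {(m : 𝓞 F)})
  have hu : IsUnit (q α) := by
    refine IsUnit.of_mul_eq_one (q γ) ?_
    rw [← map_mul, ← sub_eq_zero, ← map_one q, ← map_sub]
    exact Ideal.Quotient.eq_zero_iff_mem.2 (Ideal.mem_span_singleton.2 h)
  obtain ⟨u, hu⟩ := hu
  obtain ⟨k, hk, h1⟩ := isOfFinOrder_iff_pow_eq_one.1 (isOfFinOrder_of_finite u)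
  refine ⟨k, hk, ?_⟩
  rw [← Ideal.mem_span_singleton, ← Ideal.Quotient.eq_zero_iff_mem, map_sub, map_pow, map_one]
  change q α ^ k - 1 = 0
  rw [← hu, ← Units.val_pow_eq_pow_val, h1]; simp

lemma RC_pow_principal (I : RC_RM F m) : ∃ k, 0 < k ∧ ∃ α : 𝓞 F, α ≠ 0 ∧ (m : 𝓞 F) ∣ α - 1 ∧ (I : Ideal (𝓞 F)) ^ k = Ideal.span {α} := by
  have hI : (I : Ideal (𝓞 F)) ∈ (Ideal (𝓞 F))⁰ := mem_nonZeroDivisors_of_ne_zero I.2.1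
  obtain ⟨h, hh, h1⟩ := isOfFinOrder_iff_pow_eq_one.1 (isOfFinOrder_of_finite (ClassGroup.mk0 ⟨_, hI⟩))
  rw [← map_pow, ClassGroup.mk0_eq_one_iff] at h1
  obtain ⟨α, hα⟩ := h1
  have hα' : (I : Ideal (𝓞 F)) ^ h = Ideal.span {α} := hα
  have hmem := (I ^ h).2
  rw [SubmonoidClass.coe_pow, hα'] at hmem
  obtain ⟨γ, hγ, hd⟩ := RC_cop_iff.1 hmem.2
  obtain ⟨k, hk, hd⟩ := RC_pow_cong hd
  refine ⟨h * k, Nat.mul_pos hh hk, α ^ k, pow_ne_zero _ (by simpa using hmem.1), hd, ?_⟩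
  rw [pow_mul, hα', Ideal.span_singleton_pow]

lemma RC_pow_eq_one (x : RC_G F m) : ∃ k, 0 < k ∧ x ^ k = 1 := by
  obtain ⟨I, rfl⟩ := Quotient.exists_rep x
  obtain ⟨k, hk, α, hα, hd, h⟩ := RC_pow_principal I
  refine ⟨k, hk, ?_⟩
  change ((I ^ k : RC_RM F m) : RC_G F m) = ((1 : RC_RM F m) : RC_G F m)
  exact RC_principal_congr (α := α) (β := 1) (by simpa using h) (by simp) hd

noncomputable instance RC_group : CommGroup (RC_G F m) :=
  { (inferInstance : CommMonoid (RC_G F m)) with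
    inv := fun x => x ^ ((RC_pow_eq_one x).choose - 1)
    inv_mul_cancel := fun x => by
      obtain ⟨h1, h2⟩ := (RC_pow_eq_one x).choose_spec
      change x ^ ((RC_pow_eq_one x).choose - 1) * x = 1
      rw [← pow_succ, Nat.sub_add_cancel h1, h2] }

variable (F m) in
noncomputable def RC_cl : RC_RM F m →* RC_G F m := (RC_con F m).mk'

lemma RC_cl_surj : Function.Surjective (RC_cl F m) := Quotient.exists_rep
lemma RC_cl_eq {a b : RC_RM F m} : RC_cl F m a = RC_cl F m b ↔ ∃ α β : 𝓞 F, α ≠ 0 ∧ β ≠ 0 ∧ (m : 𝓞 F) ∣ α - 1 ∧ (m : 𝓞 F) ∣ β - 1 ∧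
    Ideal.span {α} * (a : Ideal (𝓞 F)) = Ideal.span {β} * b := (RC_con F m).eq

instance RC_finite : Finite (RC_G F m) := by
  let c0 : RC_RM F m →* ClassGroup (𝓞 F) := ClassGroup.mk0.comp
    { toFun := fun I => ⟨I, mem_nonZeroDivisors_of_ne_zero I.2.1⟩, map_one' := rfl, map_mul' := fun _ _ => rfl }
  have hc0 : ∀ I, c0 I = 1 → ∃ α, (I : Ideal (𝓞 F)) = Ideal.span {α} := by
    intro I hI
    have : ClassGroup.mk0 ⟨(I : Ideal (𝓞 F)), mem_nonZeroDivisors_of_ne_zero I.2.1⟩ = 1 := hI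
    rw [ClassGroup.mk0_eq_one_iff] at this
    exact this.principal
  let φ : RC_G F m →* ClassGroup (𝓞 F) := (RC_con F m).lift c0 (by
    rintro a b ⟨α, β, h1, h2, h3, h4, h5⟩
    change c0 a = c0 b
    change ClassGroup.mk0 _ = ClassGroup.mk0 _
    rw [ClassGroup.mk0_eq_mk0_iff]
    exact ⟨α, β, h1, h2, h5⟩)
  have hker : Finite φ.ker := by
    choose! γ hγ using hc0
    have hr : ∀ x : φ.ker, ∃ I : RC_RM F m, RC_cl F m I = x.1 := fun x => RC_cl_surj _
    choose r hr using hr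
    have hr1 : ∀ x, c0 (r x) = 1 := by
      intro x
      have := x.2
      rw [← hr x] at this
      exact this
    refine Finite.of_injective (fun x => Ideal.Quotient.mk (Ideal.span {(m : 𝓞 F)}) (γ (r x))) ?_
    intro x y hxy
    apply Subtype.ext
    rw [← hr x, ← hr y]
    refine RC_principal_congr (hγ _ (hr1 x)) (hγ _ (hr1 y)) ?_
    rw [← Ideal.mem_span_singleton]
    exact Ideal.Quotient.eq.1 hxy
  have : Finite (RC_G F m ⧸ φ.ker) := Finite.of_injective _ (QuotientGroup.kerLift_injective φ)
  exact Finite.of_equiv _ (Subgroup.groupEquivQuotientProdSubgroup (s := φ.ker)).symm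

end
end

section
section
open NumberField NumberField.mixedEmbedding MeasureTheory Module
open scoped nonZeroDivisors Classical
variable {F : Type*} [Field F] [NumberField F] {m : ℕ} [NeZero m]

noncomputable def RC_t (a : Ideal (𝓞 F)) (v : ℝ) : ℝ := (Real.exp v * Ideal.absNorm a) ^ (1 / (finrank ℚ F : ℝ))

lemma RC_absNorm_pos {a : Ideal (𝓞 F)} (ha : a ≠ ⊥) : (1:ℝ) ≤ Ideal.absNorm a := by
  have : Ideal.absNorm a ≠ 0 := by simpa [Ideal.absNorm_eq_zero_iff] using ha
  exact_mod_cast Nat.one_le_iff_ne_zero.2 this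

lemma RC_t_pow {a : Ideal (𝓞 F)} (ha : a ≠ ⊥) (v : ℝ) : RC_t a v ^ finrank ℚ F = Real.exp v * Ideal.absNorm a := by
  have h1 := RC_absNorm_pos ha
  rw [RC_t, ← Real.rpow_natCast, ← Real.rpow_mul (by positivity), one_div,
    inv_mul_cancel₀ (Nat.cast_ne_zero.mpr finrank_pos.ne'), Real.rpow_one]

lemma RC_t_ge {a : Ideal (𝓞 F)} (ha : a ≠ ⊥) (v : ℝ) : Real.exp (v * (1 / (finrank ℚ F : ℝ))) ≤ RC_t a v := by
  rw [RC_t, Real.exp_mul]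
  refine Real.rpow_le_rpow (Real.exp_pos _).le ?_ (by positivity)
  exact le_mul_of_one_le_right (Real.exp_pos _).le (RC_absNorm_pos ha)

lemma RC_t_ge_one {a : Ideal (𝓞 F)} (ha : a ≠ ⊥) {v : ℝ} (hv : 0 ≤ v) : 1 ≤ RC_t a v :=
  le_trans (Real.one_le_exp (by positivity)) (RC_t_ge ha v)

lemma RC_coset_est (f : mixedSpace F → ℝ) (k : NNReal) (hf : LipschitzWith k f) (R : ℝ)
    (hR : ∀ x, R < ‖x‖ → f x = 0) (a : Ideal (𝓞 F)) (ha : a ≠ ⊥) (z : 𝓞 F) :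
    ∃ C, 0 ≤ C ∧ ∀ v, 0 ≤ v →
    |(∑' l : (Ideal.span {(m : 𝓞 F)} * a : Ideal (𝓞 F)), f ((RC_t a v)⁻¹ • mixedEmbedding F ((z + l : 𝓞 F) : F))) -
      ((∫ x, f x) / (Ideal.absNorm (Ideal.span {(m : 𝓞 F)}) * RC_V0 F)) * Real.exp v| ≤ C * Real.exp (v * (1 - 1 / (finrank ℚ F : ℝ))) := by
  have hm : Ideal.span {(m : 𝓞 F)} ≠ ⊥ := by simpa using NeZero.ne m
  obtain ⟨C, hC, h⟩ := RC_ideal_sum F f k hf R hR (Ideal.span {(m : 𝓞 F)} * a) (mul_ne_zero hm ha) z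
  have hV := RC_V0_pos F
  have hNa := RC_absNorm_pos ha
  have hNm := RC_absNorm_pos hm
  have hNa' : (0:ℝ) < Ideal.absNorm a := by linarith
  have hNm' : (0:ℝ) < Ideal.absNorm (Ideal.span {(m : 𝓞 F)}) := by linarith
  refine ⟨C / (Ideal.absNorm (Ideal.span {(m : 𝓞 F)}) * RC_V0 F), by positivity, fun v hv => ?_⟩
  have h1 := h (RC_t a v) (RC_t_ge_one ha hv)
  set S := ∑' l : (Ideal.span {(m : 𝓞 F)} * a : Ideal (𝓞 F)), f ((RC_t a v)⁻¹ • mixedEmbedding F ((z + l : 𝓞 F) : F))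
  rw [RC_t_pow ha, map_mul, Nat.cast_mul] at h1
  set J := ∫ x, f x
  set A := (Ideal.absNorm a : ℝ)
  set M := (Ideal.absNorm (Ideal.span {(m : 𝓞 F)}) : ℝ)
  have h2 : S - J / (M * RC_V0 F) * Real.exp v = (S * (M * A * RC_V0 F) - Real.exp v * A * J) / (M * A * RC_V0 F) := by
    field_simp
  rw [h2, abs_div, abs_of_pos (show 0 < M * A * RC_V0 F by positivity), div_le_iff₀ (by positivity)]
  refine h1.trans ?_
  have ht := RC_t_ge ha v
  have h3 : C * (Real.exp v * A) / RC_t a v ≤ C * (Real.exp v * A) / Real.exp (v * (1 / (finrank ℚ F : ℝ))) := by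
    gcongr
  refine h3.trans (le_of_eq ?_)
  rw [mul_sub, mul_one, Real.exp_sub]
  field_simp

variable (F m) in
def RC_H0 : Set (𝓞 F ⧸ Ideal.span {(m : 𝓞 F)}) :=
  {r | ∃ (J : RC_RM F m) (γ : 𝓞 F), (J : Ideal (𝓞 F)) = Ideal.span {γ} ∧ RC_cl F m J = 1 ∧ Ideal.Quotient.mk _ γ = r}

lemma RC_H0_iff {α : 𝓞 F} (hα : α ≠ 0) : Ideal.Quotient.mk _ α ∈ RC_H0 F m ↔
    ∃ J : RC_RM F m, (J : Ideal (𝓞 F)) = Ideal.span {α} ∧ RC_cl F m J = 1 := by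
  constructor
  · rintro ⟨J, γ, h1, h2, h3⟩
    rw [Ideal.Quotient.eq, Ideal.mem_span_singleton] at h3
    have hJ := J.2.2
    rw [h1] at hJ
    obtain ⟨δ, -, hδ⟩ := RC_cop_iff.1 hJ
    have : Ideal.span {α} ∈ RC_RM F m := RC_principal_mem hα (γ := δ) (by
      rw [show α * δ - 1 = (γ * δ - 1) - (γ - α) * δ by ring]
      exact dvd_sub hδ (h3.mul_right _))
    refine ⟨⟨_, this⟩, rfl, ?_⟩
    rw [← h2]
    exact (RC_principal_congr h1 rfl h3).symm
  · rintro ⟨J, h1, h2⟩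
    exact ⟨J, α, h1, h2, rfl⟩

lemma RC_key1 {A : Type*} [CommRing A] (M a : Ideal A) (hcop : IsCoprime M a) (H : Set (A ⧸ M)) [Fintype H]
   (φ : A → ℝ) (hφ : φ.HasFiniteSupport) (z : H → A) (hza : ∀ r, z r ∈ a) (hzr : ∀ r, Ideal.Quotient.mk M (z r) = r) :
   ∑' α : {α : A | α ∈ a ∧ Ideal.Quotient.mk M α ∈ H}, φ α = ∑ r, ∑' l : (M * a : Ideal A), φ (z r + l) := by
  let e : H × (M * a : Ideal A) ≃ {α : A | α ∈ a ∧ Ideal.Quotient.mk M α ∈ H} := Equiv.ofBijective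
    (fun w => ⟨z w.1 + w.2, by
      refine ⟨add_mem (hza _) (Ideal.mul_le_right w.2.2), ?_⟩
      rw [map_add, hzr, Ideal.Quotient.eq_zero_iff_mem.2 (Ideal.mul_le_left w.2.2), add_zero]
      exact w.1.2⟩) (by
      constructor
      · rintro ⟨r, l⟩ ⟨r', l'⟩ h
        have h1 : z r + l = z r' + l' := congrArg Subtype.val h
        have h2 : r = r' := by
          apply Subtype.ext
          have := congrArg (Ideal.Quotient.mk M) h1
          rwa [map_add, hzr, Ideal.Quotient.eq_zero_iff_mem.2 (Ideal.mul_le_left l.2), add_zero,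
            map_add, hzr, Ideal.Quotient.eq_zero_iff_mem.2 (Ideal.mul_le_left l'.2), add_zero] at this
        subst h2
        rw [Prod.mk.injEq]
        exact ⟨rfl, Subtype.ext (add_left_cancel h1)⟩
      · rintro ⟨α, h1, h2⟩
        refine ⟨(⟨_, h2⟩, ⟨α - z ⟨_, h2⟩, ?_⟩), ?_⟩
        · rw [Ideal.mul_eq_inf_of_isCoprime hcop]
          exact ⟨Ideal.Quotient.eq.1 (hzr ⟨_, h2⟩).symm, sub_mem h1 (hza _)⟩
        · apply Subtype.ext
          simp)
  have hinj : Function.Injective (fun w => ((e w : {α : A | α ∈ a ∧ Ideal.Quotient.mk M α ∈ H}) : A)) := Subtype.val_injective.comp e.injective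
  have hsum : Summable (fun w => φ (e w)) := 
    (summable_of_hasFiniteSupport hφ).comp_injective hinj
  rw [← e.tsum_eq, hsum.tsum_prod, tsum_fintype]
  rfl

lemma RC_key2 {A ι : Type*} [CommRing A] (S : Set A) (φ : A → ℝ) (hφ : φ.HasFiniteSupport) (h0 : φ 0 = 0)
   (γ : ι → A) (hS : ∀ i (u : Aˣ), (u : A) * γ i ∈ S) 
   (hinj : Function.Injective (fun w : ι × Aˣ => (w.2 : A) * γ w.1)) (hsurj : ∀ α ∈ S, α ≠ 0 → ∃ i, ∃ u : Aˣ, (u : A) * γ i = α) :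
   ∑' α : S, φ α = ∑' i, ∑' u : Aˣ, φ (u * γ i) := by
  let e : ι × Aˣ → S := fun w => ⟨_, hS w.1 w.2⟩
  have he : Function.Injective e := fun x y h => hinj (congrArg Subtype.val h)
  have hsum : Summable (fun w => φ (e w)) := 
    (summable_of_hasFiniteSupport hφ).comp_injective hinj
  rw [← he.tsum_eq (f := fun α : S => φ α), hsum.tsum_prod]
  rintro ⟨α, hα⟩ hne
  obtain ⟨i, u, h⟩ := hsurj α hα (by rintro rfl; exact hne h0)
  exact ⟨(i, u), Subtype.ext h⟩
lemma RC_cl_one' {J : Ideal (𝓞 F)} {α β : 𝓞 F} (h1 : α ≠ 0) (h5 : Ideal.span {α} * J = Ideal.span {β}) : 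
  ∃ γ, J = Ideal.span {γ} := by
  have : β ∈ Ideal.span {α} * J := by rw [h5]; exact Ideal.mem_span_singleton_self β
  have h6 : β ∈ Ideal.span {α} := (Ideal.mul_le_left : Ideal.span {α} * J ≤ _) this
  obtain ⟨γ, rfl⟩ := Ideal.mem_span_singleton.1 h6
  have h7 : Ideal.span {α} ≠ 0 := by simpa using h1
  refine ⟨γ, mul_left_cancel₀ h7 ?_⟩
  rw [h5, Ideal.span_singleton_mul_span_singleton]

lemma RC_cl_one {J : RC_RM F m} (h : RC_cl F m J = 1) : ∃ γ, (J : Ideal (𝓞 F)) = Ideal.span {γ} := by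
  have h0 : RC_cl F m J = RC_cl F m 1 := h.trans (map_one _).symm
  obtain ⟨α, β, h1, h2, h3, h4, h5⟩ := RC_cl_eq.1 h0
  refine RC_cl_one' (β := β) h1 (h5.trans ?_)
  exact mul_one _

lemma RC_norm_eq (γ : 𝓞 F) : mixedEmbedding.norm (mixedEmbedding F (γ : F)) = Ideal.absNorm (Ideal.span {γ}) := by
  rw [norm_eq_norm, Ideal.absNorm_span_singleton, ← Algebra.coe_norm_int, Nat.cast_natAbs]
  push_cast
  rfl

/-- ideals side -/
lemma RC_count_ideals (g : ℝ → ℝ) (f : mixedSpace F → ℝ) (R : ℝ)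
    (hR : ∀ x, R < ‖x‖ → f x = 0) (hf0 : ∀ x, mixedEmbedding.norm x = 0 → f x = 0)
    (hs : ∀ x, mixedEmbedding.norm x ≠ 0 → HasSum (fun u : (𝓞 F)ˣ => f (u • x)) (g (Real.log (mixedEmbedding.norm x))))
    (x : RC_G F m) (a : RC_RM F m) (ha : RC_cl F m a = x⁻¹) (v : ℝ) (hv : 0 ≤ v) :
    ∑' α : {α : 𝓞 F | α ∈ (a : Ideal (𝓞 F)) ∧ Ideal.Quotient.mk (Ideal.span {(m : 𝓞 F)}) α ∈ RC_H0 F m},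
       f ((RC_t (a : Ideal (𝓞 F)) v)⁻¹ • mixedEmbedding F ((α : 𝓞 F) : F)) =
     ∑' I : {I : RC_RM F m // RC_cl F m I = x}, g (Real.log (Ideal.absNorm (I.1 : Ideal (𝓞 F))) - v) := by
  have ha0 : (a : Ideal (𝓞 F)) ≠ ⊥ := a.2.1
  have ht0 : 0 < RC_t (a : Ideal (𝓞 F)) v := lt_of_lt_of_le one_pos (RC_t_ge_one ha0 hv)
  have h1 : ∀ I : {I : RC_RM F m // RC_cl F m I = x}, ∃ γ, ((a * I.1 : RC_RM F m) : Ideal (𝓞 F)) = Ideal.span {γ} := by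
    intro I
    apply RC_cl_one
    rw [map_mul, ha, I.2, inv_mul_cancel]
  choose γ hγ using h1
  have hγ0 : ∀ I, γ I ≠ 0 := by
    intro I h
    have := (a * I.1).2.1
    rw [hγ, h] at this
    simp at this
  rw [RC_key2 (ι := {I : RC_RM F m // RC_cl F m I = x}) _
    (fun α : 𝓞 F => f ((RC_t (a : Ideal (𝓞 F)) v)⁻¹ • mixedEmbedding F ((α : 𝓞 F) : F)))
    (RC_fin F f R hR _ ht0) (hf0 _ (by simp)) γ ?_ ?_ ?_]
  · congr 1
    ext I
    have hne : mixedEmbedding.norm ((RC_t (a : Ideal (𝓞 F)) v)⁻¹ • mixedEmbedding F ((γ I : 𝓞 F) : F)) =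
        Ideal.absNorm (I.1 : Ideal (𝓞 F)) / Real.exp v := by
      rw [mixedEmbedding.norm_smul, RC_norm_eq, ← hγ, abs_of_pos (inv_pos.2 ht0), inv_pow, RC_t_pow ha0,
        Submonoid.coe_mul, map_mul]
      have := RC_absNorm_pos ha0
      have := Real.exp_pos v
      push_cast
      field_simp
    have hI := RC_absNorm_pos I.1.2.1
    have hne0 : mixedEmbedding.norm ((RC_t (a : Ideal (𝓞 F)) v)⁻¹ • mixedEmbedding F ((γ I : 𝓞 F) : F)) ≠ 0 := by
      rw [hne]
      have := Real.exp_pos v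
      positivity
    have h2 := (hs _ hne0).tsum_eq
    rw [hne, Real.log_div (by positivity) (Real.exp_pos v).ne', Real.log_exp] at h2
    rw [← h2]
    congr 1
    ext u
    congr 1
    rw [unitSMul_smul, mul_smul_comm, ← map_mul]
    simp
  · intro I u
    have hm : (u : 𝓞 F) * γ I ∈ (a : Ideal (𝓞 F)) := by
      apply Ideal.mul_mem_left
      have : γ I ∈ ((a * I.1 : RC_RM F m) : Ideal (𝓞 F)) := by
        rw [hγ]; exact Ideal.mem_span_singleton_self _
      rw [Submonoid.coe_mul] at this
      exact Ideal.mul_le_left this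
    refine ⟨hm, ?_⟩
    rw [RC_H0_iff (mul_ne_zero u.ne_zero (hγ0 I))]
    refine ⟨a * I.1, ?_, by rw [map_mul, ha, I.2, inv_mul_cancel]⟩
    rw [hγ, Ideal.span_singleton_mul_left_unit u.isUnit]
  · rintro ⟨I, u⟩ ⟨J, w⟩ h
    have h3 : (u : 𝓞 F) * γ I = w * γ J := h
    have h2 : Ideal.span {γ I} = Ideal.span {γ J} := by
      rw [← Ideal.span_singleton_mul_left_unit u.isUnit, h3, Ideal.span_singleton_mul_left_unit w.isUnit]
    rw [← hγ, ← hγ, Submonoid.coe_mul, Submonoid.coe_mul] at h2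
    have h4 : I = J := Subtype.ext (Subtype.ext (mul_left_cancel₀ (show (a : Ideal (𝓞 F)) ≠ 0 from ha0) h2))
    subst h4
    rw [Prod.mk.injEq]
    exact ⟨rfl, Units.ext (mul_right_cancel₀ (hγ0 I) h3)⟩
  · rintro α ⟨hα1, hα2⟩ hα0
    rw [RC_H0_iff hα0] at hα2
    obtain ⟨J, hJ, hJ1⟩ := hα2
    obtain ⟨I, hI⟩ := Ideal.dvd_iff_le.2 ((Ideal.span_singleton_le_iff_mem _).2 hα1)
    have hIm : I ∈ RC_RM F m := by
      have := J.2
      rw [hJ, hI] at this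
      exact ⟨fun h => this.1 (by rw [h]; simp), this.2.of_mul_left_right⟩
    have hIa : a * ⟨I, hIm⟩ = J := Subtype.ext (by rw [Submonoid.coe_mul, hJ, hI])
    have hIx : RC_cl F m ⟨I, hIm⟩ = x := by
      rw [← hIa, map_mul, ha, inv_mul_eq_one] at hJ1
      exact hJ1.symm
    refine ⟨⟨⟨I, hIm⟩, hIx⟩, ?_⟩
    have h5 := hγ ⟨⟨I, hIm⟩, hIx⟩
    simp only at h5
    rw [hIa, hJ, Ideal.span_singleton_eq_span_singleton] at h5
    obtain ⟨u, hu⟩ := h5.symm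
    exact ⟨u, by rw [mul_comm]; exact hu⟩

lemma RC_count_class (g : ℝ → ℝ) (f : mixedSpace F → ℝ) (k : NNReal) (hf : LipschitzWith k f) (R : ℝ)
    (hR : ∀ x, R < ‖x‖ → f x = 0) (hf0 : ∀ x, mixedEmbedding.norm x = 0 → f x = 0)
    (hs : ∀ x, mixedEmbedding.norm x ≠ 0 → HasSum (fun u : (𝓞 F)ˣ => f (u • x)) (g (Real.log (mixedEmbedding.norm x))))
    (x : RC_G F m) : ∃ C, 0 ≤ C ∧ ∀ v, 0 ≤ v →
      |(∑' I : {I : RC_RM F m // RC_cl F m I = x}, g (Real.log (Ideal.absNorm (I.1 : Ideal (𝓞 F))) - v)) -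
      (Nat.card (RC_H0 F m)) * ((∫ x, f x) / (Ideal.absNorm (Ideal.span {(m : 𝓞 F)}) * RC_V0 F)) * Real.exp v| ≤
        C * Real.exp (v * (1 - 1 / (finrank ℚ F : ℝ))) := by
  obtain ⟨a, ha⟩ := RC_cl_surj (x⁻¹)
  have ha0 : (a : Ideal (𝓞 F)) ≠ ⊥ := a.2.1
  have hNa := RC_absNorm_pos ha0
  -- coset reps
  have hv : ∀ r : RC_H0 F m, ∃ z : 𝓞 F, z ∈ (a : Ideal (𝓞 F)) ∧ Ideal.Quotient.mk (Ideal.span {(m : 𝓞 F)}) z = r := by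
    rintro ⟨r, hr⟩
    obtain ⟨y, rfl⟩ := Ideal.Quotient.mk_surjective r
    obtain ⟨i, hi, j, hj, hij⟩ := Ideal.isCoprime_iff_exists.1 a.2.2
    refine ⟨y * i, Ideal.mul_mem_left _ _ hi, ?_⟩
    rw [Ideal.Quotient.eq, show y * i - y = -(y * j) by linear_combination y * hij]
    exact neg_mem (Ideal.mul_mem_left _ _ hj)
  choose z hza hzr using hv
  have hfinH : Finite (RC_H0 F m) := inferInstance
  have hfH := Fintype.ofFinite (RC_H0 F m)
  choose C hC0 hC using fun r => RC_coset_est (m := m) f k hf R hR a ha0 (z r)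
  refine ⟨∑ r, C r, Finset.sum_nonneg fun r _ => hC0 r, fun v hv => ?_⟩
  have ht0 : 0 < RC_t (a : Ideal (𝓞 F)) v := lt_of_lt_of_le one_pos (RC_t_ge_one ha0 hv)
  have key1 := RC_key1 (Ideal.span {(m : 𝓞 F)}) (a : Ideal (𝓞 F)) a.2.2.symm (RC_H0 F m)
    (fun α : 𝓞 F => f ((RC_t (a : Ideal (𝓞 F)) v)⁻¹ • mixedEmbedding F ((α : 𝓞 F) : F))) (RC_fin F f R hR _ ht0) z hza hzr
  have key2 := RC_count_ideals g f R hR hf0 hs x a ha v hv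
  rw [← key2, key1, Nat.card_eq_fintype_card, mul_assoc, ← nsmul_eq_mul, ← Finset.card_univ, ← Finset.sum_const, ← Finset.sum_sub_distrib,
    Finset.sum_mul]
  refine (Finset.abs_sum_le_sum_abs _ _).trans (Finset.sum_le_sum fun r _ => hC r v hv)
end
end

section
section
open MeasureTheory Set
variable {ι : Type*} [Countable ι] (a : ι → ℝ) (ha : ∀ i, 0 ≤ a i) (hfin : ∀ X, {i | a i ≤ X}.Finite)
  (g : ℝ → ℝ) (hg : Continuous g) (hg0 : ∀ t, 0 ≤ g t) (hg00 : 0 < g 0) (B : ℝ) (hB : ∀ t, B ≤ |t| → g t = 0)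

include hg00 hB in
lemma RC_Bpos : 0 < B := by
  by_contra h
  push Not at h
  have := hB 0 (by simpa using h)
  linarith

include hB in
lemma RC_g_supp {t : ℝ} (ht : g t ≠ 0) : -B < t ∧ t < B := by
  by_contra h
  refine ht (hB t ?_)
  rw [le_abs]
  by_contra h2
  push Not at h2
  exact h ⟨by linarith [h2.2], h2.1⟩

include hB hg in
lemma RC_g_int (φ : ℝ → ℝ) (hφ : Continuous φ) : Integrable (fun t => g t * φ t) := by
  refine Continuous.integrable_of_hasCompactSupport (hg.mul hφ) ?_
  refine HasCompactSupport.intro (K := Icc (-B) B) isCompact_Icc fun t ht => ?_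
  have : g t = 0 := by
    by_contra h
    have := RC_g_supp g B hB h
    exact ht ⟨this.1.le, this.2.le⟩
  simp [this]

include hg hB in
lemma RC_mellin (s c : ℝ) : Integrable (fun v => g (c - v) * Real.exp (-s * v)) ∧
    ∫ v, g (c - v) * Real.exp (-s * v) = Real.exp (-s * c) * ∫ u, g u * Real.exp (s * u) := by
  have h1 : (fun v => g (c - v) * Real.exp (-s * v)) = fun v => (fun u => g u * (Real.exp (-s * c) * Real.exp (s * u))) (c - v) := by
    funext v
    simp only
    rw [← Real.exp_add]; congr 2; ring
  rw [h1]
  constructor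
  · exact (RC_g_int g hg B hB (fun u => Real.exp (-s * c) * Real.exp (s * u)) (by fun_prop)).comp_sub_left c
  · rw [integral_sub_left_eq_self (fun u => g u * (Real.exp (-s * c) * Real.exp (s * u))), ← integral_const_mul]
    congr 1; funext u; ring

include hg hB hg0 hg00 in
lemma RC_G_bd : ∃ c C : ℝ, 0 < c ∧ 0 < C ∧ ∀ s, 1 ≤ s → s ≤ 2 → c ≤ ∫ u, g u * Real.exp (s * u) ∧ ∫ u, g u * Real.exp (s * u) ≤ C := by
  have hBp := RC_Bpos g hg00 B hB
  have hint : Integrable g := by simpa using RC_g_int g hg B hB (fun _ => 1) continuous_const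
  have hI : 0 < ∫ u, g u := by
    rw [integral_pos_iff_support_of_nonneg hg0 hint]
    exact (hg.isOpen_support).measure_pos _ ⟨0, hg00.ne'⟩
  refine ⟨Real.exp (-(2*B)) * ∫ u, g u, Real.exp (2*B) * ∫ u, g u, by positivity, by positivity, fun s h1 h2 => ?_⟩
  have hi2 := RC_g_int g hg B hB (fun u => Real.exp (s * u)) (by fun_prop)
  constructor
  · rw [← integral_const_mul]
    refine integral_mono (hint.const_mul _) hi2 fun u => ?_
    simp only
    by_cases h : g u = 0
    · simp [h]
    · have := RC_g_supp g B hB h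
      rw [mul_comm]
      refine mul_le_mul_of_nonneg_left (Real.exp_le_exp.2 ?_) (hg0 u)
      nlinarith
  · rw [← integral_const_mul]
    refine integral_mono hi2 (hint.const_mul _) fun u => ?_
    simp only
    by_cases h : g u = 0
    · simp [h]
    · have := RC_g_supp g B hB h
      rw [mul_comm]
      refine mul_le_mul_of_nonneg_right (Real.exp_le_exp.2 ?_) (hg0 u)
      nlinarith

include hfin hB in
lemma RC_T_fin (v : ℝ) : {i | g (a i - v) ≠ 0}.Finite := by
  refine (hfin (B + v)).subset fun i hi => ?_
  have := RC_g_supp g B hB hi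
  simp only [mem_setOf_eq]; linarith [this.2]

include ha hfin hg0 hg hB hg00 in
lemma RC_T_ext (χ : ι → ℂ) (hχ : ∀ i, ‖χ i‖ ≤ 1) (c : ℝ) (hc0 : 0 ≤ c) (hc1 : c ≤ 1) (C : ℝ)
    (hC : ∀ v, 0 ≤ v → ‖∑' i, χ i * (g (a i - v) : ℂ)‖ ≤ C * Real.exp (v * c)) :
    ∃ C', 0 < C' ∧ ∀ v, ‖∑' i, χ i * (g (a i - v) : ℂ)‖ ≤ (Ioi (-B)).indicator (fun v => C' * Real.exp (v * c)) v := by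
  have hBp := RC_Bpos g hg00 B hB
  have : ∃ M, ∀ t, g t ≤ M := by
    obtain ⟨M, hM⟩ := hg.bounded_above_of_compact_support (HasCompactSupport.intro (K := Icc (-B) B) isCompact_Icc fun t ht => by
      by_contra h
      have := RC_g_supp g B hB h
      exact ht ⟨this.1.le, this.2.le⟩)
    exact ⟨M, fun t => (le_abs_self _).trans (hM t)⟩
  obtain ⟨M, hM⟩ := this
  have hM0 : 0 ≤ M := (hg0 0).trans (hM 0)
  set D := ((hfin B).toFinset.card : ℝ) * M with hD
  have hD0 : 0 ≤ D := by positivity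
  refine ⟨|C| + D * Real.exp B + 1, by positivity, fun v => ?_⟩
  by_cases h1 : v ≤ -B
  · rw [indicator_of_notMem (by simpa using h1)]
    rw [show (fun i => χ i * (g (a i - v) : ℂ)) = fun _ => 0 from ?_]
    · simp
    funext i
    rw [hB _ (by rw [abs_of_nonneg] <;> linarith [ha i])]
    simp
  push Not at h1
  rw [indicator_of_mem (by simpa using h1)]
  by_cases h2 : 0 ≤ v
  · refine (hC v h2).trans ?_
    refine mul_le_mul_of_nonneg_right ?_ (Real.exp_pos _).le
    have := le_abs_self C
    have : 0 ≤ D * Real.exp B := by positivity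
    linarith
  · push Not at h2
    rw [tsum_eq_sum (s := (hfin B).toFinset)]
    · refine (norm_sum_le _ _).trans ?_
      refine (Finset.sum_le_card_nsmul _ _ M ?_).trans ?_
      · intro i hi
        rw [norm_mul, Complex.norm_real, Real.norm_of_nonneg (hg0 _)]
        calc _ ≤ 1 * M := mul_le_mul (hχ i) (hM _) (hg0 _) zero_le_one
          _ = M := one_mul _
      · rw [nsmul_eq_mul, ← hD]
        have : 1 ≤ Real.exp B * Real.exp (v * c) := by
          rw [← Real.exp_add]; apply Real.one_le_exp; nlinarith
        have h3 : 0 ≤ |C| * Real.exp (v * c) := by positivity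
        have h4 : 0 < Real.exp (v * c) := by positivity
        nlinarith
    · intro i hi
      have : g (a i - v) = 0 := by
        by_contra h
        have := RC_g_supp g B hB h
        exact hi (by simp; linarith)
      simp [this]

include ha hfin hg0 hg hB hg00 in
lemma RC_A4_zeta (C : ℝ) (hC : ∀ v, 0 ≤ v → ∑' i, g (a i - v) ≤ C * Real.exp v) :
    ∃ C', 0 < C' ∧ ∀ s, 1 < s → s ≤ 2 → Summable (fun i => Real.exp (-s * a i)) ∧ ∑' i, Real.exp (-s * a i) ≤ C' / (s - 1) := by
  have hBp := RC_Bpos g hg00 B hB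
  obtain ⟨C1, hC10, hC1⟩ := RC_T_ext a ha hfin g hg hg0 hg00 B hB (fun _ => 1) (by simp) 1 zero_le_one le_rfl C (by
    intro v hv
    simp only [one_mul, mul_one]
    rw [← Complex.ofReal_tsum, Complex.norm_real, Real.norm_of_nonneg (tsum_nonneg fun i => hg0 _)]
    exact hC v hv)
  obtain ⟨c, C2, hc, hC2, hG⟩ := RC_G_bd g hg hg0 hg00 B hB
  refine ⟨C1 * Real.exp B / c, by positivity, fun s hs1 hs2 => ?_⟩
  have hs0 : 0 < s - 1 := by linarith
  have key : ∀ A : Finset ι, ∑ i ∈ A, Real.exp (-s * a i) ≤ C1 * Real.exp B / c / (s - 1) := by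
    intro A
    have h1 : (∑ i ∈ A, Real.exp (-s * a i)) * c ≤ ∫ v, ∑ i ∈ A, g (a i - v) * Real.exp (-s * v) := by
      rw [integral_finset_sum _ (fun i _ => (RC_mellin g hg B hB s (a i)).1), Finset.sum_mul]
      refine Finset.sum_le_sum fun i _ => ?_
      rw [(RC_mellin g hg B hB s (a i)).2]
      exact mul_le_mul_of_nonneg_left (hG s hs1.le hs2).1 (Real.exp_pos _).le
    have h2 : ∫ v, ∑ i ∈ A, g (a i - v) * Real.exp (-s * v) ≤ ∫ v, (Ioi (-B)).indicator (fun v => C1 * Real.exp ((1 - s) * v)) v := by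
      refine integral_mono (integrable_finset_sum _ (fun i _ => (RC_mellin g hg B hB s (a i)).1)) ?_ fun v => ?_
      · rw [integrable_indicator_iff measurableSet_Ioi]
        exact (integrableOn_exp_mul_Ioi (by linarith) _).const_mul _
      · simp only
        rw [← Finset.sum_mul]
        have h3 := hC1 v
        simp only [one_mul, mul_one] at h3
        rw [← Complex.ofReal_tsum, Complex.norm_real, Real.norm_of_nonneg (tsum_nonneg fun i => hg0 _)] at h3
        have h4 : ∑ i ∈ A, g (a i - v) ≤ ∑' i, g (a i - v) :=
          Summable.sum_le_tsum _ (fun i _ => hg0 _) (summable_of_hasFiniteSupport (RC_T_fin a hfin g B hB v))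
        refine (mul_le_mul_of_nonneg_right (h4.trans h3) (Real.exp_pos _).le).trans (le_of_eq ?_)
        by_cases hv : v ∈ Ioi (-B)
        · rw [indicator_of_mem hv, indicator_of_mem hv, mul_assoc, ← Real.exp_add]; congr 2; ring
        · rw [indicator_of_notMem hv, indicator_of_notMem hv, zero_mul]
    rw [integral_indicator measurableSet_Ioi, integral_const_mul, integral_exp_mul_Ioi (by linarith)] at h2
    rw [div_div, le_div_iff₀ (by positivity)]
    have h3 : Real.exp ((1 - s) * -B) ≤ Real.exp B := Real.exp_le_exp.2 (by nlinarith)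
    have h4 : -Real.exp ((1 - s) * -B) / (1 - s) = Real.exp ((1 - s) * -B) / (s - 1) := by
      rw [← neg_sub s 1, neg_div_neg_eq]
    rw [h4] at h2
    have h5 := h1.trans h2
    rw [← mul_div_assoc, le_div_iff₀ hs0] at h5
    nlinarith
  have hsum : Summable (fun i => Real.exp (-s * a i)) := summable_of_sum_le (fun i => (Real.exp_pos _).le) key
  exact ⟨hsum, hsum.tsum_le_of_sum_le key⟩

/-- difference of Mellin transforms -/
lemma RC_exp_diff (B δ s s' v : ℝ) (hδ : 0 < δ) (hs : 1 ≤ s) (hs' : s ≤ s') (h2 : s' ≤ 2) (hv : -B < v) (hB : 0 < B) :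
    Real.exp (v * (1 - δ)) * |Real.exp (-s * v) - Real.exp (-s' * v)| ≤
      (s' - s) * ((2/δ) * Real.exp (δ * B + B) * Real.exp (-(δ/2) * v)) := by
  have h1 : |v| ≤ (2/δ) * Real.exp (δ * B + δ/2 * v) := by
    have h3 : |v| ≤ v + 2 * B := by rw [abs_le]; constructor <;> linarith
    have h4 := Real.add_one_le_exp (δ * B + δ/2 * v)
    refine h3.trans ?_
    rw [div_mul_eq_mul_div, le_div_iff₀ hδ]
    nlinarith
  have h5 : |Real.exp (-s * v) - Real.exp (-s' * v)| ≤ (s' - s) * |v| * Real.exp (B - v) := by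
    have gen : ∀ x y M : ℝ, x ≤ M → y ≤ M → |Real.exp x - Real.exp y| ≤ |x - y| * Real.exp M := by
      intro x y M hx hy
      wlog hxy : y ≤ x generalizing x y
      · rw [abs_sub_comm, abs_sub_comm x y]; exact this y x hy hx (by linarith)
      rw [abs_of_nonneg (by linarith [Real.exp_le_exp.2 hxy]), abs_of_nonneg (by linarith)]
      have h6 : Real.exp y = Real.exp x * Real.exp (y - x) := by rw [← Real.exp_add]; congr 1; ring
      have h7 := Real.add_one_le_exp (y - x)
      have h8 := Real.exp_le_exp.2 hx
      have h9 := Real.exp_pos x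
      nlinarith
    have := gen (-s * v) (-s' * v) (B - v) (by nlinarith) (by nlinarith)
    rwa [show -s * v - -s' * v = (s' - s) * v by ring, abs_mul, abs_of_nonneg (by linarith : 0 ≤ s' - s)] at this
  calc _ ≤ Real.exp (v * (1 - δ)) * ((s' - s) * ((2/δ) * Real.exp (δ * B + δ/2 * v)) * Real.exp (B - v)) := by
        refine mul_le_mul_of_nonneg_left (h5.trans ?_) (Real.exp_pos _).le
        exact mul_le_mul_of_nonneg_right (mul_le_mul_of_nonneg_left h1 (by linarith)) (Real.exp_pos _).le
    _ = (s' - s) * (2/δ) * (Real.exp (v * (1 - δ)) * (Real.exp (δ * B + δ/2 * v) * Real.exp (B - v))) := by ring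
    _ = _ := by
        rw [← Real.exp_add, ← Real.exp_add, show v * (1 - δ) + (δ * B + δ/2 * v + (B - v)) = δ * B + B + -(δ/2) * v by ring, Real.exp_add (δ * B + B)]; ring

include ha hfin hg0 hg hB hg00 in
lemma RC_A4_char (hz : ∀ s, 1 < s → s ≤ 2 → Summable (fun i => Real.exp (-s * a i)))
    (χ : ι → ℂ) (hχ : ∀ i, ‖χ i‖ ≤ 1) (δ : ℝ) (hδ0 : 0 < δ) (hδ1 : δ ≤ 1) (C : ℝ)
    (hC : ∀ v, 0 ≤ v → ‖∑' i, χ i * (g (a i - v) : ℂ)‖ ≤ C * Real.exp (v * (1 - δ))) :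
    ∃ C', 0 < C' ∧ (∀ s, 1 < s → s ≤ 2 → ‖∑' i, χ i * (Real.exp (-s * a i) : ℂ)‖ ≤ C') ∧
      ((∀ s, 1 < s → s ≤ 2 → ‖∑' i, χ i * (Real.exp (-s * a i) : ℂ)‖ ≤ C' * (s - 1)) ∨
        ∃ c > 0, ∃ s₀ > 1, ∀ s, 1 < s → s ≤ s₀ → c ≤ ‖∑' i, χ i * (Real.exp (-s * a i) : ℂ)‖) := by
  have hBp := RC_Bpos g hg00 B hB
  obtain ⟨C1, hC10, hC1⟩ := RC_T_ext a ha hfin g hg hg0 hg00 B hB χ hχ (1 - δ) (by linarith) (by linarith) C hC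
  obtain ⟨c, C2, hc, hC2, hG⟩ := RC_G_bd g hg hg0 hg00 B hB
  set G : ℝ → ℝ := fun s => ∫ u, g u * Real.exp (s * u) with hGdef
  set L : ℝ → ℂ := fun s => ∑' i, χ i * (Real.exp (-s * a i) : ℂ) with hL
  have hsumL : ∀ s, 1 < s → s ≤ 2 → Summable (fun i => χ i * (Real.exp (-s * a i) : ℂ)) := by
    intro s h1 h2
    refine Summable.of_norm_bounded (hz s h1 h2) fun i => ?_
    rw [norm_mul, Complex.norm_real, Real.norm_of_nonneg (Real.exp_pos _).le]
    exact mul_le_of_le_one_left (Real.exp_pos _).le (hχ i)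
  have hFint : ∀ s i, Integrable (fun v => χ i * ((g (a i - v) * Real.exp (-s * v) : ℝ) : ℂ)) := fun s i =>
    ((RC_mellin g hg B hB s (a i)).1.ofReal).const_mul _
  have hFi : ∀ s i, ∫ v, χ i * ((g (a i - v) * Real.exp (-s * v) : ℝ) : ℂ) = χ i * (Real.exp (-s * a i) : ℂ) * G s := by
    intro s i
    rw [integral_const_mul, integral_complex_ofReal, (RC_mellin g hg B hB s (a i)).2]
    push_cast; ring
  have hFn : ∀ s, 1 < s → s ≤ 2 → Summable (fun i => ∫ v, ‖χ i * ((g (a i - v) * Real.exp (-s * v) : ℝ) : ℂ)‖) := by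
    intro s h1 h2
    refine Summable.of_nonneg_of_le (fun i => integral_nonneg fun v => norm_nonneg _) (fun i => ?_) ((hz s h1 h2).mul_right (G s))
    rw [← (RC_mellin g hg B hB s (a i)).2]
    refine integral_mono (hFint s i).norm (RC_mellin g hg B hB s (a i)).1 fun v => ?_
    simp only
    rw [norm_mul, Complex.norm_real, Real.norm_of_nonneg (mul_nonneg (hg0 _) (Real.exp_pos _).le)]
    exact mul_le_of_le_one_left (mul_nonneg (hg0 _) (Real.exp_pos _).le) (hχ i)
  have hΛ : ∀ s, 1 < s → s ≤ 2 → L s * G s = ∫ v, (∑' i, χ i * (g (a i - v) : ℂ)) * (Real.exp (-s * v) : ℂ) := by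
    intro s h1 h2
    have := hasSum_integral_of_summable_integral_norm (hFint s) (hFn s h1 h2)
    simp only [hFi] at this
    rw [hL]; simp only
    rw [← tsum_mul_right, this.tsum_eq]
    congr 1; funext v
    rw [← tsum_mul_right]; congr 1; funext i; push_cast; ring
  have hΛd : ∀ s s', 1 < s → s ≤ 2 → 1 < s' → s' ≤ 2 → L s * G s - L s' * G s' =
      ∫ v, (∑' i, χ i * (g (a i - v) : ℂ)) * ((Real.exp (-s * v) - Real.exp (-s' * v) : ℝ) : ℂ) := by
    intro s s' h1 h2 h1' h2'
    have := hasSum_integral_of_summable_integral_norm (F := fun i v => χ i * ((g (a i - v) * Real.exp (-s * v) : ℝ) : ℂ) -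
      χ i * ((g (a i - v) * Real.exp (-s' * v) : ℝ) : ℂ)) (fun i => (hFint s i).sub (hFint s' i)) (by
        refine Summable.of_nonneg_of_le (fun i => integral_nonneg fun v => norm_nonneg _) (fun i => ?_) ((hFn s h1 h2).add (hFn s' h1' h2'))
        rw [← integral_add (hFint s i).norm (hFint s' i).norm]
        exact integral_mono ((hFint s i).sub (hFint s' i)).norm ((hFint s i).norm.add (hFint s' i).norm) fun v => norm_sub_le _ _)
    have h3 : ∀ i, ∫ v, (χ i * ((g (a i - v) * Real.exp (-s * v) : ℝ) : ℂ) -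
      χ i * ((g (a i - v) * Real.exp (-s' * v) : ℝ) : ℂ)) = χ i * (Real.exp (-s * a i) : ℂ) * G s - χ i * (Real.exp (-s' * a i) : ℂ) * G s' := by
      intro i
      rw [integral_sub (hFint s i) (hFint s' i), hFi, hFi]
    simp only [h3] at this
    rw [hL]; simp only
    rw [← tsum_mul_right, ← tsum_mul_right, ← ((hsumL s h1 h2).mul_right _).tsum_sub ((hsumL s' h1' h2').mul_right _), this.tsum_eq]
    congr 1; funext v
    rw [← tsum_mul_right]; congr 1; funext i; push_cast; ring
  -- bounds
  set D1 := ∫ v in Ioi (-B), C1 * Real.exp B * Real.exp (-δ * v) with hD1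
  set D2 := ∫ v in Ioi (-B), C1 * ((2/δ) * Real.exp (δ * B + B) * Real.exp (-(δ/2) * v)) with hD2
  have hD1n : 0 ≤ D1 := integral_nonneg fun v => by positivity
  have hD2n : 0 ≤ D2 := integral_nonneg fun v => by positivity
  have hb1 : ∀ s, 1 < s → s ≤ 2 → ‖L s * G s‖ ≤ D1 := by
    intro s h1 h2
    rw [hΛ s h1 h2, hD1, ← integral_indicator measurableSet_Ioi]
    refine norm_integral_le_of_norm_le ?_ (Filter.Eventually.of_forall fun v => ?_)
    · rw [integrable_indicator_iff measurableSet_Ioi]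
      exact (integrableOn_exp_mul_Ioi (by linarith) _).const_mul _
    · rw [norm_mul, Complex.norm_real, Real.norm_of_nonneg (Real.exp_pos _).le]
      refine (mul_le_mul_of_nonneg_right (hC1 v) (Real.exp_pos _).le).trans ?_
      by_cases hv : v ∈ Ioi (-B)
      · rw [indicator_of_mem hv, indicator_of_mem hv, mul_assoc, mul_assoc, ← Real.exp_add, ← Real.exp_add]
        refine mul_le_mul_of_nonneg_left (Real.exp_le_exp.2 ?_) hC10.le
        simp only [mem_Ioi] at hv
        nlinarith
      · rw [indicator_of_notMem hv, indicator_of_notMem hv, zero_mul]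
  have hb2 : ∀ s s', 1 < s → s ≤ s' → s' ≤ 2 → ‖L s * G s - L s' * G s'‖ ≤ (s' - s) * D2 := by
    intro s s' h1 h2 h3
    rw [hΛd s s' h1 (by linarith) (by linarith) h3, hD2, ← integral_const_mul, ← integral_indicator measurableSet_Ioi]
    refine norm_integral_le_of_norm_le ?_ (Filter.Eventually.of_forall fun v => ?_)
    · rw [integrable_indicator_iff measurableSet_Ioi]
      exact (((integrableOn_exp_mul_Ioi (by linarith) _).const_mul _).const_mul _).const_mul _
    · rw [norm_mul, Complex.norm_real, Real.norm_eq_abs]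
      refine (mul_le_mul_of_nonneg_right (hC1 v) (abs_nonneg _)).trans ?_
      by_cases hv : v ∈ Ioi (-B)
      · rw [indicator_of_mem hv, indicator_of_mem hv, mul_assoc]
        have := mul_le_mul_of_nonneg_left (RC_exp_diff B δ s s' v hδ0 h1.le h2 h3 hv hBp) hC10.le
        linarith
      · rw [indicator_of_notMem hv, indicator_of_notMem hv, zero_mul]
  have hnorm : ∀ s, 1 < s → s ≤ 2 → ‖L s * G s‖ = ‖L s‖ * G s ∧ c ≤ G s ∧ G s ≤ C2 := by
    intro s h1 h2
    have := hG s h1.le h2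
    refine ⟨?_, this⟩
    rw [norm_mul, Complex.norm_real, Real.norm_of_nonneg (hc.le.trans this.1)]
  refine ⟨(D1 + D2 + 1) / c, by positivity, fun s h1 h2 => ?_, ?_⟩
  · obtain ⟨e1, e2, e3⟩ := hnorm s h1 h2
    have := hb1 s h1 h2
    rw [le_div_iff₀ hc]
    have h4 : ‖L s‖ * c ≤ ‖L s‖ * G s := mul_le_mul_of_nonneg_left e2 (norm_nonneg _)
    linarith
  · by_cases hall : ∀ s, 1 < s → s ≤ 2 → ‖L s * G s‖ ≤ D2 * (s - 1)
    · left
      intro s h1 h2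
      obtain ⟨e1, e2, e3⟩ := hnorm s h1 h2
      have := hall s h1 h2
      rw [div_mul_eq_mul_div, le_div_iff₀ hc]
      have h4 : ‖L s‖ * c ≤ ‖L s‖ * G s := mul_le_mul_of_nonneg_left e2 (norm_nonneg _)
      nlinarith
    · right
      push Not at hall
      obtain ⟨s₀, h1, h2, h3⟩ := hall
      refine ⟨(‖L s₀ * G s₀‖ - D2 * (s₀ - 1)) / C2, div_pos (by linarith) hC2, s₀, h1, fun s h4 h5 => ?_⟩
      obtain ⟨e1, e2, e3⟩ := hnorm s h4 (by linarith)
      have h6 := hb2 s s₀ h4 h5 h2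
      have h7 := norm_sub_norm_le (L s₀ * G s₀) (L s * G s)
      rw [norm_sub_rev] at h7
      rw [div_le_iff₀ hC2]
      have h8 : ‖L s‖ * G s ≤ ‖L s‖ * C2 := mul_le_mul_of_nonneg_left e3 (norm_nonneg _)
      nlinarith
end
end

section
section
open Filter Topology
variable {M : Type*} [CommMonoid M] (PP : Set M)
  (hP1 : ∀ P ∈ PP, ∀ x y, P ∣ x * y → P ∣ x ∨ P ∣ y)
  (hPc : ∀ P ∈ PP, ∀ x y : M, P * x = P * y → x = y)
  (hPd : ∀ P ∈ PP, ∀ P' ∈ PP, P ∣ P' → P = P')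
  (hPe : ∀ x : M, x ≠ 1 → ∃ P ∈ PP, P ∣ x)

open Classical in
include hP1 hPc hPd in
lemma RC_sieve (h : M →* ℂ) (hs : Summable h) (S : Finset PP) :
    (∏ P ∈ S, (1 - h P.1)) * ∑' x, h x = ∑' x, if (∀ P ∈ S, ¬ P.1 ∣ x) then h x else 0 := by
  induction S using Finset.induction_on with
  | empty => simp
  | insert P S hPS ih =>
    rw [Finset.prod_insert hPS, mul_assoc, ih, sub_mul, one_mul]
    have hsum : ∀ (A : M → Prop) [DecidablePred A], Summable (fun x => if A x then h x else 0) := by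
      intro A _
      refine Summable.of_norm_bounded hs.norm fun x => ?_
      split_ifs <;> simp
    have h1 : h P.1 * ∑' x, (if (∀ P ∈ S, ¬ P.1 ∣ x) then h x else 0) =
        ∑' x, if (P.1 ∣ x ∧ ∀ P ∈ S, ¬ P.1 ∣ x) then h x else 0 := by
      rw [← tsum_mul_left]
      have hinj : Function.Injective (fun y => P.1 * y) := fun x y hxy => hPc P.1 P.2 x y hxy
      rw [← hinj.tsum_eq (f := fun x => if (P.1 ∣ x ∧ ∀ P ∈ S, ¬ P.1 ∣ x) then h x else 0)]
      · refine tsum_congr fun y => ?_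
        have : (∀ P' ∈ S, ¬ P'.1 ∣ P.1 * y) ↔ (∀ P' ∈ S, ¬ P'.1 ∣ y) := by
          refine forall₂_congr fun P' hP' => not_congr ⟨fun hd => ?_, fun hd => Dvd.dvd.mul_left hd _⟩
          rcases hP1 P'.1 P'.2 _ _ hd with h3 | h3
          · exact absurd (Subtype.ext (hPd _ P'.2 _ P.2 h3)) (fun h4 => hPS (h4 ▸ hP'))
          · exact h3
        simp only [this, dvd_mul_right, true_and]
        split_ifs <;> simp
      · intro x hx
        simp only [Function.mem_support, ne_eq, ite_eq_right_iff, not_forall] at hx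
        obtain ⟨⟨⟨y, rfl⟩, _⟩, _⟩ := hx
        exact ⟨y, rfl⟩
    rw [h1, ← (hsum _).tsum_sub (hsum _)]
    refine tsum_congr fun x => ?_
    simp only [Finset.forall_mem_insert]
    by_cases h2 : P.1 ∣ x <;> by_cases h3 : ∀ P ∈ S, ¬ P.1 ∣ x <;> simp [h2, h3]

include hP1 hPc hPd hPe in
lemma RC_euler (h : M →* ℂ) (hs : Summable h) (hu : ∀ P ∈ PP, ¬ P ∣ 1) :
    Tendsto (fun S : Finset PP => (∏ P ∈ S, (1 - h P.1)) * ∑' x, h x) atTop (𝓝 1) := by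
  classical
  simp_rw [RC_sieve PP hP1 hPc hPd h hs]
  have h1 : (1:ℂ) = ∑' x : M, if x = 1 then 1 else 0 := by rw [tsum_ite_eq]
  rw [h1]
  refine tendsto_tsum_of_dominated_convergence hs.norm ?_ ?_
  · intro x
    by_cases hx : x = 1
    · subst hx
      rw [if_pos rfl]
      refine tendsto_const_nhds.congr' (Eventually.of_forall fun S => ?_)
      simp only
      rw [if_pos (fun (P : PP) _ => hu P.1 P.2), map_one]
    · obtain ⟨P, hP, hd⟩ := hPe x hx
      rw [if_neg hx]
      refine tendsto_const_nhds.congr' ?_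
      filter_upwards [eventually_ge_atTop {⟨P, hP⟩}] with S hS
      rw [if_neg]
      intro h2
      exact h2 ⟨P, hP⟩ (by simpa using hS) hd
  · refine Eventually.of_forall fun S x => ?_
    split_ifs <;> simp

lemma RC_U (z : ℂ) : ‖1 - z‖ ^ 2 ≤ Real.exp (-2 * z.re + ‖z‖ ^ 2) := by
  have : ‖1 - z‖ ^ 2 = 1 - 2 * z.re + ‖z‖ ^ 2 := by
    rw [← Complex.normSq_eq_norm_sq, ← Complex.normSq_eq_norm_sq, Complex.normSq_apply, Complex.normSq_apply]; simp; ring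
  have h2 := Real.add_one_le_exp (-2 * z.re + ‖z‖ ^ 2)
  linarith

lemma RC_Lo (z : ℂ) (hz : ‖z‖ ≤ 1 / 2) : Real.exp (-(2 * z.re + 25 * ‖z‖ ^ 2)) ≤ ‖1 - z‖ ^ 2 := by
  have h1 : ‖1 - z‖ ^ 2 = 1 - 2 * z.re + ‖z‖ ^ 2 := by
    rw [← Complex.normSq_eq_norm_sq, ← Complex.normSq_eq_norm_sq, Complex.normSq_apply, Complex.normSq_apply]; simp; ring
  have h0 : 1/2 ≤ ‖1 - z‖ := by
    have := norm_sub_norm_le 1 z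
    simp at this; linarith
  have h2 := Real.add_one_le_exp (2 * z.re + 25 * ‖z‖ ^ 2)
  rw [Real.exp_neg]
  have h3 := abs_le.1 (Complex.abs_re_le_norm z)
  have h4 := norm_nonneg z
  have h5 : 1/4 ≤ ‖1 - z‖ ^ 2 := by nlinarith
  refine inv_le_of_inv_le₀ (by positivity) (le_trans ?_ h2)
  rw [inv_le_iff_one_le_mul₀ (by positivity)]
  rw [h1] at h5 ⊢
  set r := z.re
  set x := ‖z‖
  have h6 : r ^ 2 ≤ x ^ 2 := by nlinarith
  have hx2 : x ^ 2 ≤ 1 / 4 := by nlinarith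
  have : (2 * r - x^2)^2 ≤ 25/4 * x^2 := by
    have : |2 * r - x^2| ≤ 5/2 * x := by rw [abs_le]; constructor <;> nlinarith
    have := sq_abs (2 * r - x^2) ▸ pow_le_pow_left₀ (abs_nonneg _) this 2
    nlinarith
  nlinarith
end
end

section
section
open Filter Topology
variable {M : Type*} [CommMonoid M] (PP : Set M)
  (hP1 : ∀ P ∈ PP, ∀ x y, P ∣ x * y → P ∣ x ∨ P ∣ y)
  (hPc : ∀ P ∈ PP, ∀ x y : M, P * x = P * y → x = y)
  (hPd : ∀ P ∈ PP, ∀ P' ∈ PP, P ∣ P' → P = P')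
  (hPe : ∀ x : M, x ≠ 1 → ∃ P ∈ PP, P ∣ x)
  (hu : ∀ P ∈ PP, ¬ P ∣ 1)
  (a : M → ℝ) (ha : ∀ x, 0 ≤ a x) (ha1 : a 1 = 0) (hmul : ∀ x y, a (x * y) = a x + a y)
  (haP : ∀ P ∈ PP, Real.log 2 ≤ a P)
  {Q : Type*} [CommGroup Q] [Finite Q] (φ : M →* Q)

lemma RC_orth [Fintype (Q →* ℂˣ)] (q : Q) (hq : q ≠ 1) : ∑ χ : Q →* ℂˣ, ((χ q : ℂˣ) : ℂ) = 0 := by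
  obtain ⟨ψ, hψ⟩ := CommGroup.exists_apply_ne_one_of_hasEnoughRootsOfUnity Q ℂ hq
  set S := ∑ χ : Q →* ℂˣ, ((χ q : ℂˣ) : ℂ)
  have : ((ψ q : ℂˣ) : ℂ) * S = S := by
    rw [Finset.mul_sum]
    exact Fintype.sum_equiv (Equiv.mulLeft ψ) _ _ (fun χ => by simp)
  have h1 : (((ψ q : ℂˣ) : ℂ) - 1) * S = 0 := by rw [sub_mul, this]; ring
  rcases mul_eq_zero.1 h1 with h | h
  · exact absurd (Units.ext (by simpa using sub_eq_zero.1 h)) hψ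
  · exact h

noncomputable def RC_hh (s : ℝ) (χ : Q →* ℂˣ) : M →* ℂ where
  toFun x := ((χ (φ x) : ℂˣ) : ℂ) * (Real.exp (-s * a x) : ℂ)
  map_one' := by simp [ha1]
  map_mul' x y := by
    rw [hmul, mul_add, Real.exp_add]; simp only [map_mul, Units.val_mul]; push_cast; ring

lemma RC_char_norm (χ : Q →* ℂˣ) (q : Q) : ‖((χ q : ℂˣ) : ℂ)‖ = 1 := by
  have h1 : ((χ q : ℂˣ) : ℂ) ^ (Nat.card Q) = 1 := by
    rw [← Units.val_pow_eq_pow_val, ← map_pow, pow_card_eq_one', map_one, Units.val_one]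
  exact Complex.norm_eq_one_of_pow_eq_one h1 Nat.card_pos.ne'

lemma RC_hh_norm (s : ℝ) (χ : Q →* ℂˣ) (x : M) : ‖RC_hh a ha1 hmul φ s χ x‖ = Real.exp (-s * a x) := by
  simp only [RC_hh, MonoidHom.coe_mk, OneHom.coe_mk]
  rw [norm_mul, RC_char_norm, one_mul, Complex.norm_real, Real.norm_of_nonneg (Real.exp_pos _).le]

include hP1 hPc hPd hPe hu haP ha in
lemma RC_prod_bd [Fintype (Q →* ℂˣ)] (hz : ∀ s, 1 < s → s ≤ 2 → Summable (fun x => Real.exp (-s * a x)))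
    (hw : Summable (fun P : {P : PP // φ P = 1} => Real.exp (-a P.1))) :
    ∃ c C : ℝ, 0 < c ∧ ∀ s, 1 < s → s ≤ 2 → c ≤ ∏ χ : Q →* ℂˣ, ‖∑' x, RC_hh a ha1 hmul φ s χ x‖ ^ 2 ∧
      ∏ χ : Q →* ℂˣ, ‖∑' x, RC_hh a ha1 hmul φ s χ x‖ ^ 2 ≤ C := by
  classical
  obtain ⟨n, hn⟩ : ∃ n : ℝ, n = ((Fintype.card (Q →* ℂˣ) : ℕ) : ℝ) := ⟨_, rfl⟩
  have hn0 : 0 ≤ n := by rw [hn]; positivity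
  have hz2 : Summable (fun P : PP => Real.exp (-2 * a P)) := (hz 2 one_lt_two le_rfl).subtype _
  have hw' : Summable (fun P : PP => if φ P = 1 then Real.exp (-a P) else 0) := by
    have := (Function.Injective.summable_iff (f := fun P : PP => if φ P = 1 then Real.exp (-a P) else 0)
      (Subtype.val_injective (p := fun P : PP => φ P = 1)) ?_).1 ?_
    · exact this
    · intro P hP
      simp only [Subtype.range_coe_subtype, Set.mem_setOf_eq] at hP
      rw [if_neg hP]
    · refine hw.congr fun P => ?_
      simp [P.2]
  set Z2 := ∑' P : PP, Real.exp (-2 * a P)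
  set W := ∑' P : PP, if φ P = 1 then Real.exp (-a P) else 0
  refine ⟨Real.exp (-(n * Z2)), Real.exp (n * (2 * W + 25 * Z2)), Real.exp_pos _, fun s h1 h2 => ?_⟩
  set h := RC_hh a ha1 hmul φ s with hh
  have hsum : ∀ χ, Summable (h χ) := fun χ => Summable.of_norm_bounded (hz s h1 h2) (fun x => (RC_hh_norm a ha1 hmul φ s χ x).le)
  have hlim := tendsto_finset_prod Finset.univ (fun χ _ => ((RC_euler PP hP1 hPc hPd hPe (h χ) (hsum χ) hu).norm.pow 2))
  simp only [norm_one, one_pow, Finset.prod_const_one] at hlim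
  have hx1 : ∀ P : PP, Real.exp (-s * a P) ≤ Real.exp (-a P) := fun P => Real.exp_le_exp.2 (by nlinarith [ha P.1])
  have hx2 : ∀ P : PP, Real.exp (-s * a P) ≤ 1/2 := by
    intro P
    refine (hx1 P).trans ?_
    have : Real.exp (-a P) ≤ Real.exp (-Real.log 2) := Real.exp_le_exp.2 (by linarith [haP P.1 P.2])
    rwa [Real.exp_neg (Real.log 2), Real.exp_log two_pos, ← one_div] at this
  have hx3 : ∀ P : PP, Real.exp (-s * a P) ^ 2 ≤ Real.exp (-2 * a P) := by
    intro P
    rw [← Real.exp_nat_mul]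
    exact Real.exp_le_exp.2 (by push_cast; nlinarith [ha P.1])
  have hre : ∀ P : PP, ∑ χ, (h χ P.1).re = if φ P = 1 then n * Real.exp (-s * a P) else 0 := by
    intro P
    rw [← Complex.re_sum]
    simp only [hh, RC_hh, MonoidHom.coe_mk, OneHom.coe_mk]
    rw [← Finset.sum_mul]
    split_ifs with hφ
    · simp only [hφ, map_one, Units.val_one, Finset.sum_const, Finset.card_univ, nsmul_eq_mul, mul_one]
      rw [← Complex.ofReal_natCast, ← Complex.ofReal_mul, Complex.ofReal_re, hn]
    · rw [RC_orth _ hφ]; simp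
  have hbig : ∀ S : Finset PP, ∏ χ, ‖(∏ P ∈ S, (1 - h χ P.1)) * ∑' x, h χ x‖ ^ 2 =
      (∏ P ∈ S, ∏ χ, ‖1 - h χ P.1‖ ^ 2) * ∏ χ, ‖∑' x, h χ x‖ ^ 2 := by
    intro S
    rw [Finset.prod_comm, ← Finset.prod_mul_distrib]
    refine Finset.prod_congr rfl fun χ _ => ?_
    rw [norm_mul, mul_pow, norm_prod, Finset.prod_pow]
  simp only [hbig] at hlim
  set Pr := ∏ χ, ‖∑' x, h χ x‖ ^ 2 with hPr
  have hPr0 : 0 ≤ Pr := Finset.prod_nonneg fun χ _ => by positivity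
  have hsq : ∀ χ (P : PP), ‖h χ P.1‖ ^ 2 ≤ Real.exp (-2 * a P) := fun χ P => by
    rw [hh, RC_hh_norm]; exact hx3 P
  constructor
  · have hup : ∀ S : Finset PP, ∏ P ∈ S, ∏ χ, ‖1 - h χ P.1‖ ^ 2 ≤ Real.exp (n * Z2) := by
      intro S
      have e1 : ∀ P : PP, ∏ χ, ‖1 - h χ P.1‖ ^ 2 ≤ Real.exp (n * Real.exp (-2 * a P)) := by
        intro P
        refine (Finset.prod_le_prod (fun χ _ => by positivity) (fun χ _ => RC_U (h χ P.1))).trans ?_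
        rw [← Real.exp_sum, Finset.sum_add_distrib, ← Finset.mul_sum, hre]
        refine Real.exp_le_exp.2 ?_
        have e2 : ∑ χ, ‖h χ P.1‖ ^ 2 ≤ n * Real.exp (-2 * a P) := by
          refine (Finset.sum_le_card_nsmul _ _ _ fun χ _ => hsq χ P).trans ?_
          rw [nsmul_eq_mul, Finset.card_univ, hn]
        have e3 : 0 ≤ n * Real.exp (-s * a P) := by positivity
        split_ifs <;> linarith
      refine (Finset.prod_le_prod (fun P _ => Finset.prod_nonneg fun χ _ => by positivity) (fun P _ => e1 P)).trans ?_
      rw [← Real.exp_sum, ← Finset.mul_sum]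
      exact Real.exp_le_exp.2 (mul_le_mul_of_nonneg_left (hz2.sum_le_tsum _ fun _ _ => (Real.exp_pos _).le) hn0)
    have : 1 ≤ Real.exp (n * Z2) * Pr := le_of_tendsto hlim (Eventually.of_forall fun S => mul_le_mul_of_nonneg_right (hup S) hPr0)
    rw [Real.exp_neg, inv_le_iff_one_le_mul₀ (Real.exp_pos _), mul_comm]; exact this
  · have hlo : ∀ S : Finset PP, Real.exp (-(n * (2 * W + 25 * Z2))) ≤ ∏ P ∈ S, ∏ χ, ‖1 - h χ P.1‖ ^ 2 := by
      intro S
      have e1 : ∀ P : PP, Real.exp (-(n * (2 * (if φ P = 1 then Real.exp (-a P) else 0) + 25 * Real.exp (-2 * a P)))) ≤ ∏ χ, ‖1 - h χ P.1‖ ^ 2 := by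
        intro P
        refine le_trans ?_ (Finset.prod_le_prod (fun χ _ => (Real.exp_pos _).le) (fun χ _ => RC_Lo (h χ P.1) (by
          rw [hh, RC_hh_norm]; exact hx2 P)))
        rw [← Real.exp_sum, Finset.sum_neg_distrib, Finset.sum_add_distrib, ← Finset.mul_sum, ← Finset.mul_sum, hre]
        refine Real.exp_le_exp.2 (neg_le_neg ?_)
        have e2 : ∑ χ, ‖h χ P.1‖ ^ 2 ≤ n * Real.exp (-2 * a P) := by
          refine (Finset.sum_le_card_nsmul _ _ _ fun χ _ => hsq χ P).trans ?_
          rw [nsmul_eq_mul, Finset.card_univ, hn]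
        have e3 : n * Real.exp (-s * a P) ≤ n * Real.exp (-a P) := mul_le_mul_of_nonneg_left (hx1 P) hn0
        split_ifs <;> linarith
      refine le_trans ?_ (Finset.prod_le_prod (fun P _ => (Real.exp_pos _).le) (fun P _ => e1 P))
      rw [← Real.exp_sum, Finset.sum_neg_distrib, ← Finset.mul_sum, Finset.sum_add_distrib, ← Finset.mul_sum, ← Finset.mul_sum]
      refine Real.exp_le_exp.2 (neg_le_neg (mul_le_mul_of_nonneg_left ?_ hn0))
      have e4 := hz2.sum_le_tsum S fun _ _ => (Real.exp_pos _).le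
      have e5 := hw'.sum_le_tsum S fun _ _ => by split_ifs <;> positivity
      linarith
    have : Real.exp (-(n * (2 * W + 25 * Z2))) * Pr ≤ 1 := ge_of_tendsto hlim (Eventually.of_forall fun S => mul_le_mul_of_nonneg_right (hlo S) hPr0)
    rwa [Real.exp_neg, inv_mul_le_iff₀ (Real.exp_pos _), mul_one] at this

include hP1 hPc hPd hPe hu haP ha ha1 hmul in
theorem RC_A5 (p : ℕ) (hp : Odd p) (hQ : ∀ q : Q, q ^ p = 1) (C0 : ℝ)
    (hz : ∀ s, 1 < s → s ≤ 2 → Summable (fun x => Real.exp (-s * a x)) ∧ ∑' x, Real.exp (-s * a x) ≤ C0 / (s - 1))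
    (hdiv : ¬ Summable (fun x => Real.exp (-a x)))
    (hch : ∀ χ : Q →* ℂˣ, χ ≠ 1 → ∃ C', 0 < C' ∧
      (∀ s, 1 < s → s ≤ 2 → ‖∑' i, ((χ (φ i) : ℂˣ) : ℂ) * (Real.exp (-s * a i) : ℂ)‖ ≤ C') ∧
      ((∀ s, 1 < s → s ≤ 2 → ‖∑' i, ((χ (φ i) : ℂˣ) : ℂ) * (Real.exp (-s * a i) : ℂ)‖ ≤ C' * (s - 1)) ∨
        ∃ c > 0, ∃ s₀ > 1, ∀ s, 1 < s → s ≤ s₀ → c ≤ ‖∑' i, ((χ (φ i) : ℂˣ) : ℂ) * (Real.exp (-s * a i) : ℂ)‖)) :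
    ¬ Summable (fun P : {P : PP // φ P = 1} => Real.exp (-a P.1)) := by
  classical
  intro hw
  have hfx : Fintype (Q →* ℂˣ) := Fintype.ofFinite _
  obtain ⟨c, C, hc, hbd⟩ := RC_prod_bd PP hP1 hPc hPd hPe hu a ha ha1 hmul haP φ (fun s h1 h2 => (hz s h1 h2).1) hw
  have hLh : ∀ s χ, ∑' x, RC_hh a ha1 hmul φ s χ x = ∑' i, ((χ (φ i) : ℂˣ) : ℂ) * (Real.exp (-s * a i) : ℂ) := fun s χ => rfl
  set L : ℝ → (Q →* ℂˣ) → ℂ := fun s χ => ∑' i, ((χ (φ i) : ℂˣ) : ℂ) * (Real.exp (-s * a i) : ℂ) with hL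
  have hL1 : ∀ s, ‖L s 1‖ = ∑' x, Real.exp (-s * a x) := by
    intro s
    simp only [hL, MonoidHom.one_apply, Units.val_one, one_mul]
    rw [← Complex.ofReal_tsum, Complex.norm_real, Real.norm_of_nonneg (tsum_nonneg fun _ => (Real.exp_pos _).le)]
  have hLinv : ∀ s χ, ‖L s χ⁻¹‖ = ‖L s χ‖ := by
    intro s χ
    rw [← Complex.norm_conj (L s χ)]
    simp only [hL]
    rw [Complex.conj_tsum]
    congr 2; funext i
    rw [map_mul, Complex.conj_ofReal, MonoidHom.inv_apply, Units.val_inv_eq_inv_val, Complex.inv_eq_conj (RC_char_norm χ _)]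
  simp only [hLh] at hbd
  choose! C' hC' hCb hCd using hch
  by_cases hvan : ∃ χ : Q →* ℂˣ, χ ≠ 1 ∧ ∀ s, 1 < s → s ≤ 2 → ‖L s χ‖ ≤ C' χ * (s - 1)
  · obtain ⟨χ, hχ1, hχ⟩ := hvan
    have hne : χ⁻¹ ≠ χ := by
      intro h
      apply hχ1
      ext1 q
      have h1 : (χ q)⁻¹ = χ q := by rw [← MonoidHom.inv_apply, h]
      have h2 : (χ q) ^ 2 = 1 := by rw [pow_two]; nth_rewrite 1 [← h1]; exact inv_mul_cancel _
      have hp' : (χ q) ^ p = 1 := by rw [← map_pow, hQ, map_one]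
      obtain ⟨k, rfl⟩ := hp
      rw [pow_succ, pow_mul, h2, one_pow, one_mul] at hp'
      rw [hp']; rfl
    have hinv1 : χ⁻¹ ≠ 1 := by
      intro h
      apply hχ1
      ext1 q
      have h1 : (χ q)⁻¹ = 1 := by rw [← MonoidHom.inv_apply, h]; rfl
      rw [inv_eq_one.1 h1]; rfl
    set R := ((Finset.univ.erase (1 : Q →* ℂˣ)).erase χ).erase χ⁻¹ with hR
    set D := ∏ ψ ∈ R, (C' ψ) ^ 2
    have hdec : ∀ s, ∏ ψ, ‖L s ψ‖ ^ 2 = ‖L s 1‖^2 * (‖L s χ‖^2 * (‖L s χ⁻¹‖^2 * ∏ ψ ∈ R, ‖L s ψ‖^2)) := by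
      intro s
      rw [hR, Finset.mul_prod_erase _ (fun ψ => ‖L s ψ‖^2), Finset.mul_prod_erase _ (fun ψ => ‖L s ψ‖^2), Finset.mul_prod_erase _ (fun ψ => ‖L s ψ‖^2)]
      · simp
      · simpa using hχ1
      · simp [hne, hinv1]
    have hub : ∀ s, 1 < s → s ≤ 2 → c ≤ (s - 1) ^ 2 * (C0 ^ 2 * (C' χ)^4 * D) := by
      intro s h1 h2
      have hs : 0 < s - 1 := by linarith
      refine (hbd s h1 h2).1.trans ?_
      rw [hdec, hLinv, hL1]
      have e1 := (hz s h1 h2).2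
      have e2 := hχ s h1 h2
      have e3 : ∏ ψ ∈ R, ‖L s ψ‖^2 ≤ D := by
        refine Finset.prod_le_prod (fun _ _ => by positivity) fun ψ hψ => ?_
        have : ψ ≠ 1 := by simp [hR] at hψ; exact hψ.2.2
        exact pow_le_pow_left₀ (norm_nonneg _) (hCb ψ this s h1 h2) 2
      have e0 : 0 ≤ ∑' x, Real.exp (-s * a x) := tsum_nonneg fun _ => (Real.exp_pos _).le
      calc _ ≤ (C0 / (s - 1))^2 * ((C' χ * (s-1))^2 * ((C' χ * (s-1))^2 * D)) := by gcongr
        _ = _ := by field_simp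
    have ht : Tendsto (fun s : ℝ => (s - 1) ^ 2 * (C0 ^ 2 * (C' χ)^4 * D)) (𝓝[>] 1) (𝓝 0) := by
      have : Tendsto (fun s : ℝ => (s - 1) ^ 2 * (C0 ^ 2 * (C' χ)^4 * D)) (𝓝 1) (𝓝 ((1 - 1)^2 * (C0 ^ 2 * (C' χ)^4 * D))) :=
        Continuous.tendsto (by fun_prop) 1
      simp only [sub_self, ne_eq, OfNat.ofNat_ne_zero, not_false_eq_true, zero_pow, zero_mul] at this
      exact this.mono_left nhdsWithin_le_nhds
    have : c ≤ 0 := by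
      refine ge_of_tendsto ht ?_
      filter_upwards [Ioc_mem_nhdsGT (one_lt_two : (1:ℝ) < 2)] with s hs
      exact hub s hs.1 hs.2
    linarith
  · push Not at hvan
    have hlow : ∀ χ : Q →* ℂˣ, ∃ c s₀ : ℝ, χ ≠ 1 → 0 < c ∧ 1 < s₀ ∧ ∀ s, 1 < s → s ≤ s₀ → c ≤ ‖L s χ‖ := by
      intro χ
      by_cases h : χ = 1
      · exact ⟨0, 0, fun h' => absurd h h'⟩
      rcases hCd χ h with h1 | ⟨c, hc, s₀, hs, h1⟩
      · obtain ⟨s, e1, e2, e3⟩ := hvan χ h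
        exact absurd (h1 s e1 e2) (not_le.2 e3)
      · exact ⟨c, s₀, fun _ => ⟨hc, hs, h1⟩⟩
    choose c' s₀ hcs using hlow
    set R := Finset.univ.erase (1 : Q →* ℂˣ) with hR
    set D := ∏ ψ ∈ R, (c' ψ) ^ 2
    have hRne : ∀ ψ ∈ R, ψ ≠ 1 := fun ψ hψ => by simpa [hR] using hψ
    have hD : 0 < D := Finset.prod_pos fun ψ hψ => pow_pos (hcs ψ (hRne ψ hψ)).1 2
    have hev : ∀ᶠ s in 𝓝[>] (1:ℝ), ∑' x, Real.exp (-s * a x) ≤ 1 + C / D := by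
      have h1 : ∀ᶠ s in 𝓝[>] (1:ℝ), ∀ ψ ∈ R, c' ψ ≤ ‖L s ψ‖ := by
        rw [Filter.eventually_all_finset]
        intro ψ hψ
        obtain ⟨e1, e2, e3⟩ := hcs ψ (hRne ψ hψ)
        filter_upwards [Ioc_mem_nhdsGT e2] with s hs using e3 s hs.1 hs.2
      filter_upwards [h1, Ioc_mem_nhdsGT (one_lt_two : (1:ℝ) < 2)] with s hs hs2
      have e1 := (hbd s hs2.1 hs2.2).2
      rw [← Finset.mul_prod_erase Finset.univ (fun ψ => ‖L s ψ‖^2) (Finset.mem_univ 1), ← hR, hL1] at e1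
      have e2 : D ≤ ∏ ψ ∈ R, ‖L s ψ‖^2 := Finset.prod_le_prod (fun _ _ => by positivity) fun ψ hψ =>
        pow_le_pow_left₀ (hcs ψ (hRne ψ hψ)).1.le (hs ψ hψ) 2
      set t := ∑' x, Real.exp (-s * a x)
      have e3 : t ^ 2 ≤ C / D := by
        rw [le_div_iff₀ hD]
        exact (mul_le_mul_of_nonneg_left e2 (sq_nonneg t)).trans e1
      nlinarith
    refine hdiv (summable_of_sum_le (c := 1 + C / D) (fun x => (Real.exp_pos _).le) fun A => ?_)
    have ht : Tendsto (fun s : ℝ => ∑ x ∈ A, Real.exp (-s * a x)) (𝓝[>] 1) (𝓝 (∑ x ∈ A, Real.exp (-a x))) := by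
      have : Tendsto (fun s : ℝ => ∑ x ∈ A, Real.exp (-s * a x)) (𝓝 1) (𝓝 (∑ x ∈ A, Real.exp (-1 * a x))) :=
        Continuous.tendsto (by fun_prop) 1
      simp only [neg_one_mul] at this
      exact this.mono_left nhdsWithin_le_nhds
    refine le_of_tendsto ht ?_
    filter_upwards [hev, Ioc_mem_nhdsGT (one_lt_two : (1:ℝ) < 2)] with s hs hs2
    exact ((hz s hs2.1 hs2.2).1.sum_le_tsum _ fun _ _ => (Real.exp_pos _).le).trans hs
end
end

section
section
open NumberField NumberField.mixedEmbedding MeasureTheory Module Filter Topology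
open scoped Classical
variable (F : Type*) [Field F] [NumberField F] (m : ℕ) [NeZero m]

lemma RC_fiber_sum {ι G : Type*} [Fintype G] (cl : ι → G) (φ : ι → ℝ) (hφ : Summable φ) (c : G → ℂ) :
    ∑' i, c (cl i) * (φ i : ℂ) = ∑ x, c x * ((∑' i : {i // cl i = x}, φ i : ℝ) : ℂ) := by
  have hs : Summable (fun i => c (cl i) * (φ i : ℂ)) := by
    obtain ⟨K, hK⟩ : ∃ K : ℝ, ∀ x, ‖c x‖ ≤ K := ⟨∑ x, ‖c x‖, fun x => Finset.single_le_sum (f := fun x => ‖c x‖) (fun _ _ => norm_nonneg _) (Finset.mem_univ x)⟩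
    refine Summable.of_norm_bounded (hφ.norm.mul_left K) fun i => ?_
    rw [norm_mul, Complex.norm_real]
    exact mul_le_mul_of_nonneg_right (hK _) (norm_nonneg _)
  rw [← (Equiv.sigmaFiberEquiv cl).tsum_eq]
  refine (Summable.tsum_sigma' (fun x => (hs.subtype {i | cl i = x})) ((Equiv.sigmaFiberEquiv cl).summable_iff.2 hs)).trans ?_
  rw [tsum_fintype]
  refine Finset.sum_congr rfl fun x _ => ?_
  rw [Complex.ofReal_tsum, ← tsum_mul_left]
  refine tsum_congr fun i => ?_
  exact congrArg (fun y => c y * (φ i : ℂ)) i.2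

lemma RC_class_asymp : ∃ (g : ℝ → ℝ) (B κ δ : ℝ), Continuous g ∧ (∀ t, 0 ≤ g t) ∧ 0 < g 0 ∧ (∀ t, B ≤ |t| → g t = 0) ∧
    0 < κ ∧ 0 < δ ∧ δ ≤ 1 ∧ ∀ x : RC_G F m, ∃ C, 0 ≤ C ∧ ∀ v, 0 ≤ v →
      |(∑' I : {I : RC_RM F m // RC_cl F m I = x}, g (Real.log (Ideal.absNorm (I.1 : Ideal (𝓞 F))) - v)) - κ * Real.exp v|
        ≤ C * Real.exp (v * (1 - δ)) := by
  obtain ⟨g, f, B, hg, hg0, hg00, hB, ⟨k, hk⟩, ⟨R, hR⟩, hf0, hfn, hs⟩ := RC_A2 F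
  have hn : 0 < (finrank ℚ F : ℝ) := by exact_mod_cast finrank_pos
  have hn1 : 1 ≤ (finrank ℚ F : ℝ) := by exact_mod_cast finrank_pos (R := ℚ) (M := F)
  refine ⟨g, B, (Nat.card (RC_H0 F m)) * ((∫ x, f x) / (Ideal.absNorm (Ideal.span {(m : 𝓞 F)}) * RC_V0 F)), 1 / (finrank ℚ F : ℝ),
    hg, hg0, hg00, hB, ?_, by positivity, (div_le_one hn).2 hn1, fun x => RC_count_class g f k hk R hR hfn hs x⟩
  have h1 : 0 < (Nat.card (RC_H0 F m) : ℝ) := by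
    have : Nonempty (RC_H0 F m) := ⟨⟨Ideal.Quotient.mk _ 1, (RC_H0_iff one_ne_zero).2 ⟨1, by simp, map_one _⟩⟩⟩
    exact_mod_cast Nat.card_pos
  have h2 : 0 < ∫ x, f x := by
    have hsupp : HasCompactSupport f := by
      refine HasCompactSupport.intro (isCompact_closedBall (0 : mixedSpace F) R) fun x hx ↦ hR x ?_
      simpa using hx
    have hx : ∃ x, f x ≠ 0 := by
      by_contra hcon
      push Not at hcon
      have h5 := hs (mixedEmbedding F 1) (by simp)
      simp only [hcon] at h5
      have h6 := h5.unique hasSum_zero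
      rw [map_one, map_one, Real.log_one] at h6
      linarith
    obtain ⟨x, hx⟩ := hx
    exact hk.continuous.integral_pos_of_hasCompactSupport_nonneg_nonzero hsupp hf0 hx
  have h3 := RC_V0_pos F
  have h4 : (1:ℝ) ≤ Ideal.absNorm (Ideal.span {(m : 𝓞 F)}) := RC_absNorm_pos (by simpa using NeZero.ne m)
  positivity
end
end

section
section
open NumberField Module Filter Topology
variable {F : Type*} [Field F] [NumberField F] {m : ℕ} [NeZero m]

lemma RC_dvd {P x : RC_RM F m} : P ∣ x ↔ (P : Ideal (𝓞 F)) ∣ x := by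
  constructor
  · rintro ⟨c, rfl⟩; exact ⟨c, rfl⟩
  · rintro ⟨c, hc⟩
    refine ⟨⟨c, ?_, ?_⟩, Subtype.ext hc⟩
    · rintro rfl
      exact x.2.1 (by rw [hc]; exact mul_zero _)
    · have := x.2.2
      rw [hc] at this
      exact IsCoprime.of_mul_left_right this

lemma RC_rm_fin (X : ℝ) : {I : RC_RM F m | Real.log (Ideal.absNorm (I : Ideal (𝓞 F))) ≤ X}.Finite := by
  have h1 := Ideal.finite_setOfPred_absNorm_le (S := 𝓞 F) ⌊Real.exp X⌋₊
  refine Set.Finite.of_finite_image (f := Subtype.val) (h1.subset ?_) Subtype.val_injective.injOn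
  rintro _ ⟨I, hI, rfl⟩
  have h2 : Real.log (Ideal.absNorm (I : Ideal (𝓞 F))) ≤ X := hI
  have h3 := RC_absNorm_pos I.2.1
  rw [Real.log_le_iff_le_exp (by linarith)] at h2
  exact Nat.le_floor h2

lemma RC_countable : Countable (RC_RM F m) := by
  have : (Set.univ : Set (RC_RM F m)) = ⋃ n : ℕ, {I : RC_RM F m | Real.log (Ideal.absNorm (I : Ideal (𝓞 F))) ≤ n} := by
    symm
    rw [Set.eq_univ_iff_forall]
    intro I
    rw [Set.mem_iUnion]
    exact exists_nat_ge (Real.log (Ideal.absNorm (I : Ideal (𝓞 F))))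
  rw [← Set.countable_univ_iff, this]
  exact Set.countable_iUnion fun n => (RC_rm_fin _).countable

lemma RC_primes_not_summable (p : ℕ) (hp : Odd p) :
    ¬ Summable (fun P : {P : {P : RC_RM F m | (P : Ideal (𝓞 F)).IsPrime} //
      ((QuotientGroup.mk' (powMonoidHom p : RC_G F m →* RC_G F m).range).comp (RC_cl F m)) P.1 = 1} =>
        Real.exp (-Real.log (Ideal.absNorm (P.1.1 : Ideal (𝓞 F))))) := by
  classical
  have hcount : Countable (RC_RM F m) := RC_countable
  obtain ⟨g, B, κ, δ, hg, hg0, hg00, hB, hκ, hδ0, hδ1, hcls⟩ := RC_class_asymp F m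
  have hBp := RC_Bpos g hg00 B hB
  have hfG : Fintype (RC_G F m) := Fintype.ofFinite _
  choose Cx hCx0 hCx using hcls
  set a : RC_RM F m → ℝ := fun I => Real.log (Ideal.absNorm (I : Ideal (𝓞 F))) with ha_def
  have ha : ∀ x, 0 ≤ a x := fun x => Real.log_nonneg (RC_absNorm_pos x.2.1)
  have hfin : ∀ X, {i | a i ≤ X}.Finite := RC_rm_fin
  have hsummT : ∀ v, Summable (fun i => g (a i - v)) := fun v => summable_of_hasFiniteSupport (RC_T_fin a hfin g B hB v)
  have hT : ∀ (c : RC_G F m → ℂ) v, ∑' i, c (RC_cl F m i) * (g (a i - v) : ℂ) =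
      ∑ x, c x * ((∑' i : {i // RC_cl F m i = x}, g (a i - v) : ℝ) : ℂ) := fun c v => RC_fiber_sum (RC_cl F m) _ (hsummT v) c
  set CC := ∑ x, Cx x with hCC
  have hCC0 : 0 ≤ CC := Finset.sum_nonneg fun x _ => hCx0 x
  have hmain : ∀ (c : RC_G F m → ℂ), (∀ x, ‖c x‖ ≤ 1) → ∀ v, 0 ≤ v →
      ‖∑' i, c (RC_cl F m i) * (g (a i - v) : ℂ) - (∑ x, c x) * ((κ * Real.exp v : ℝ) : ℂ)‖ ≤ CC * Real.exp (v * (1 - δ)) := by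
    intro c hc v hv
    rw [hT, Finset.sum_mul, ← Finset.sum_sub_distrib, hCC, Finset.sum_mul]
    refine (norm_sum_le _ _).trans (Finset.sum_le_sum fun x _ => ?_)
    rw [← mul_sub, ← Complex.ofReal_sub, norm_mul, Complex.norm_real, Real.norm_eq_abs]
    have := mul_le_mul (hc x) (hCx x v hv) (abs_nonneg _) zero_le_one
    rwa [one_mul] at this
  set n : ℝ := ((Fintype.card (RC_G F m) : ℕ) : ℝ) with hn
  have hn1 : 1 ≤ n := by rw [hn]; exact_mod_cast Fintype.card_pos
  have hT1 : ∀ v, 0 ≤ v → |∑' i, g (a i - v) - n * κ * Real.exp v| ≤ CC * Real.exp (v * (1 - δ)) := by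
    intro v hv
    have := hmain (fun _ => 1) (by simp) v hv
    simp only [one_mul, Finset.sum_const, Finset.card_univ, nsmul_eq_mul, mul_one] at this
    rw [← Complex.ofReal_tsum, ← Complex.ofReal_natCast, ← Complex.ofReal_mul, ← Complex.ofReal_sub, Complex.norm_real, Real.norm_eq_abs, ← hn, ← mul_assoc] at this
    exact this
  obtain ⟨C0, hC0, hz⟩ := RC_A4_zeta a ha hfin g hg hg0 hg00 B hB (n * κ + CC) (by
    intro v hv
    have h1 := (abs_le.1 (hT1 v hv)).2
    have h2 : Real.exp (v * (1 - δ)) ≤ Real.exp v := Real.exp_le_exp.2 (by nlinarith)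
    nlinarith [mul_le_mul_of_nonneg_left h2 hCC0])
  refine RC_A5 {P : RC_RM F m | (P : Ideal (𝓞 F)).IsPrime} ?_ ?_ ?_ ?_ ?_ a ha ?_ ?_ ?_
    ((QuotientGroup.mk' (powMonoidHom p : RC_G F m →* RC_G F m).range).comp (RC_cl F m)) p hp ?_ C0 hz ?_ ?_
  · intro P hP x y h
    rw [RC_dvd] at h ⊢
    rw [RC_dvd]
    exact (Ideal.prime_of_isPrime P.2.1 hP).dvd_or_dvd h
  · intro P hP x y h
    exact Subtype.ext (mul_left_cancel₀ P.2.1 (congrArg Subtype.val h))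
  · intro P hP P' hP' h
    rw [RC_dvd, Ideal.dvd_iff_le] at h
    have hmax : (P' : Ideal (𝓞 F)).IsMaximal := Ideal.IsPrime.isMaximal hP' P'.2.1
    exact Subtype.ext (hmax.eq_of_le hP.ne_top h).symm
  · intro x hx
    have hx' : (x : Ideal (𝓞 F)) ≠ ⊤ := fun h => hx (Subtype.ext (by rw [h, OneMemClass.coe_one, Ideal.one_eq_top]))
    obtain ⟨P, hP, hle⟩ := Ideal.exists_le_maximal _ hx'
    obtain ⟨c, hc⟩ := Ideal.dvd_iff_le.2 hle
    have hcop := x.2.2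
    rw [hc] at hcop
    refine ⟨⟨P, ?_, IsCoprime.of_mul_left_left hcop⟩, hP.isPrime, ?_⟩
    · rintro rfl
      exact x.2.1 (le_bot_iff.1 hle)
    · rw [RC_dvd]; exact ⟨c, hc⟩
  · intro P hP h
    rw [RC_dvd] at h
    exact hP.ne_top (Ideal.isUnit_iff.1 (isUnit_of_dvd_one h))
  · simp [ha_def]
  · intro x y
    simp only [ha_def, Submonoid.coe_mul, map_mul, Nat.cast_mul]
    rw [Real.log_mul (by linarith [RC_absNorm_pos x.2.1]) (by linarith [RC_absNorm_pos y.2.1])]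
  · intro P hP
    refine Real.log_le_log two_pos ?_
    have h1 : Ideal.absNorm (P : Ideal (𝓞 F)) ≠ 0 := by simpa [Ideal.absNorm_eq_zero_iff] using P.2.1
    have h2 : Ideal.absNorm (P : Ideal (𝓞 F)) ≠ 1 := by simpa [Ideal.absNorm_eq_one_iff] using hP.ne_top
    exact_mod_cast (by omega : 2 ≤ Ideal.absNorm (P : Ideal (𝓞 F)))
  · intro q
    obtain ⟨x, rfl⟩ := QuotientGroup.mk_surjective q
    rw [← QuotientGroup.mk_pow, QuotientGroup.eq_one_iff]
    exact ⟨x, rfl⟩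
  · -- divergence
    intro hsum
    obtain ⟨Mg, hMg⟩ : ∃ M, ∀ t, g t ≤ M := by
      obtain ⟨M, hM⟩ := hg.bounded_above_of_compact_support (HasCompactSupport.intro (K := Set.Icc (-B) B) isCompact_Icc fun t ht => by
        by_contra h
        have := RC_g_supp g B hB h
        exact ht ⟨this.1.le, this.2.le⟩)
      exact ⟨M, fun t => (le_abs_self _).trans (hM t)⟩
    have hMg0 : 0 < Mg := hg00.trans_le (hMg 0)
    -- T v * exp (-v) → 0
    have h1 : Tendsto (fun v : ℝ => ∑' i, g (a i - v) * Real.exp (-v)) atTop (𝓝 (∑' _ : RC_RM F m, (0:ℝ))) := by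
      refine tendsto_tsum_of_dominated_convergence (bound := fun i => Mg * Real.exp B * Real.exp (-a i)) (hsum.mul_left _) ?_ ?_
      · intro i
        refine tendsto_const_nhds.congr' ?_
        filter_upwards [eventually_ge_atTop (a i + B)] with v hv
        rw [hB _ (by rw [abs_of_nonpos] <;> linarith), zero_mul]
      · refine Eventually.of_forall fun v i => ?_
        rw [Real.norm_of_nonneg (mul_nonneg (hg0 _) (Real.exp_pos _).le)]
        by_cases h : g (a i - v) = 0
        · rw [h, zero_mul]; positivity
        · have h3 := RC_g_supp g B hB h
          rw [mul_assoc, ← Real.exp_add]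
          exact mul_le_mul (hMg _) (Real.exp_le_exp.2 (by linarith [h3.2])) (Real.exp_pos _).le hMg0.le
    rw [tsum_zero] at h1
    have h2 : Tendsto (fun v : ℝ => n * κ - CC * Real.exp (-(δ * v))) atTop (𝓝 (n * κ - CC * 0)) := by
      refine tendsto_const_nhds.sub (Tendsto.const_mul _ ?_)
      exact Real.tendsto_exp_neg_atTop_nhds_zero.comp (tendsto_id.const_mul_atTop hδ0)
    have h3 : n * κ - CC * 0 ≤ 0 := by
      refine le_of_tendsto_of_tendsto h2 h1 ?_
      filter_upwards [eventually_ge_atTop 0] with v hv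
      rw [tsum_mul_right]
      have h4 := (abs_le.1 (hT1 v hv)).1
      have h5 : n * κ - CC * Real.exp (-(δ * v)) = (n * κ * Real.exp v - CC * Real.exp (v * (1 - δ))) * Real.exp (-v) := by
        rw [sub_mul, mul_assoc, mul_assoc CC, ← Real.exp_add, ← Real.exp_add, add_neg_cancel, Real.exp_zero, mul_one]
        congr 3; ring
      rw [h5]
      exact mul_le_mul_of_nonneg_right (by linarith) (Real.exp_pos _).le
    nlinarith
  · intro χ hχ
    refine RC_A4_char a ha hfin g hg hg0 hg00 B hB (fun s h1 h2 => (hz s h1 h2).1) _ (fun i => (RC_char_norm χ _).le) δ hδ0 hδ1 CC ?_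
    intro v hv
    have h1 := hmain (fun x => ((χ (QuotientGroup.mk' (powMonoidHom p : RC_G F m →* RC_G F m).range x) : ℂˣ) : ℂ)) (fun x => (RC_char_norm χ _).le) v hv
    have h2 : ∑ x, ((χ (QuotientGroup.mk' (powMonoidHom p : RC_G F m →* RC_G F m).range x) : ℂˣ) : ℂ) = 0 := by
      obtain ⟨q, hq⟩ : ∃ q, χ q ≠ 1 := by
        by_contra hcon
        push Not at hcon
        exact hχ (MonoidHom.ext hcon)
      obtain ⟨y, rfl⟩ := QuotientGroup.mk'_surjective _ q
      set S := ∑ x, ((χ (QuotientGroup.mk' (powMonoidHom p : RC_G F m →* RC_G F m).range x) : ℂˣ) : ℂ) with hS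
      set t := ((χ (QuotientGroup.mk' (powMonoidHom p : RC_G F m →* RC_G F m).range y) : ℂˣ) : ℂ) with ht
      have h3 : t * S = S := by
        rw [hS, Finset.mul_sum]
        exact Fintype.sum_equiv (Equiv.mulLeft y) _ _ (fun x => by simp [ht])
      have h4 : (t - 1) * S = 0 := by rw [sub_mul, h3]; ring
      rcases mul_eq_zero.1 h4 with h | h
      · exact absurd (Units.ext (sub_eq_zero.1 h)) hq
      · exact h
    rw [h2, zero_mul, sub_zero] at h1
    exact h1
end
end

section
section
open NumberField Module Filter Topology
variable {F : Type*} [Field F] [NumberField F]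

lemma RC_prime_norm (P : Ideal (𝓞 F)) (hP : P.IsPrime) (h0 : P ≠ ⊥) :
    ∃ ℓ k : ℕ, ℓ.Prime ∧ 0 < k ∧ Ideal.absNorm P = ℓ ^ k ∧ (ℓ : 𝓞 F) ∈ P := by
  have hmax := hP.isMaximal h0
  letI := Ideal.Quotient.field P
  have hfin : Finite (𝓞 F ⧸ P) := Ideal.finiteQuotientOfFreeOfNeBot P h0
  have hft := Fintype.ofFinite (𝓞 F ⧸ P)
  obtain ⟨ℓ, hcp, k, hℓ, hc⟩ := FiniteField.card' (𝓞 F ⧸ P)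
  have hN : Ideal.absNorm P = ℓ ^ (k : ℕ) := by
    rw [← hc, Ideal.absNorm_apply, Submodule.cardQuot_apply, Nat.card_eq_fintype_card]
  refine ⟨ℓ, k, hℓ, k.pos, hN, ?_⟩
  have := Ideal.absNorm_mem P
  rw [hN, Nat.cast_pow] at this
  exact hP.mem_of_pow_mem _ this

lemma RC_fib (ℓ : ℕ) (hℓ : ℓ.Prime) (A : Finset (Ideal (𝓞 F))) (hA : ∀ P ∈ A, P.IsPrime ∧ P ≠ ⊥ ∧ ℓ ∣ Ideal.absNorm P ∧ (ℓ : 𝓞 F) ∈ P) :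
    A.card ≤ finrank ℚ F := by
  have h1 : ∏ P ∈ A, P ∣ Ideal.span {(ℓ : 𝓞 F)} := by
    refine Finset.prod_dvd_of_coprime ?_ ?_
    · intro P hP P' hP' hne
      have e1 := (hA P hP).1.isMaximal (hA P hP).2.1
      have e2 := (hA P' hP').1.isMaximal (hA P' hP').2.1
      exact Ideal.isCoprime_iff_sup_eq.2 (e1.coprime_of_ne e2 hne)
    · intro P hP
      rw [Ideal.dvd_iff_le, Ideal.span_singleton_le_iff_mem]
      exact (hA P hP).2.2.2
  have h2 := Ideal.absNorm_dvd_absNorm_of_le (Ideal.dvd_iff_le.1 h1)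
  rw [map_prod, Ideal.absNorm_span_singleton] at h2
  have h3 : Algebra.norm ℤ (ℓ : 𝓞 F) = (ℓ : ℤ) ^ finrank ℚ F := by
    rw [← RingOfIntegers.rank F]
    have h5 := Algebra.norm_algebraMap_of_basis (Module.Free.chooseBasis ℤ (𝓞 F)) (ℓ : ℤ)
    rw [← finrank_eq_card_chooseBasisIndex] at h5
    simpa using h5
  rw [h3, Int.natAbs_pow, Int.natAbs_natCast] at h2
  have h4 : ℓ ^ A.card ∣ ∏ P ∈ A, Ideal.absNorm P := by
    rw [← Finset.prod_const]
    exact Finset.prod_dvd_prod_of_dvd _ _ fun P hP => (hA P hP).2.2.1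
  exact (Nat.pow_dvd_pow_iff_le_right hℓ.one_lt).1 (h4.trans h2)

lemma RC_deg2_summable : Summable (fun P : {P : Ideal (𝓞 F) // P.IsPrime ∧ P ≠ ⊥ ∧ ¬ (Ideal.absNorm P).Prime} => ((Ideal.absNorm P.1 : ℕ) : ℝ)⁻¹) := by
  classical
  choose ℓ k hℓ hk hN hmem using fun P : {P : Ideal (𝓞 F) // P.IsPrime ∧ P ≠ ⊥ ∧ ¬ (Ideal.absNorm P).Prime} =>
    RC_prime_norm P.1 P.2.1 P.2.2.1
  have hk2 : ∀ P, 2 ≤ k P := by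
    intro P
    by_contra h
    have h1 : k P = 1 := by have := hk P; omega
    have h2 := hN P
    rw [h1, pow_one] at h2
    exact P.2.2.2 (h2 ▸ hℓ P)
  have hsum : Summable (fun l : ℕ => ((l : ℝ) ^ 2)⁻¹) := by simp
  have h1 : Summable (fun P : {P : Ideal (𝓞 F) // P.IsPrime ∧ P ≠ ⊥ ∧ ¬ (Ideal.absNorm P).Prime} => ((ℓ P : ℝ) ^ 2)⁻¹) := by
    refine summable_of_sum_le (c := finrank ℚ F * ∑' l : ℕ, ((l : ℝ) ^ 2)⁻¹) (fun P => by positivity) fun A => ?_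
    rw [Finset.sum_comp (fun l : ℕ => ((l : ℝ) ^ 2)⁻¹) ℓ]
    refine le_trans (Finset.sum_le_sum (g := fun l : ℕ => (finrank ℚ F : ℝ) * ((l : ℝ) ^ 2)⁻¹) fun l hl => ?_) ?_
    · rw [nsmul_eq_mul]
      refine mul_le_mul_of_nonneg_right ?_ (by positivity)
      rw [Finset.mem_image] at hl
      obtain ⟨P0, hP0, rfl⟩ := hl
      have := RC_fib (ℓ P0) (hℓ P0) ((A.filter (fun P => ℓ P = ℓ P0)).map ⟨Subtype.val, Subtype.val_injective⟩) (by
        intro P hP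
        rw [Finset.mem_map] at hP
        obtain ⟨P, hP, rfl⟩ := hP
        have e := (Finset.mem_filter.1 hP).2
        refine ⟨P.2.1, P.2.2.1, ?_, ?_⟩
        · rw [← e]
          show ℓ P ∣ Ideal.absNorm P.1
          rw [hN P]
          exact dvd_pow_self _ (hk P).ne'
        · rw [← e]; exact hmem P)
      rw [Finset.card_map] at this
      exact_mod_cast this
    · rw [← Finset.mul_sum]
      exact mul_le_mul_of_nonneg_left (hsum.sum_le_tsum _ fun _ _ => by positivity) (by positivity)
  refine Summable.of_nonneg_of_le (fun P => by positivity) (fun P => ?_) h1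
  rw [hN P, Nat.cast_pow]
  have h2 : (1:ℝ) ≤ ℓ P := by exact_mod_cast (hℓ P).one_lt.le
  exact inv_anti₀ (by positivity) (pow_le_pow_right₀ h2 (hk2 P))

theorem RC_Aprime (p : ℕ) (hp : Odd p) (m : ℕ) [NeZero m] (T : Set (Ideal (𝓞 F))) (hT : T.Finite) :
    ∃ P : Ideal (𝓞 F), P.IsPrime ∧ P ≠ ⊥ ∧ (Ideal.absNorm P).Prime ∧ P ∉ T ∧ ∃ 𝔞 : Ideal (𝓞 F), 𝔞 ≠ ⊥ ∧
      ∃ α : 𝓞 F, α ≠ 0 ∧ (m : 𝓞 F) ∣ α - 1 ∧ P * 𝔞 ^ p = Ideal.span {α} := by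
  classical
  by_contra hcon
  push Not at hcon
  refine RC_primes_not_summable (F := F) (m := m) p hp ?_
  have hmem : ∀ P : {P : {P : RC_RM F m | (P : Ideal (𝓞 F)).IsPrime} //
      ((QuotientGroup.mk' (powMonoidHom p : RC_G F m →* RC_G F m).range).comp (RC_cl F m)) P.1 = 1},
      (Ideal.absNorm (P.1.1 : Ideal (𝓞 F))).Prime → (P.1.1 : Ideal (𝓞 F)) ∈ T := by
    rintro ⟨⟨P, hP⟩, hφ⟩ hpr
    by_contra hPT
    simp only [MonoidHom.comp_apply, QuotientGroup.mk'_apply, QuotientGroup.eq_one_iff] at hφ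
    obtain ⟨x, hx⟩ := hφ
    obtain ⟨J, rfl⟩ := RC_cl_surj x
    rw [powMonoidHom_apply, ← map_pow, eq_comm, RC_cl_eq] at hx
    obtain ⟨α, β, h1, h2, h3, h4, h5⟩ := hx
    obtain ⟨k, hk, δ, hδ, hδ1, hJ⟩ := RC_pow_principal J
    obtain ⟨k, rfl⟩ : ∃ k', k = k' + 1 := ⟨k - 1, by omega⟩
    obtain ⟨q, rfl⟩ : ∃ q, p = q + 1 := ⟨p - 1, by have := hp.pos; omega⟩
    have hdvd : (m : 𝓞 F) ∣ β * α ^ q * δ ^ (q + 1) - 1 := by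
      rw [← Ideal.mem_span_singleton, ← Ideal.Quotient.eq] at h3 h4 hδ1 ⊢
      simp [h3, h4, hδ1]
    refine hcon P hP P.2.1 hpr hPT (Ideal.span {α} * (J : Ideal (𝓞 F)) ^ k) (mul_ne_zero (by simpa using h1) (pow_ne_zero _ J.2.1))
      (β * α ^ q * δ ^ (q + 1)) (mul_ne_zero (mul_ne_zero h2 (pow_ne_zero _ h1)) (pow_ne_zero _ hδ)) hdvd ?_
    rw [← Ideal.span_singleton_mul_span_singleton, ← Ideal.span_singleton_mul_span_singleton, ← Ideal.span_singleton_pow, ← Ideal.span_singleton_pow, ← hJ]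
    rw [SubmonoidClass.coe_pow] at h5
    calc _ = (Ideal.span {α} * (P : Ideal (𝓞 F))) * (Ideal.span {α} ^ q * ((J : Ideal (𝓞 F)) ^ k) ^ (q + 1)) := by ring
      _ = _ := by rw [h5]; ring
  have hexp : ∀ P : RC_RM F m, Real.exp (-Real.log (Ideal.absNorm (P : Ideal (𝓞 F)))) = ((Ideal.absNorm (P : Ideal (𝓞 F)) : ℕ) : ℝ)⁻¹ := by
    intro P
    rw [Real.exp_neg, Real.exp_log (by linarith [RC_absNorm_pos P.2.1])]
  simp only [hexp]
  -- reduce to sum over all primes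
  set w : Ideal (𝓞 F) → ℝ := fun P => ((Ideal.absNorm P : ℕ) : ℝ)⁻¹ with hw
  have hA : Summable (Set.indicator {P : Ideal (𝓞 F) | P.IsPrime ∧ P ≠ ⊥ ∧ ¬ (Ideal.absNorm P).Prime} w) := by
    rw [← summable_subtype_iff_indicator]
    exact RC_deg2_summable
  have hB : Summable (Set.indicator T w) := by
    refine summable_of_hasFiniteSupport (hT.subset ?_)
    exact Set.support_indicator_subset
  have hinj : Function.Injective (fun P : {P : {P : RC_RM F m | (P : Ideal (𝓞 F)).IsPrime} //
      ((QuotientGroup.mk' (powMonoidHom p : RC_G F m →* RC_G F m).range).comp (RC_cl F m)) P.1 = 1} => (P.1.1 : Ideal (𝓞 F))) :=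
    fun x y h => Subtype.ext (Subtype.ext (Subtype.ext h))
  refine Summable.of_nonneg_of_le (fun P => by positivity) (fun P => ?_) ((hA.add hB).comp_injective hinj)
  have hw0 : ∀ P, 0 ≤ w P := fun P => by positivity
  simp only [Function.comp]
  by_cases hpr : (Ideal.absNorm (P.1.1 : Ideal (𝓞 F))).Prime
  · rw [Set.indicator_of_mem (hmem P hpr)]
    have := Set.indicator_nonneg (s := {P : Ideal (𝓞 F) | P.IsPrime ∧ P ≠ ⊥ ∧ ¬ (Ideal.absNorm P).Prime}) (fun x _ => hw0 x) P.1.1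
    simp only [hw] at this ⊢
    linarith
  · rw [Set.indicator_of_mem (show (P.1.1 : Ideal (𝓞 F)) ∈ {P : Ideal (𝓞 F) | P.IsPrime ∧ P ≠ ⊥ ∧ ¬ (Ideal.absNorm P).Prime} from ⟨P.1.2, P.1.1.2.1, hpr⟩)]
    have := Set.indicator_nonneg (s := T) (fun x _ => hw0 x) P.1.1
    simp only [hw] at this ⊢
    linarith
end
end

section
section
open NumberField Polynomial

theorem RC_B0 {K : Type*} {E : Type} [Field K] [NumberField K] [Field E] [NumberField E] [Algebra K E]
    (f : E[X]) (hf : f ≠ 0) :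
    ∃ (F : Type) (_ : Field F) (_ : NumberField F) (_ : Algebra K F) (_ : Algebra E F),
      IsScalarTower K E F ∧ IsGalois K F ∧ (f.map (algebraMap E F)).Splits := by
  let M := SplittingField f
  haveI : FiniteDimensional K M := FiniteDimensional.trans K E M
  let Ω := AlgebraicClosure M
  haveI : CharZero M := charZero_of_injective_algebraMap (algebraMap K M).injective
  haveI : Algebra.IsAlgebraic K Ω := Algebra.IsAlgebraic.trans K M Ω
  haveI : Normal K Ω := normal_iff.2 fun x => ⟨Algebra.IsIntegral.isIntegral x, IsAlgClosed.splits _⟩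
  let F := IntermediateField.normalClosure K M Ω
  haveI : FiniteDimensional K F := inferInstance
  haveI : NumberField F := NumberField.of_module_finite K F
  letI : Algebra E F := ((algebraMap M F).comp (algebraMap E M)).toAlgebra
  refine ⟨F, inferInstance, inferInstance, inferInstance, inferInstance, ?_, ?_, ?_⟩
  · apply IsScalarTower.of_algebraMap_eq'
    rw [RingHom.algebraMap_toAlgebra, RingHom.comp_assoc, ← IsScalarTower.algebraMap_eq K E M, ← IsScalarTower.algebraMap_eq K M F]
  · haveI : Normal K F := inferInstance
    exact ⟨⟩
  · rw [RingHom.algebraMap_toAlgebra, ← Polynomial.map_map]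
    exact (SplittingField.splits f).map _
end
end

section
section
open NumberField

noncomputable def RC_Th {K F U : Type*} [Field K] [Field F] [Algebra K F] [FiniteDimensional K F] [Group U]
    (ω : Gal(F/K) →* U) (c : U → ℤ) (z : F) : F := ∏ σ : Gal(F/K), (σ z) ^ (c (ω σ))

variable {K F U : Type*} [Field K] [Field F] [Algebra K F] [FiniteDimensional K F] [Group U]
    (ω : Gal(F/K) →* U) (c : U → ℤ)

theorem RC_Th_mul (z w : F) : RC_Th ω c (z * w) = RC_Th ω c z * RC_Th ω c w := by
  simp [RC_Th, mul_zpow, Finset.prod_mul_distrib]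

theorem RC_Th_pow (z : F) (n : ℕ) : RC_Th ω c (z ^ n) = RC_Th ω c z ^ n := by
  rw [RC_Th, RC_Th, ← Finset.prod_pow]
  refine Finset.prod_congr rfl fun σ _ => ?_
  rw [map_pow, ← zpow_natCast, ← zpow_natCast, zpow_comm]

theorem RC_Th_ne_zero {z : F} (hz : z ≠ 0) : RC_Th ω c z ≠ 0 := by
  rw [RC_Th, Finset.prod_ne_zero_iff]
  intro σ _
  exact zpow_ne_zero _ (by simpa using hz)

theorem RC_Th_exp (c' c'' : U → ℤ) (k p : ℕ) (h : ∀ u, c u = k * c' u + p * c'' u) {z : F} (hz : z ≠ 0) :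
    RC_Th ω c z = RC_Th ω c' z ^ k * RC_Th ω c'' z ^ p := by
  rw [RC_Th, RC_Th, RC_Th, ← Finset.prod_pow, ← Finset.prod_pow, ← Finset.prod_mul_distrib]
  refine Finset.prod_congr rfl fun σ _ => ?_
  have : σ z ≠ 0 := by simpa using hz
  rw [h, zpow_add₀ this, mul_comm (k : ℤ), zpow_mul, mul_comm (p : ℤ), zpow_mul, zpow_natCast, zpow_natCast]

theorem RC_Th_act (ρ : Gal(F/K)) (z : F) :
    ρ (RC_Th ω c z) = RC_Th ω (fun u => c ((ω ρ)⁻¹ * u)) z := by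
  rw [RC_Th, RC_Th, map_prod]
  refine Fintype.prod_equiv (Equiv.mulLeft ρ) _ _ fun σ => ?_
  rw [map_zpow₀]
  simp

theorem RC_Th_mem {E : Type*} [Field E] [Algebra K E] [Algebra E F] [IsScalarTower K E F] [IsGalois K F]
    (h : ∀ g : Gal(F/E), ω (g.restrictScalars K) = 1) (z : F) :
    ∃ y : E, algebraMap E F y = RC_Th ω c z := by
  have := IsGalois.tower_top_of_isGalois K E F
  have := FiniteDimensional.right K E F
  have := (IsGalois.mem_range_algebraMap_iff_fixed (F := E) (RC_Th ω c z)).2 (fun g => by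
    have h1 := RC_Th_act ω c (g.restrictScalars K) z
    rw [h] at h1
    simpa using h1)
  exact this

theorem RC_Th_int (a : U → ℕ) [NumberField F] (z : 𝓞 F) :
    RC_Th ω (fun u => (a u : ℤ)) (z : F) = ((∏ σ : Gal(F/K), (σ • z) ^ a (ω σ) : 𝓞 F) : F) := by
  rw [RC_Th, RingOfIntegers.coe_eq_algebraMap (∏ σ : Gal(F/K), (σ • z) ^ a (ω σ)), map_prod]
  refine Finset.prod_congr rfl fun σ _ => ?_
  rw [zpow_natCast, map_pow]
  rfl

theorem RC_desc_int {E : Type*} [Field E] [NumberField E] [NumberField F] [Algebra E F] (y : E) (x : 𝓞 F)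
    (h : algebraMap E F y = (x : F)) : ∃ y' : 𝓞 E, (y' : E) = y ∧ algebraMap (𝓞 E) (𝓞 F) y' = x := by
  have hy : IsIntegral ℤ y := by
    rw [← isIntegral_algebraMap_iff (algebraMap E F).injective, h]
    exact x.2
  refine ⟨⟨y, hy⟩, rfl, ?_⟩
  apply RingOfIntegers.ext
  rw [← h]
  rfl

end
end

section
section
open NumberField Pointwise

variable {F : Type*} [Field F] [NumberField F]

theorem RC_resdeg1 {P : Ideal (𝓞 F)} (hP : (Ideal.absNorm P).Prime) (θ : 𝓞 F) : ∃ x : ℕ, θ - x ∈ P := by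
  have hc : Nat.card (𝓞 F ⧸ P) = Ideal.absNorm P := rfl
  haveI : Fact (Nat.card (𝓞 F ⧸ P)).Prime := ⟨hc ▸ hP⟩
  haveI : Finite (𝓞 F ⧸ P) := Nat.finite_of_card_ne_zero (Fact.out : (Nat.card (𝓞 F ⧸ P)).Prime).ne_zero
  haveI : Nontrivial (𝓞 F ⧸ P) := Finite.one_lt_card_iff_nontrivial.1 (Fact.out : (Nat.card (𝓞 F ⧸ P)).Prime).one_lt
  have h1 := mem_zmultiples_of_prime_card (p := Nat.card (𝓞 F ⧸ P)) (g := (1 : 𝓞 F ⧸ P)) (g' := Ideal.Quotient.mk P θ) rfl one_ne_zero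
  rw [← mem_multiples_iff_mem_zmultiples] at h1
  obtain ⟨x, hx⟩ := h1
  refine ⟨x, ?_⟩
  rw [← Ideal.Quotient.mk_eq_mk_iff_sub_mem, map_natCast, ← hx]
  simp

theorem RC_bad_finite {δ : 𝓞 F} (h : δ ≠ 0) : {P : Ideal (𝓞 F) | δ ∈ P}.Finite := by
  refine (Ideal.finite_setOfPred_absNorm_le (S := 𝓞 F) (Ideal.absNorm (Ideal.span {δ}))).subset ?_
  intro P hP
  apply Nat.le_of_dvd
  · rw [Nat.pos_iff_ne_zero, Ne, Ideal.absNorm_eq_zero_iff, Ideal.span_singleton_eq_bot]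
    exact h
  · apply Ideal.absNorm_dvd_absNorm_of_le
    rwa [Ideal.span_singleton_le_iff_mem]

/-- moving lemma -/
theorem RC_move (P 𝔞 : Ideal (𝓞 F)) (h𝔞 : 𝔞 ≠ ⊥) (α : 𝓞 F) (p : ℕ) (h : P * 𝔞 ^ p = Ideal.span {α})
    (D : 𝓞 F) (hD : D ≠ 0) (hD' : ¬ IsUnit D) :
    ∃ (w τ u : 𝓞 F) (𝔡 : Ideal (𝓞 F)), w ≠ 0 ∧ τ ≠ 0 ∧ w ^ p * α = u * τ ^ p ∧
      Ideal.span {u} = P * 𝔡 ^ p ∧ 𝔡 ⊔ Ideal.span {D} = ⊤ := by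
  have hDb : Ideal.span {D} ≠ ⊥ := by rwa [Ne, Ideal.span_singleton_eq_bot]
  obtain ⟨τ, hτ⟩ := IsDedekindDomain.exists_sup_span_eq (I := 𝔞 * Ideal.span {D}) (J := 𝔞)
    Ideal.mul_le_left (mul_ne_zero h𝔞 hDb)
  have hτ0 : τ ≠ 0 := by
    rintro rfl
    rw [Ideal.span_singleton_zero, sup_bot_eq] at hτ
    have := mul_left_cancel₀ h𝔞 (hτ.trans (mul_one 𝔞).symm)
    rw [Ideal.one_eq_top, Ideal.span_singleton_eq_top] at this
    exact hD' this
  have hle : Ideal.span {τ} ≤ 𝔞 := le_sup_right.trans hτ.le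
  obtain ⟨𝔠, h𝔠⟩ := Ideal.dvd_iff_le.2 hle
  have hco : Ideal.span {D} ⊔ 𝔠 = ⊤ := by
    rw [h𝔠, ← Ideal.mul_sup] at hτ
    have := mul_left_cancel₀ h𝔞 (hτ.trans (mul_one 𝔞).symm)
    rwa [Ideal.one_eq_top] at this
  have h1 : (1 : 𝓞 F) ∈ Ideal.span {D} ⊔ 𝔠 := by rw [hco]; trivial
  obtain ⟨y, hy, w, hw, hyw⟩ := Submodule.mem_sup.1 h1
  have hw0 : w ≠ 0 := by
    rintro rfl
    rw [add_zero] at hyw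
    rw [hyw] at hy
    exact hD' (Ideal.span_singleton_eq_top.1 ((Ideal.eq_top_iff_one _).2 hy))
  obtain ⟨𝔡, h𝔡⟩ := Ideal.dvd_iff_le.2 ((Ideal.span_singleton_le_iff_mem _).2 hw)
  have hco2 : 𝔡 ⊔ Ideal.span {D} = ⊤ := by
    rw [Ideal.eq_top_iff_one, ← hyw, add_comm]
    refine Submodule.add_mem_sup ?_ hy
    have : Ideal.span {w} ≤ 𝔡 := by rw [h𝔡]; exact Ideal.mul_le_right
    exact this (Ideal.mem_span_singleton_self w)
  have hkey : Ideal.span {w ^ p * α} = Ideal.span {τ ^ p} * (P * 𝔡 ^ p) := by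
    rw [← Ideal.span_singleton_mul_span_singleton, ← Ideal.span_singleton_pow, ← Ideal.span_singleton_pow,
      ← h, h𝔠, h𝔡]
    ring
  have hdvd : τ ^ p ∣ w ^ p * α := by
    rw [← Ideal.span_singleton_le_span_singleton, hkey]
    exact Ideal.mul_le_left
  obtain ⟨u, hu⟩ := hdvd
  refine ⟨w, τ, u, 𝔡, hw0, hτ0, by rw [hu, mul_comm], ?_, hco2⟩
  rw [hu, ← Ideal.span_singleton_mul_span_singleton] at hkey
  refine mul_left_cancel₀ ?_ hkey
  rw [Ne, Ideal.zero_eq_bot, Ideal.span_singleton_eq_bot]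
  exact pow_ne_zero _ hτ0

/-- order of a root of unity mod P -/
theorem RC_root_card {P : Ideal (𝓞 F)} (hP : (Ideal.absNorm P).Prime) (p n : ℕ) [Fact p.Prime] (ξ : 𝓞 F)
    (h1 : ξ ^ (p ^ (n + 1)) = 1) (h2 : ξ ^ (p ^ n) - 1 ∉ P) : p ^ (n + 1) ∣ Ideal.absNorm P - 1 := by
  classical
  have hc : Nat.card (𝓞 F ⧸ P) = Ideal.absNorm P := rfl
  haveI hPp : P.IsPrime := Ideal.isPrime_of_irreducible_absNorm hP.prime.irreducible
  have h0 : P ≠ ⊥ := by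
    rintro rfl
    rw [Ideal.absNorm_bot] at hP
    exact Nat.not_prime_zero hP
  haveI : P.IsMaximal := hPp.isMaximal h0
  letI := Ideal.Quotient.field P
  haveI : Finite (𝓞 F ⧸ P) := Nat.finite_of_card_ne_zero (hc ▸ hP.ne_zero)
  letI := Fintype.ofFinite (𝓞 F ⧸ P)
  have hu : IsUnit (Ideal.Quotient.mk P ξ) := by
    refine IsUnit.of_pow_eq_one (n := p ^ (n+1)) (by rw [← map_pow, h1, map_one]) (pow_ne_zero _ (Fact.out : p.Prime).ne_zero)
  obtain ⟨x, hx⟩ := hu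
  have ho : orderOf x = p ^ (n + 1) := by
    apply orderOf_eq_prime_pow
    · intro h
      apply h2
      rw [← Ideal.Quotient.eq_zero_iff_mem, map_sub, map_pow, ← hx, ← Units.val_pow_eq_pow_val, h]
      simp
    · ext
      rw [Units.val_pow_eq_pow_val, hx, ← map_pow, h1, map_one, Units.val_one]
  rw [← ho, ← hc, Nat.card_eq_fintype_card, ← Fintype.card_units]
  exact orderOf_dvd_card

end
end

section
section
open NumberField Pointwise

variable {K F : Type*} [Field K] [NumberField K] [Field F] [NumberField F] [Algebra K F]

theorem RC_smul_span (σ : Gal(F/K)) (x : 𝓞 F) : σ • (Ideal.span {x} : Ideal (𝓞 F)) = Ideal.span {σ • x} := by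
  rw [Ideal.pointwise_smul_def, Ideal.map_span, Set.image_singleton]; rfl

theorem RC_smul_mul (σ : Gal(F/K)) (I J : Ideal (𝓞 F)) : σ • (I * J) = (σ • I) * (σ • J) := by
  simp only [Ideal.pointwise_smul_def, Ideal.map_mul]

theorem RC_smul_pow (σ : Gal(F/K)) (I : Ideal (𝓞 F)) (n : ℕ) : σ • (I ^ n) = (σ • I) ^ n := by
  simp only [Ideal.pointwise_smul_def, Ideal.map_pow]

theorem RC_smul_ne_bot (σ : Gal(F/K)) {I : Ideal (𝓞 F)} (h : I ≠ ⊥) : σ • I ≠ ⊥ := by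
  intro h'
  apply h
  rw [← inv_smul_smul σ I, h', Ideal.pointwise_smul_def, Ideal.map_bot]

theorem RC_smul_prime (σ : Gal(F/K)) {P : Ideal (𝓞 F)} (h : P.IsPrime) : (σ • P).IsPrime := by
  infer_instance

theorem RC_emult {P 𝔞 : Ideal (𝓞 F)} (hP : P.IsPrime) (h0 : P ≠ ⊥) (hdist : ∀ g : Gal(F/K), g • P = P → g = 1)
    (h𝔞 : 𝔞 ≠ ⊥) {α : 𝓞 F} {p : ℕ} (h : P * 𝔞 ^ p = Ideal.span {α}) (a : Gal(F/K) → ℕ) (τ : Gal(F/K)) :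
    ∃ M : ℕ, emultiplicity (τ • P) (Ideal.span {∏ σ : Gal(F/K), (σ • α) ^ a σ}) = ((a τ + p * M : ℕ) : ℕ∞) := by
  classical
  have hτP : (τ • P).IsPrime := RC_smul_prime τ hP
  have hpr : Prime (τ • P) := Ideal.prime_of_isPrime (RC_smul_ne_bot τ h0) hτP
  have hfin : ∀ σ : Gal(F/K), ∃ n : ℕ, emultiplicity (τ • P) (σ • 𝔞) = (n : ℕ∞) := by
    intro σ
    have : FiniteMultiplicity (τ • P) (σ • 𝔞) := FiniteMultiplicity.of_prime_left hpr (RC_smul_ne_bot σ h𝔞)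
    exact ⟨_, this.emultiplicity_eq_multiplicity⟩
  choose n hn using hfin
  have h1 : ∀ σ : Gal(F/K), emultiplicity (τ • P) (σ • P) = if σ = τ then 1 else 0 := by
    intro σ
    split_ifs with hσ
    · rw [hσ]
      exact (FiniteMultiplicity.of_prime_left hpr hpr.ne_zero).emultiplicity_self
    · rw [emultiplicity_eq_zero, Ideal.dvd_iff_le]
      intro hle
      have hm : (σ • P).IsMaximal := (RC_smul_prime σ hP).isMaximal (RC_smul_ne_bot σ h0)
      have := hm.eq_of_le hτP.ne_top hle
      apply hσ
      have h3 : (τ⁻¹ * σ) • P = P := by rw [mul_smul, this, inv_smul_smul]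
      have := hdist _ h3
      rwa [inv_mul_eq_one, eq_comm] at this
  have h2 : ∀ σ : Gal(F/K), emultiplicity (τ • P) (Ideal.span {σ • α}) = (((if σ = τ then 1 else 0) + p * n σ : ℕ) : ℕ∞) := by
    intro σ
    rw [← RC_smul_span, ← h, RC_smul_mul, RC_smul_pow, emultiplicity_mul hpr, emultiplicity_pow hpr, h1, hn]
    push_cast
    simp
  refine ⟨∑ σ, a σ * n σ, ?_⟩
  rw [← Ideal.prod_span_singleton, Finset.emultiplicity_prod hpr]
  simp_rw [← Ideal.span_singleton_pow, emultiplicity_pow hpr, h2]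
  rw [← Nat.cast_inj (R := ℕ∞).2 (show ∑ σ, a σ * ((if σ = τ then 1 else 0) + p * n σ) = a τ + p * ∑ σ, a σ * n σ from ?_)]
  · push_cast
    rfl
  · simp_rw [mul_add, Finset.sum_add_distrib, Finset.mul_sum]
    congr 1
    · simp
    · exact Finset.sum_congr rfl fun _ _ => by ring

end
end

section
section
open NumberField Pointwise

theorem RC_primroot_pow {R : Type*} [Field R] {x : R} {p : ℕ} (h : IsPrimitiveRoot x p) (hp : p ≠ 0) {i j : ℕ}
    (hij : x ^ i = x ^ j) : (i : ZMod p) = j := by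
  have h1 : x ^ ((i : ℤ) - j) = 1 := by
    rw [zpow_sub₀ (h.ne_zero hp), zpow_natCast, zpow_natCast, hij, div_self]
    exact pow_ne_zero _ (h.ne_zero hp)
  rw [h.zpow_eq_one_iff_dvd, ← ZMod.intCast_zmod_eq_zero_iff_dvd] at h1
  push_cast at h1
  exact sub_eq_zero.1 h1

theorem RC_step_F {K E F : Type*} [Field K] [NumberField K] [Field E] [NumberField E] [Field F] [NumberField F]
    [Algebra K F] [Algebra K E] [Algebra E F] [IsScalarTower K E F] [IsGalois K F] [IsGalois K E]
    (p : ℕ) [Fact p.Prime] (hodd : Odd p) (ζ : E) (hζ : IsPrimitiveRoot ζ p) {J : Type*}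
    (βj : J → 𝓞 E) (bj : J → 𝓞 F) (hb : ∀ j, algebraMap (𝓞 E) (𝓞 F) (βj j) = bj j ^ p)
    (n : ℕ) (ξ : 𝓞 F) (hξ1 : ξ ^ (p ^ (n + 1)) = 1) (hξ2 : ξ ^ (p ^ n) ≠ 1) (m : ℕ) [NeZero m] :
    ∃ (q : Ideal (𝓞 K)) (β : 𝓞 E), q.IsPrime ∧ q ≠ ⊥ ∧ (m : 𝓞 K) ∉ q ∧
      p ^ (n + 1) ∣ Nat.card (𝓞 K ⧸ q) - 1 ∧ β ≠ 0 ∧ (m : 𝓞 E) ∣ β - 1 ∧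
      (∀ (σ : Gal(E/K)) (k : ℕ), σ ζ = ζ ^ k → ∃ γ : E, σ (β : E) = (β : E) ^ k * γ ^ p) ∧
      (∀ Q : Ideal (𝓞 E), Q.IsPrime → Q ≠ ⊥ → Q.comap (algebraMap (𝓞 K) (𝓞 E)) ≠ q →
        ∃ c : E, c ≠ 0 ∧ ∃ u : 𝓞 E, u ∉ Q ∧ (β : E) * c ^ p = u) ∧
      (∀ Q : Ideal (𝓞 E), Q.IsPrime → Q.comap (algebraMap (𝓞 K) (𝓞 E)) = q →
        ∃ v : ℕ, ¬ p ∣ v ∧ emultiplicity Q (Ideal.span {β}) = (v : ℕ∞)) ∧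
      (∀ Q : Ideal (𝓞 E), Q.IsPrime → Q.comap (algebraMap (𝓞 K) (𝓞 E)) = q →
        ∀ j, ∃ x : ℕ, βj j - x ^ p ∈ Q) := by
  classical
  have hpp : p.Prime := Fact.out
  haveI : NeZero p := ⟨hpp.ne_zero⟩
  -- bad element
  have hth : ∀ g : Gal(F/K), g ≠ 1 → ∃ θ : 𝓞 F, g • θ ≠ θ := by
    intro g hg
    by_contra hcon
    push Not at hcon
    apply hg
    ext x
    obtain ⟨y, z, hz, hyz⟩ := IsFractionRing.div_surjective (A := 𝓞 F) x
    rw [← hyz, map_div₀]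
    have h1 : ∀ y : 𝓞 F, g (algebraMap (𝓞 F) F y) = algebraMap (𝓞 F) F y := fun y => congrArg (algebraMap (𝓞 F) F) (hcon y)
    rw [h1, h1]
    rfl
  choose! θ hθ using hth
  let δ : 𝓞 F := (m : 𝓞 F) * (ξ ^ (p ^ n) - 1) * ∏ g ∈ Finset.univ.filter (fun g : Gal(F/K) => g ≠ 1), (g • θ g - θ g)
  have hδ : δ ≠ 0 := by
    refine mul_ne_zero (mul_ne_zero (Nat.cast_ne_zero.2 (NeZero.ne m)) (sub_ne_zero.2 hξ2)) ?_
    rw [Finset.prod_ne_zero_iff]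
    intro g hg
    exact sub_ne_zero.2 (hθ g (Finset.mem_filter.1 hg).2)
  obtain ⟨P, hP, hP0, hNP, hPT, 𝔞, h𝔞, α, hα, hmα, hPα⟩ := RC_Aprime (F := F) p hodd m _ (RC_bad_finite hδ)
  have hδP : δ ∉ P := hPT
  have hmP : (m : 𝓞 F) ∉ P := fun h => hδP (by
    simp only [δ, mul_assoc]; exact Ideal.mul_mem_right _ _ h)
  have hξP : ξ ^ (p ^ n) - 1 ∉ P := fun h => hδP (Ideal.mul_mem_right _ _ (Ideal.mul_mem_left _ _ h))
  have hdist : ∀ g : Gal(F/K), g • P = P → g = 1 := by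
    intro g hg
    by_contra hne
    apply hδP
    refine Ideal.mul_mem_left _ _ ?_
    rw [← Finset.mul_prod_erase _ _ (Finset.mem_filter.2 ⟨Finset.mem_univ g, hne⟩)]
    refine Ideal.mul_mem_right _ _ ?_
    obtain ⟨x, hx⟩ := RC_resdeg1 hNP (θ g)
    have h1 : g • (θ g - x) ∈ P := by
      rw [← hg]
      exact Ideal.smul_mem_pointwise_smul_iff.2 hx
    rw [smul_sub] at h1
    have h2 : g • (x : 𝓞 F) = x := map_natCast (MulSemiringAction.toRingHom Gal(F/K) (𝓞 F) g) x
    rw [h2] at h1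
    have := P.sub_mem h1 hx
    rwa [sub_sub_sub_cancel_right] at this
  -- conjugates have residue degree one
  have hres : ∀ (g : Gal(F/K)) (θ : 𝓞 F), ∃ x : ℕ, θ - x ∈ g • P := by
    intro g θ
    obtain ⟨x, hx⟩ := RC_resdeg1 hNP (g⁻¹ • θ)
    refine ⟨x, ?_⟩
    have h1 : g • (g⁻¹ • θ - x) ∈ g • P := Ideal.smul_mem_pointwise_smul_iff.2 hx
    have h2 : g • (x : 𝓞 F) = x := map_natCast (MulSemiringAction.toRingHom Gal(F/K) (𝓞 F) g) x
    rwa [smul_sub, h2, smul_inv_smul] at h1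
  have hαP : α ∈ P := by
    have : Ideal.span {α} ≤ P := by rw [← hPα]; exact Ideal.mul_le_left
    exact this (Ideal.mem_span_singleton_self α)
  let q : Ideal (𝓞 K) := P.comap (algebraMap (𝓞 K) (𝓞 F))
  have hq : q.IsPrime := Ideal.IsPrime.comap _
  have hq0 : q ≠ ⊥ := Ideal.comap_ne_bot_of_integral_mem (I := P) (x := α) hα hαP (Algebra.IsIntegral.isIntegral α)
  have hconj : ∀ M : Ideal (𝓞 F), M.IsPrime → M.comap (algebraMap (𝓞 K) (𝓞 F)) = q → ∃ g : Gal(F/K), M = g • P := by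
    intro M hM hMq
    haveI : M.LiesOver q := ⟨hMq.symm⟩
    haveI : P.LiesOver q := ⟨rfl⟩
    obtain ⟨g, hg⟩ := Ideal.exists_smul_eq_of_isGaloisGroup q P M Gal(F/K)
    exact ⟨g, hg.symm⟩
  have hover : ∀ Q : Ideal (𝓞 E), Q.IsPrime → ∃ M : Ideal (𝓞 F), M.IsPrime ∧ M.comap (algebraMap (𝓞 E) (𝓞 F)) = Q := by
    intro Q hQ
    obtain ⟨M, -, h1, h2⟩ := Ideal.exists_ideal_over_prime_of_isIntegral (S := 𝓞 F) Q ⊥ (by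
      rw [← RingHom.ker_eq_comap_bot, (RingHom.injective_iff_ker_eq_bot _).1 (FaithfulSMul.algebraMap_injective (𝓞 E) (𝓞 F))]
      exact bot_le)
    exact ⟨M, h1, h2⟩
  have htower : ∀ M : Ideal (𝓞 F), (M.comap (algebraMap (𝓞 E) (𝓞 F))).comap (algebraMap (𝓞 K) (𝓞 E)) = M.comap (algebraMap (𝓞 K) (𝓞 F)) := by
    intro M
    rw [Ideal.comap_comap, ← IsScalarTower.algebraMap_eq]
  -- the character
  have hζF : IsPrimitiveRoot (algebraMap E F ζ) p := hζ.map_of_injective (algebraMap E F).injective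
  let ω : Gal(F/K) →* (ZMod p)ˣ := hζF.autToPow K
  have hω : ∀ (g : Gal(F/K)) (k : ℕ), g (algebraMap E F ζ) = (algebraMap E F ζ) ^ k → ((ω g : (ZMod p)ˣ) : ZMod p) = k := by
    intro g k hk
    have h1 := hζF.autToPow_spec K g
    rw [hk] at h1
    have h2 := RC_primroot_pow hζF hpp.ne_zero h1
    rwa [ZMod.natCast_zmod_val] at h2
  have hωE : ∀ g : Gal(F/E), ω (g.restrictScalars K) = 1 := by
    intro g
    ext
    rw [hω _ 1 (by simp)]
    simp
  let a : (ZMod p)ˣ → ℕ := fun u => ((u⁻¹ : (ZMod p)ˣ) : ZMod p).val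
  have ha : ∀ u, ¬ p ∣ a u := by
    intro u h
    rw [← ZMod.natCast_eq_zero_iff, ZMod.natCast_zmod_val] at h
    exact (u⁻¹).ne_zero h
  obtain ⟨β', hβ'⟩ := RC_Th_mem ω (fun u => (a u : ℤ)) hωE (α : F)
  obtain ⟨β, hβE, hβF⟩ := RC_desc_int β' _ (hβ'.trans (RC_Th_int ω a α))
  subst hβE
  have hβ0 : β ≠ 0 := by
    rintro rfl
    apply RC_Th_ne_zero ω (fun u => (a u : ℤ)) (z := (α : F)) (by simpa using hα)
    rw [← hβ']
    simp
  have hPmax : ∀ g : Gal(F/K), (g • P).IsMaximal := fun g => (RC_smul_prime g hP).isMaximal (RC_smul_ne_bot g hP0)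
  refine ⟨q, β, hq, hq0, ?_, ?_, hβ0, ?_, ?_, ?_, ?_, ?_⟩
  · intro h
    have : algebraMap (𝓞 K) (𝓞 F) (m : 𝓞 K) ∈ P := h
    rw [map_natCast] at this
    exact hmP this
  · have hcard : Nat.card (𝓞 K ⧸ q) = Ideal.absNorm P := by
      show Nat.card (𝓞 K ⧸ q) = Nat.card (𝓞 F ⧸ P)
      refine Nat.card_congr (Equiv.ofBijective (Ideal.quotientMap P (algebraMap (𝓞 K) (𝓞 F)) le_rfl) ⟨?_, ?_⟩)
      · exact Ideal.quotientMap_injective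
      · intro y
        obtain ⟨y, rfl⟩ := Ideal.Quotient.mk_surjective y
        obtain ⟨x, hx⟩ := RC_resdeg1 hNP y
        refine ⟨(x : 𝓞 K ⧸ q), ?_⟩
        rw [map_natCast, eq_comm, ← map_natCast (Ideal.Quotient.mk P)]
        exact Ideal.Quotient.mk_eq_mk_iff_sub_mem _ _ |>.2 hx
    rw [hcard]
    exact RC_root_card hNP p n ξ hξ1 hξP
  · have h1 : (m : 𝓞 F) ∣ (∏ σ : Gal(F/K), (σ • α) ^ a (ω σ)) - 1 := by
      rw [← Ideal.mem_span_singleton, ← Ideal.Quotient.mk_eq_mk_iff_sub_mem, map_prod, map_one]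
      refine Finset.prod_eq_one fun σ _ => ?_
      have : Ideal.Quotient.mk (Ideal.span {(m : 𝓞 F)}) (σ • α) = 1 := by
        rw [← map_one (Ideal.Quotient.mk (Ideal.span {(m : 𝓞 F)})), Ideal.Quotient.mk_eq_mk_iff_sub_mem, Ideal.mem_span_singleton]
        obtain ⟨y, hy⟩ := hmα
        refine ⟨σ • y, ?_⟩
        have h2 : σ • (m : 𝓞 F) = m := map_natCast (MulSemiringAction.toRingHom Gal(F/K) (𝓞 F) σ) m
        have h3 := congrArg (σ • ·) hy
        simp only [smul_sub, smul_mul', smul_one, h2] at h3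
        exact h3
      rw [map_pow, this, one_pow]
    obtain ⟨y, hy⟩ := h1
    have hm0 : (m : E) ≠ 0 := Nat.cast_ne_zero.2 (NeZero.ne m)
    obtain ⟨y', hy1, hy2⟩ := RC_desc_int (((β : E) - 1) / m) y (by
      have hm0 : (m : F) ≠ 0 := Nat.cast_ne_zero.2 (NeZero.ne m)
      rw [map_div₀, map_sub, map_one, map_natCast, hβ', RC_Th_int, div_eq_iff hm0]
      have := congrArg (algebraMap (𝓞 F) F) hy
      rw [map_sub, map_one, map_mul, map_natCast] at this
      rw [mul_comm]
      exact this)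
    refine ⟨y', ?_⟩
    apply RingOfIntegers.ext
    rw [RingOfIntegers.coe_eq_algebraMap, RingOfIntegers.coe_eq_algebraMap, map_sub, map_one, map_mul, map_natCast,
      ← RingOfIntegers.coe_eq_algebraMap y', hy1]
    field_simp
  · intro σ k hk
    obtain ⟨ρ, rfl⟩ := AlgEquiv.restrictNormalHom_surjective (F := K) (K₁ := E) F σ
    have hcomm : ∀ x : E, algebraMap E F (AlgEquiv.restrictNormalHom E ρ x) = ρ (algebraMap E F x) :=
      fun x => AlgEquiv.restrictNormal_commutes ρ E x
    have hωρ : ((ω ρ : (ZMod p)ˣ) : ZMod p) = k := hω ρ k (by rw [← hcomm, hk, map_pow])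
    have hex : ∀ u : (ZMod p)ˣ, ∃ c : ℤ, ((a ((ω ρ)⁻¹ * u) : ℕ) : ℤ) = k * (a u : ℤ) + p * c := by
      intro u
      have : (p : ℤ) ∣ ((a ((ω ρ)⁻¹ * u) : ℕ) : ℤ) - k * (a u : ℤ) := by
        rw [← ZMod.intCast_zmod_eq_zero_iff_dvd]
        push_cast
        simp only [a, ZMod.natCast_zmod_val, mul_inv_rev, inv_inv, Units.val_mul, hωρ]
        ring
      obtain ⟨c, hc⟩ := this
      exact ⟨c, by linarith⟩
    choose c hc using hex
    obtain ⟨γ, hγ⟩ := RC_Th_mem ω c hωE (α : F)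
    refine ⟨γ, (algebraMap E F).injective ?_⟩
    rw [hcomm, hβ', RC_Th_act, map_mul, map_pow, map_pow, hβ', hγ]
    exact RC_Th_exp ω _ _ c k p hc (by simpa using hα)
  · intro Q hQ hQ0 hQq
    obtain ⟨M, hM, hMQ⟩ := hover Q hQ
    have hN0 : Ideal.absNorm Q ≠ 0 := by rwa [Ne, Ideal.absNorm_eq_zero_iff]
    have hDM : ((Ideal.absNorm Q : ℕ) : 𝓞 F) ∈ M := by
      have : algebraMap (𝓞 E) (𝓞 F) (Ideal.absNorm Q : ℕ) ∈ M := by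
        rw [← Ideal.mem_comap, hMQ]
        exact Ideal.absNorm_mem Q
      rwa [map_natCast] at this
    obtain ⟨w, τ, u, 𝔡, hw, hτ, hwu, hu, h𝔡⟩ := RC_move P 𝔞 h𝔞 α p hPα ((Ideal.absNorm Q : ℕ) : 𝓞 F) (Nat.cast_ne_zero.2 hN0)
      (fun h => hM.ne_top (Ideal.eq_top_of_isUnit_mem _ hDM h))
    have hwF : (w : F) ≠ 0 := by simpa using hw
    have hτF : (τ : F) ≠ 0 := by simpa using hτ
    obtain ⟨c, hc⟩ := RC_Th_mem ω (fun u => (a u : ℤ)) hωE ((w : F) / τ)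
    have hc0 : c ≠ 0 := by
      rintro rfl
      apply RC_Th_ne_zero ω (fun u => (a u : ℤ)) (div_ne_zero hwF hτF)
      rw [← hc, map_zero]
    have hkey : algebraMap E F ((β : E) * c ^ p) = ((∏ σ : Gal(F/K), (σ • u) ^ a (ω σ) : 𝓞 F) : F) := by
      rw [← RC_Th_int, map_mul, map_pow, hβ', hc, ← RC_Th_pow, ← RC_Th_mul]
      congr 1
      have := congrArg (algebraMap (𝓞 F) F) hwu
      rw [map_mul, map_mul, map_pow, map_pow] at this
      rw [div_pow, mul_div_assoc', div_eq_iff (pow_ne_zero _ hτF), mul_comm]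
      exact this
    obtain ⟨u', hu'E, hu'F⟩ := RC_desc_int _ _ hkey
    refine ⟨c, hc0, u', ?_, hu'E.symm⟩
    intro hmem
    rw [← hMQ, Ideal.mem_comap, hu'F, hM.prod_mem_iff] at hmem
    obtain ⟨σ, -, hσ⟩ := hmem
    have hσ' := hM.mem_of_pow_mem _ hσ
    have hle : P * 𝔡 ^ p ≤ σ⁻¹ • M := by
      rw [← hu, Ideal.span_singleton_le_iff_mem]
      have := (Ideal.smul_mem_pointwise_smul_iff (a := σ⁻¹)).2 hσ'
      rwa [inv_smul_smul] at this
    have hσM : (σ⁻¹ • M).IsPrime := RC_smul_prime _ hM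
    rcases hσM.mul_le.1 hle with h1 | h1
    · have h2 := (hP.isMaximal hP0).eq_of_le hσM.ne_top h1
      apply hQq
      have h3 : M = σ • P := by rw [h2, smul_inv_smul]
      rw [← hMQ, htower, h3]
      ext x
      rw [Ideal.mem_comap, Ideal.mem_comap, ← Ideal.smul_mem_pointwise_smul_iff (a := σ) (S := P)]
      have h4 : σ • (algebraMap (𝓞 K) (𝓞 F) x) = algebraMap (𝓞 K) (𝓞 F) x := smul_algebraMap σ x
      rw [h4]
    · have h2 : 𝔡 ≤ σ⁻¹ • M := hσM.le_of_pow_le h1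
      apply hσM.ne_top
      rw [eq_top_iff, ← h𝔡]
      refine sup_le h2 ?_
      rw [Ideal.span_singleton_le_iff_mem]
      have := (Ideal.smul_mem_pointwise_smul_iff (a := σ⁻¹)).2 hDM
      have h2 : σ⁻¹ • ((Ideal.absNorm Q : ℕ) : 𝓞 F) = (Ideal.absNorm Q : ℕ) := map_natCast (MulSemiringAction.toRingHom Gal(F/K) (𝓞 F) σ⁻¹) _
      rwa [h2] at this
  · intro Q hQ hQq
    obtain ⟨M, hM, hMQ⟩ := hover Q hQ
    obtain ⟨g, rfl⟩ := hconj M hM (by rw [← htower, hMQ, hQq])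
    obtain ⟨N, hN⟩ := RC_emult hP hP0 hdist h𝔞 hPα (fun σ => a (ω σ)) g
    have hQ0 : Q ≠ ⊥ := by
      rintro rfl
      apply hq0
      rw [← hQq, ← RingHom.ker_eq_comap_bot, (RingHom.injective_iff_ker_eq_bot _).1 (FaithfulSMul.algebraMap_injective (𝓞 K) (𝓞 E))]
    have hfin : FiniteMultiplicity Q (Ideal.span {β}) :=
      FiniteMultiplicity.of_prime_left (Ideal.prime_of_isPrime hQ0 hQ) (by rwa [Ne, Ideal.zero_eq_bot, Ideal.span_singleton_eq_bot])
    refine ⟨multiplicity Q (Ideal.span {β}), ?_, hfin.emultiplicity_eq_multiplicity⟩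
    haveI : (g • P).LiesOver Q := ⟨hMQ.symm⟩
    have h1 := Ideal.IsDedekindDomain.emultiplicity_map_eq_ramificationIdx'_mul (v := Q) (w := g • P) (I := Ideal.span {β})
      (by rwa [Ne, Ideal.span_singleton_eq_bot]) (Ideal.prime_of_isPrime hQ0 hQ).irreducible
      (Ideal.prime_of_isPrime (RC_smul_ne_bot g hP0) hM).irreducible (RC_smul_ne_bot g hP0)
    rw [Ideal.map_span, Set.image_singleton, hβF, hN, hfin.emultiplicity_eq_multiplicity] at h1
    norm_cast at h1
    intro hdvd
    apply ha (ω g)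
    rw [← Nat.dvd_add_left (dvd_mul_right p N), h1]
    exact dvd_mul_of_dvd_right hdvd _
  · intro Q hQ hQq j
    obtain ⟨M, hM, hMQ⟩ := hover Q hQ
    obtain ⟨g, rfl⟩ := hconj M hM (by rw [← htower, hMQ, hQq])
    obtain ⟨x, hx⟩ := hres g (bj j)
    refine ⟨x, ?_⟩
    rw [← hMQ, Ideal.mem_comap, map_sub, hb, map_pow, map_natCast]
    exact Ideal.mem_of_dvd _ (sub_dvd_pow_sub_pow _ _ p) hx
end
end

section
section
open NumberField Polynomial

def RC_good {K E : Type*} [Field K] [NumberField K] [Field E] [NumberField E] [Algebra K E] (p : ℕ) (ζ : E) (n m : ℕ)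
    (q : Ideal (𝓞 K)) (β : 𝓞 E) : Prop :=
  q.IsPrime ∧ q ≠ ⊥ ∧ (m : 𝓞 K) ∉ q ∧
      p ^ n ∣ Nat.card (𝓞 K ⧸ q) - 1 ∧ β ≠ 0 ∧ (m : 𝓞 E) ∣ β - 1 ∧
      (∀ (σ : Gal(E/K)) (k : ℕ), σ ζ = ζ ^ k → ∃ γ : E, σ (β : E) = (β : E) ^ k * γ ^ p) ∧
      (∀ Q : Ideal (𝓞 E), Q.IsPrime → Q ≠ ⊥ → Q.comap (algebraMap (𝓞 K) (𝓞 E)) ≠ q →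
        ∃ c : E, c ≠ 0 ∧ ∃ u : 𝓞 E, u ∉ Q ∧ (β : E) * c ^ p = u) ∧
      (∀ Q : Ideal (𝓞 E), Q.IsPrime → Q.comap (algebraMap (𝓞 K) (𝓞 E)) = q →
        ∃ v : ℕ, ¬ p ∣ v ∧ emultiplicity Q (Ideal.span {β}) = (v : ℕ∞))

theorem RC_step {K : Type*} {E : Type} [Field K] [NumberField K] [Field E] [NumberField E]
    [Algebra K E] [IsGalois K E]
    (p : ℕ) [Fact p.Prime] (hodd : Odd p) (ζ : E) (hζ : IsPrimitiveRoot ζ p) {J : Type*} [Fintype J]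
    (βj : J → 𝓞 E) (n : ℕ) (hn : 1 ≤ n) (m : ℕ) (hm : m ≠ 0) :
    ∃ (q : Ideal (𝓞 K)) (β : 𝓞 E), RC_good p ζ n m q β ∧
      (∀ Q : Ideal (𝓞 E), Q.IsPrime → Q.comap (algebraMap (𝓞 K) (𝓞 E)) = q →
        ∀ j, ∃ x : ℕ, βj j - x ^ p ∈ Q) := by
  have hpp : p.Prime := Fact.out
  haveI : NeZero m := ⟨hm⟩
  obtain ⟨n, rfl⟩ : ∃ k, n = k + 1 := ⟨n - 1, by omega⟩
  let f : E[X] := cyclotomic (p ^ (n + 1)) E * ∏ j, (X ^ p - C (βj j : E))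
  have hprod : (∏ j, (X ^ p - C (βj j : E))) ≠ 0 :=
    Finset.prod_ne_zero_iff.2 fun j _ => X_pow_sub_C_ne_zero hpp.pos _
  have hf : f ≠ 0 := mul_ne_zero (cyclotomic_ne_zero _ _) hprod
  obtain ⟨F, _, _, _, _, _, _, hsp⟩ := RC_B0 (K := K) f hf
  have hf' : f.map (algebraMap E F) ≠ 0 := by rwa [Polynomial.map_ne_zero_iff (algebraMap E F).injective]
  have hroot : ∀ g : E[X], g ∣ f → g.degree ≠ 0 → ∃ x : F, (g.map (algebraMap E F)).eval x = 0 := by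
    intro g hg hdeg
    have h1 : (g.map (algebraMap E F)).Splits := hsp.of_dvd hf' (Polynomial.map_dvd _ hg)
    exact h1.exists_eval_eq_zero (by rwa [degree_map])
  have hN : p ^ (n + 1) ≠ 0 := pow_ne_zero _ hpp.ne_zero
  obtain ⟨ξ, hξ⟩ := hroot (cyclotomic (p ^ (n + 1)) E) (Dvd.intro _ rfl) (by
    rw [degree_cyclotomic]
    exact_mod_cast (Nat.totient_pos.2 (Nat.pos_of_ne_zero hN)).ne')
  haveI : NeZero ((p ^ (n + 1) : ℕ) : F) := ⟨Nat.cast_ne_zero.2 hN⟩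
  rw [map_cyclotomic] at hξ
  have hξ' : IsPrimitiveRoot ξ (p ^ (n + 1)) := isRoot_cyclotomic_iff.1 hξ
  have hb : ∀ j, ∃ b : F, b ^ p = algebraMap E F (βj j) := by
    intro j
    obtain ⟨b, hb⟩ := hroot (X ^ p - C (βj j : E)) (Dvd.dvd.mul_left (Finset.dvd_prod_of_mem _ (Finset.mem_univ j)) _) (by
      rw [degree_X_pow_sub_C hpp.pos]
      exact_mod_cast hpp.ne_zero)
    refine ⟨b, ?_⟩
    simpa [sub_eq_zero] using hb
  have hint : ∀ (b : F) (k : ℕ), 0 < k → IsIntegral ℤ (b ^ k) → IsIntegral ℤ b := fun b k hk h => IsIntegral.of_pow hk h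
  choose b hb using hb
  have hbint : ∀ j, IsIntegral ℤ (b j) := fun j => hint _ p hpp.pos (by
    rw [hb j]
    exact (βj j).2.map (algebraMap E F).toIntAlgHom)
  have hξint : IsIntegral ℤ ξ := hint _ _ (Nat.pos_of_ne_zero hN) (by rw [hξ'.pow_eq_one]; exact isIntegral_one)
  have hlift : ∀ x : F, IsIntegral ℤ x → ∃ y : 𝓞 F, algebraMap (𝓞 F) F y = x := fun x hx => ⟨⟨x, hx⟩, rfl⟩
  choose b' hb' using fun j => hlift (b j) (hbint j)
  obtain ⟨ξ', hξ0⟩ := hlift ξ hξint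
  obtain ⟨q, β, h1, h2, h3, h4, h5, h6, h7, h8, h9, h10⟩ := RC_step_F (K := K) (E := E) (F := F) p hodd ζ hζ βj b'
    (fun j => by
      apply IsFractionRing.injective (𝓞 F) F
      rw [map_pow, hb']
      exact (hb j).symm) n ξ' (by
      apply IsFractionRing.injective (𝓞 F) F
      rw [map_pow, map_one, hξ0]
      exact hξ'.pow_eq_one) (by
      intro h
      have := congrArg (algebraMap (𝓞 F) F) h
      rw [map_pow, map_one, hξ0] at this
      have h3 := hξ'.pow_ne_one_of_pos_of_lt (pow_ne_zero n hpp.ne_zero) (Nat.pow_lt_pow_right hpp.one_lt (Nat.lt_succ_self n))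
      exact h3 this) m
  exact ⟨q, β, ⟨h1, h2, h3, h4, h5, h6, h7, h8, h9⟩, h10⟩

theorem RC_good_mono {K E : Type*} [Field K] [NumberField K] [Field E] [NumberField E] [Algebra K E] {p : ℕ} {ζ : E} {n m m' : ℕ}
    {q : Ideal (𝓞 K)} {β : 𝓞 E} (hm : m ∣ m') (h : RC_good p ζ n m' q β) : RC_good p ζ n m q β := by
  obtain ⟨h1, h2, h3, h4, h5, h6, h7⟩ := h
  refine ⟨h1, h2, fun h => h3 ?_, h4, h5, (Nat.cast_dvd_cast hm).trans h6, h7⟩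
  exact Ideal.mem_of_dvd _ (Nat.cast_dvd_cast hm) h

theorem RC_family {K : Type*} {E : Type} [Field K] [NumberField K] [Field E] [NumberField E]
    [Algebra K E] [IsGalois K E]
    (p : ℕ) [Fact p.Prime] (hodd : Odd p) (ζ : E) (hζ : IsPrimitiveRoot ζ p)
    (m : ℕ) (hm : m ≠ 0) (d : ℕ) (e : Fin d → ℕ) (he : ∀ i, 1 ≤ e i) :
    ∃ (q : Fin d → Ideal (𝓞 K)) (β : Fin d → 𝓞 E), (∀ i, RC_good p ζ (e i) m (q i) (β i)) ∧
      (∀ i j, i ≠ j → ∀ Q : Ideal (𝓞 E), Q.IsPrime → Q.comap (algebraMap (𝓞 K) (𝓞 E)) = q i →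
        β j ∉ Q ∧ ∃ x : ℕ, β j - x ^ p ∈ Q) := by
  induction d with
  | zero => exact ⟨Fin.elim0, Fin.elim0, fun i => i.elim0, fun i => i.elim0⟩
  | succ d ih =>
    obtain ⟨q, β, hg, hc⟩ := ih (fun i => e i.castSucc) (fun i => he _)
    let m' := m * ((∏ i, Ideal.absNorm (q i)) * ∏ i, Ideal.absNorm (Ideal.span {β i}))
    have hm' : m' ≠ 0 := by
      refine mul_ne_zero hm (mul_ne_zero (Finset.prod_ne_zero_iff.2 fun i _ => ?_) (Finset.prod_ne_zero_iff.2 fun i _ => ?_))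
      · rw [Ne, Ideal.absNorm_eq_zero_iff]
        exact (hg i).2.1
      · rw [Ne, Ideal.absNorm_eq_zero_iff, Ideal.span_singleton_eq_bot]
        exact (hg i).2.2.2.2.1
    obtain ⟨q', β', hg', hc'⟩ := RC_step (K := K) p hodd ζ hζ β (e (Fin.last d)) (he _) m' hm'
    refine ⟨Fin.snoc q q', Fin.snoc β β', ?_, ?_⟩
    · intro i
      refine Fin.lastCases ?_ (fun i => ?_) i
      · simpa using RC_good_mono (Dvd.intro _ rfl) hg'
      · simpa using hg i
    · intro i
      refine Fin.lastCases ?_ (fun i => ?_) i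
      · intro j
        refine Fin.lastCases ?_ (fun j => ?_) j
        · exact fun h => absurd rfl h
        · intro _ Q hQ hQq
          simp only [Fin.snoc_last, Fin.snoc_castSucc] at hQq ⊢
          refine ⟨fun hmem => hg'.2.2.1 ?_, hc' Q hQ hQq j⟩
          rw [← hQq, Ideal.mem_comap, map_natCast]
          have h1 : ((Ideal.absNorm (Ideal.span {β j}) : ℕ) : 𝓞 E) ∈ Q :=
            (Ideal.span_singleton_le_iff_mem Q).2 hmem (Ideal.absNorm_mem _)
          refine Ideal.mem_of_dvd _ (Nat.cast_dvd_cast ?_) h1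
          exact Dvd.dvd.mul_left (Dvd.dvd.mul_left (Finset.dvd_prod_of_mem (fun i => Ideal.absNorm (Ideal.span {β i})) (Finset.mem_univ j)) _) _
      · intro j
        refine Fin.lastCases ?_ (fun j => ?_) j
        · intro _ Q hQ hQq
          simp only [Fin.snoc_last, Fin.snoc_castSucc] at hQq ⊢
          have hmem : β' - 1 ∈ Q := by
            have h1 : ((Ideal.absNorm (q i) : ℕ) : 𝓞 E) ∈ Q := by
              have : ((Ideal.absNorm (q i) : ℕ) : 𝓞 K) ∈ Q.comap (algebraMap (𝓞 K) (𝓞 E)) := by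
                rw [hQq]; exact Ideal.absNorm_mem _
              rwa [Ideal.mem_comap, map_natCast] at this
            refine Ideal.mem_of_dvd _ (dvd_trans (Nat.cast_dvd_cast ?_) hg'.2.2.2.2.2.1) h1
            exact Dvd.dvd.mul_left (Dvd.dvd.mul_right (Finset.dvd_prod_of_mem (fun i => Ideal.absNorm (q i)) (Finset.mem_univ i)) _) _
          refine ⟨fun h => hQ.ne_top ((Ideal.eq_top_iff_one _).2 ?_), 1, by simpa using hmem⟩
          have := Q.sub_mem h hmem
          rwa [sub_sub_cancel] at this
        · intro hij Q hQ hQq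
          simp only [Fin.snoc_castSucc] at hQq ⊢
          exact hc i j (fun h => hij (by rw [h])) Q hQ hQq
end
end

section
section
open NumberField Pointwise

variable {K M : Type*} [Field K] [NumberField K] [Field M] [NumberField M] [Algebra K M] [IsGalois K M]

theorem RC_perfect {P : Ideal (𝓞 K)} (hP : P.IsPrime) (h0 : P ≠ ⊥) : PerfectField P.ResidueField := by
  haveI : P.IsMaximal := hP.isMaximal h0
  haveI : Finite (𝓞 K ⧸ P) := Ideal.finiteQuotientOfFreeOfNeBot P h0
  haveI : Finite P.ResidueField := Finite.of_surjective _ (Ideal.bijective_algebraMap_quotient_residueField P).2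
  infer_instance

theorem RC_card_inertia {P : Ideal (𝓞 K)} (hP : P.IsPrime) (h0 : P ≠ ⊥) (Q : Ideal (𝓞 M)) (hQ : Q.IsPrime)
    (hQP : Q.comap (algebraMap (𝓞 K) (𝓞 M)) = P) :
    Nat.card (Q.inertia Gal(M/K)) = Ideal.ramificationIdx' P Q := by
  haveI : Q.LiesOver P := ⟨hQP.symm⟩
  haveI := RC_perfect hP h0
  rw [Ideal.card_inertia_eq_ramificationIdxIn (G := Gal(M/K)) P Q, Ideal.ramificationIdxIn_eq_ramificationIdx P Q Gal(M/K),
    Ideal.ramificationIdx'_eq_ramificationIdx P Q h0]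

theorem RC_over_ne_bot {K M : Type*} [Field K] [NumberField K] [Field M] [NumberField M] [Algebra K M]
    {P : Ideal (𝓞 K)} (h0 : P ≠ ⊥) {Q : Ideal (𝓞 M)}
    (hQP : Q.comap (algebraMap (𝓞 K) (𝓞 M)) = P) : Q ≠ ⊥ := by
  rintro rfl
  apply h0
  rw [← hQP, ← RingHom.ker_eq_comap_bot, (RingHom.injective_iff_ker_eq_bot _).1 (FaithfulSMul.algebraMap_injective (𝓞 K) (𝓞 M))]

theorem RC_card_stab {P : Ideal (𝓞 K)} (hP : P.IsPrime) (h0 : P ≠ ⊥) (Q : Ideal (𝓞 M)) (hQ : Q.IsPrime)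
    (hQP : Q.comap (algebraMap (𝓞 K) (𝓞 M)) = P) :
    Nat.card (MulAction.stabilizer Gal(M/K) Q) = Ideal.ramificationIdx' P Q * Ideal.inertiaDeg' P Q := by
  haveI : Q.LiesOver P := ⟨hQP.symm⟩
  haveI := RC_perfect hP h0
  haveI : P.IsMaximal := hP.isMaximal h0
  haveI : Q.IsMaximal := hQ.isMaximal (RC_over_ne_bot h0 hQP)
  rw [Ideal.card_stabilizer_eq (G := Gal(M/K)) P Q, Ideal.ramificationIdxIn_eq_ramificationIdx P Q Gal(M/K),
    Ideal.ramificationIdx'_eq_ramificationIdx P Q h0, Ideal.inertiaDegIn_eq_inertiaDeg P Q Gal(M/K), Ideal.inertiaDeg'_eq_inertiaDeg P Q]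

theorem RC_ef_dvd {P : Ideal (𝓞 K)} (hP : P.IsPrime) (h0 : P ≠ ⊥) (Q : Ideal (𝓞 M)) (hQ : Q.IsPrime)
    (hQP : Q.comap (algebraMap (𝓞 K) (𝓞 M)) = P) :
    Ideal.ramificationIdx' P Q * Ideal.inertiaDeg' P Q ∣ Nat.card Gal(M/K) := by
  rw [← RC_card_stab hP h0 Q hQ hQP]
  exact Subgroup.card_subgroup_dvd_card _

theorem RC_exists_over {K M : Type*} [Field K] [NumberField K] [Field M] [NumberField M] [Algebra K M]
    (Q : Ideal (𝓞 K)) (hQ : Q.IsPrime) :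
    ∃ R : Ideal (𝓞 M), R.IsPrime ∧ R.comap (algebraMap (𝓞 K) (𝓞 M)) = Q := by
  obtain ⟨R, -, h1, h2⟩ := Ideal.exists_ideal_over_prime_of_isIntegral (S := 𝓞 M) Q ⊥ (by
    rw [← RingHom.ker_eq_comap_bot, (RingHom.injective_iff_ker_eq_bot _).1 (FaithfulSMul.algebraMap_injective (𝓞 K) (𝓞 M))]
    exact bot_le)
  exact ⟨R, h1, h2⟩

theorem RC_tower_e {K L M : Type*} [Field K] [NumberField K] [Field M] [NumberField M] [Algebra K M]
    [Field L] [NumberField L] [Algebra K L] [Algebra L M] [IsScalarTower K L M]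
    {P : Ideal (𝓞 K)} {Q : Ideal (𝓞 L)} {R : Ideal (𝓞 M)} (hR : R.IsPrime) 
    (hRQ : R.comap (algebraMap (𝓞 L) (𝓞 M)) = Q) (hQP : Q.comap (algebraMap (𝓞 K) (𝓞 L)) = P) :
    Ideal.ramificationIdx' P R = Ideal.ramificationIdx' P Q * Ideal.ramificationIdx' Q R := by
  haveI : R.LiesOver Q := ⟨hRQ.symm⟩
  haveI : Q.LiesOver P := ⟨hQP.symm⟩
  exact Ideal.ramificationIdx'_algebra_tower' P Q R

theorem RC_tower_f {K L M : Type*} [Field K] [NumberField K] [Field M] [NumberField M] [Algebra K M]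
    [Field L] [NumberField L] [Algebra K L] [Algebra L M] [IsScalarTower K L M]
    {P : Ideal (𝓞 K)} {Q : Ideal (𝓞 L)} {R : Ideal (𝓞 M)} (hR : R.IsPrime) (h0 : P ≠ ⊥)
    (hRQ : R.comap (algebraMap (𝓞 L) (𝓞 M)) = Q) (hQP : Q.comap (algebraMap (𝓞 K) (𝓞 L)) = P) :
    Ideal.inertiaDeg' P R = Ideal.inertiaDeg' P Q * Ideal.inertiaDeg' Q R := by
  haveI : R.LiesOver Q := ⟨hRQ.symm⟩
  haveI : Q.LiesOver P := ⟨hQP.symm⟩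
  have hQ : Q.IsPrime := by rw [← hRQ]; exact Ideal.IsPrime.comap _
  have hP : P.IsPrime := by rw [← hQP]; exact Ideal.IsPrime.comap _
  haveI : P.IsMaximal := hP.isMaximal h0
  haveI : Q.IsMaximal := hQ.isMaximal (RC_over_ne_bot h0 hQP)
  exact Ideal.inertiaDeg'_algebra_tower P Q R

end
end

section
section
open NumberField Pointwise

theorem RC_Psi {K E M : Type*} [Field K] [NumberField K] [Field E] [NumberField E] [Field M] [NumberField M]
    [Algebra K M] [Algebra K E] [Algebra E M] [IsScalarTower K E M] [IsGalois K M] [IsGalois K E]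
    (p : ℕ) [Fact p.Prime] (ζ : E) (hζ : IsPrimitiveRoot ζ p)
    (hE : ∀ σ : Gal(E/K), σ ζ = ζ → σ = 1) (d : ℕ) (β : Fin d → 𝓞 E) (hβ0 : ∀ i, β i ≠ 0)
    (hγ : ∀ i (σ : Gal(E/K)) (k : ℕ), σ ζ = ζ ^ k → ∃ γ : E, σ (β i : E) = (β i : E) ^ k * γ ^ p)
    (b : Fin d → 𝓞 M) (hb : ∀ i, b i ^ p = algebraMap (𝓞 E) (𝓞 M) (β i))
    (hgen : ∀ g : Gal(M/K), g (algebraMap E M ζ) = algebraMap E M ζ → (∀ i, g (b i : M) = (b i : M)) → g = 1) :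
    (∀ g : Gal(M/K), g (algebraMap E M ζ) = algebraMap E M ζ → ∀ x : E, g (algebraMap E M x) = algebraMap E M x) ∧
    (∀ g h : Gal(M/K), g * h = h * g) ∧
    ∃ Ψ : Gal(M/K) →* Multiplicative (Fin d → ZMod p),
      (∀ g : Gal(M/K), (g ^ (p - 1)) (algebraMap E M ζ) = algebraMap E M ζ) ∧
      (∀ (g : Gal(M/K)) i, (g ^ (p - 1)) (b i : M) = (algebraMap E M ζ) ^ ((Ψ g).toAdd i).val * (b i : M)) ∧
      (∀ g : Gal(M/K), Ψ g = 1 → g ^ (p - 1) = 1) := by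
  have hpp : p.Prime := Fact.out
  haveI : NeZero p := ⟨hpp.ne_zero⟩
  let z : M := algebraMap E M ζ
  have hz : IsPrimitiveRoot z p := hζ.map_of_injective (algebraMap E M).injective
  have hcomm : ∀ (ρ : Gal(M/K)) (x : E), algebraMap E M (AlgEquiv.restrictNormalHom E ρ x) = ρ (algebraMap E M x) :=
    fun ρ x => AlgEquiv.restrictNormal_commutes ρ E x
  have hb' : ∀ i, (b i : M) ^ p = algebraMap E M (β i : E) := by
    intro i
    have := congrArg (algebraMap (𝓞 M) M) (hb i)
    rw [map_pow] at this
    exact this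
  have hbne : ∀ i, (b i : M) ≠ 0 := by
    intro i h
    have h1 := hb' i
    rw [h, zero_pow hpp.ne_zero, eq_comm, map_eq_zero] at h1
    exact hβ0 i (by simpa using h1)
  have hfixE : ∀ g : Gal(M/K), g z = z → ∀ x : E, g (algebraMap E M x) = algebraMap E M x := by
    intro g hg x
    rw [← hcomm, hE (AlgEquiv.restrictNormalHom E g) ((algebraMap E M).injective (by rw [hcomm]; exact hg))]
    rfl
  -- action of elements fixing z
  have hA : ∀ g : Gal(M/K), g z = z → ∀ i, ∃ k : ℕ, k < p ∧ g (b i : M) = z ^ k * (b i : M) := by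
    intro g hg i
    have h1 : (g (b i : M) / (b i : M)) ^ p = 1 := by
      rw [div_pow, ← map_pow, hb', hfixE g hg, div_self]
      rw [← hb']
      exact pow_ne_zero _ (hbne i)
    obtain ⟨k, hk, hk'⟩ := hz.eq_pow_of_pow_eq_one h1
    exact ⟨k, hk, by rw [hk', div_mul_cancel₀ _ (hbne i)]⟩
  have hgz : ∀ g : Gal(M/K), ∃ k : ℕ, g z = z ^ k := fun g => ⟨_, (hz.autToPow_spec K g).symm⟩
  -- action of general elements
  have hG : ∀ (g : Gal(M/K)) (k : ℕ), g z = z ^ k → ∀ i, ∃ (s : ℕ) (γ : E), g (b i : M) = z ^ s * (b i : M) ^ k * algebraMap E M γ := by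
    intro g k hk i
    obtain ⟨γ, hγ'⟩ := hγ i (AlgEquiv.restrictNormalHom E g) k ((algebraMap E M).injective (by rw [hcomm, map_pow]; exact hk))
    have h2 := congrArg (algebraMap E M) hγ'
    rw [hcomm, map_mul, map_pow, map_pow, ← hb', map_pow] at h2
    have hne : (b i : M) ^ k * algebraMap E M γ ≠ 0 := by
      intro h0
      have h3 : ((b i : M) ^ p) ^ k * (algebraMap E M γ) ^ p = 0 := by
        rw [← pow_mul, mul_comm p k, pow_mul, ← mul_pow, h0, zero_pow hpp.ne_zero]
      rw [h3] at h2
      rw [pow_eq_zero_iff hpp.ne_zero, map_eq_zero] at h2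
      exact hbne i h2
    have h1 : (g (b i : M) / ((b i : M) ^ k * algebraMap E M γ)) ^ p = 1 := by
      rw [div_pow, h2, mul_pow, ← pow_mul, ← pow_mul, mul_comm p k, div_self]
      rw [pow_mul, ← mul_pow]
      exact pow_ne_zero _ hne
    obtain ⟨s, hs, hs'⟩ := hz.eq_pow_of_pow_eq_one h1
    exact ⟨s, γ, by rw [mul_assoc, hs', div_mul_cancel₀ _ hne]⟩
  have hcen : ∀ a : Gal(M/K), a z = z → ∀ g, g * a = a * g := by
    intro a ha g
    have hext : ∀ u v : Gal(M/K), u z = v z → (∀ i, u (b i : M) = v (b i : M)) → u = v := by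
      intro u v h1 h2
      have := hgen (v⁻¹ * u) (by
        show v⁻¹ (u z) = z
        rw [h1]; exact v.symm_apply_apply z) (fun i => by
        show v⁻¹ (u _) = _
        rw [h2]; exact v.symm_apply_apply _)
      rw [inv_mul_eq_one] at this
      exact this.symm
    obtain ⟨k, hk⟩ := hgz g
    refine hext _ _ ?_ ?_
    · show g (a z) = a (g z)
      rw [ha, hk, map_pow, ha]
    · intro i
      show g (a _) = a (g _)
      obtain ⟨t, -, ht⟩ := hA a ha i
      obtain ⟨s, γ, hs⟩ := hG g k hk i
      rw [ht, map_mul, map_pow, hk, hs, map_mul, map_mul, map_pow, map_pow, ha, ht, hfixE a ha]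
      rw [mul_pow, ← pow_mul, ← pow_mul, mul_comm k t]
      ring
  have hcm : ∀ g h : Gal(M/K), g * h = h * g := by
    refine commutative_of_cyclic_center_quotient (hz.autToPow K) ?_
    intro a ha
    rw [Subgroup.mem_center_iff]
    refine hcen a ?_
    rw [MonoidHom.mem_ker] at ha
    have h1 := hz.autToPow_spec K a
    haveI : Fact (1 < p) := ⟨hpp.one_lt⟩
    rw [ha, Units.val_one, ZMod.val_one, pow_one] at h1
    exact h1.symm
  refine ⟨hfixE, hcm, ?_⟩
  have hp1 : ∀ g : Gal(M/K), (g ^ (p - 1)) z = z := by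
    intro g
    have h1 := hz.autToPow_spec K (g ^ (p - 1))
    haveI : Fact (1 < p) := ⟨hpp.one_lt⟩
    rw [map_pow, ZMod.units_pow_card_sub_one_eq_one, Units.val_one, ZMod.val_one, pow_one] at h1
    exact h1.symm
  choose k hk hkb using fun g : Gal(M/K) => hA (g ^ (p - 1)) (hp1 g)
  have huniq : ∀ (g : Gal(M/K)) i (t : ℕ), (g ^ (p - 1)) (b i : M) = z ^ t * (b i : M) → ((k g i : ℕ) : ZMod p) = t := by
    intro g i t ht
    rw [hkb] at ht
    exact RC_primroot_pow hz hpp.ne_zero (mul_right_cancel₀ (hbne i) ht)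
  let Ψ : Gal(M/K) →* Multiplicative (Fin d → ZMod p) := MonoidHom.mk' (fun g => Multiplicative.ofAdd (fun i => ((k g i : ℕ) : ZMod p))) (by
    intro g h
    rw [← ofAdd_add]
    congr 1
    funext i
    rw [Pi.add_apply, ← Nat.cast_add]
    apply huniq
    rw [(show Commute g h from hcm g h).mul_pow]
    show (g ^ (p - 1)) ((h ^ (p - 1)) _) = _
    rw [hkb, map_mul, map_pow, hp1, hkb]
    ring)
  have hΨ : ∀ g i, (Ψ g).toAdd i = ((k g i : ℕ) : ZMod p) := fun g i => rfl
  have hval : ∀ g i, ((Ψ g).toAdd i).val = k g i := fun g i => by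
    rw [hΨ, ZMod.val_natCast, Nat.mod_eq_of_lt (hk g i)]
  refine ⟨Ψ, hp1, ?_, ?_⟩
  · intro g i
    rw [hval, hkb]
  · intro g hg
    refine hgen _ (hp1 g) fun i => ?_
    rw [hkb, ← hval, hg]
    simp
end
end

section
section
open NumberField Pointwise Polynomial

variable {K M : Type*} [Field K] [NumberField K] [Field M] [NumberField M] [Algebra K M]

theorem RC_zk_dvd (p : ℕ) [Fact p.Prime] (z : 𝓞 M) (hz : IsPrimitiveRoot z p) (k : ℕ) (hk : k < p) (hk0 : k ≠ 0) :
    (z ^ k - 1) ^ (p - 1) ∣ (p : 𝓞 M) := by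
  have hpp : p.Prime := Fact.out
  have h1 : IsPrimitiveRoot (z ^ k) p := hz.pow_of_coprime k (by
    rw [Nat.coprime_comm]
    exact (Nat.Prime.coprime_iff_not_dvd hpp).2 (fun h => by
      have := Nat.le_of_dvd (Nat.pos_of_ne_zero hk0) h
      omega))
  obtain ⟨n, rfl⟩ : ∃ n, p = n + 1 := ⟨p - 1, by have := hpp.pos; omega⟩
  have := h1.prod_one_sub_pow_eq_order
  rw [Nat.add_sub_cancel]
  have h2 : ((n + 1 : ℕ) : 𝓞 M) = n + 1 := by push_cast; rfl
  rw [h2, ← this]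
  rw [← Finset.card_range n, ← Finset.prod_const, Finset.card_range]
  refine Finset.prod_dvd_prod_of_dvd _ _ fun i _ => ?_
  have h3 := sub_dvd_pow_sub_pow (z ^ k) 1 (i + 1)
  rw [one_pow] at h3
  rw [dvd_sub_comm]
  exact h3

theorem RC_zk_notMem (p : ℕ) [Fact p.Prime] (z : 𝓞 M) (hz : IsPrimitiveRoot z p) (k : ℕ) (hk : k < p)
    (R : Ideal (𝓞 M)) (hpR : (p : 𝓞 M) ∉ R) (h : z ^ k - 1 ∈ R) : k = 0 := by
  have hpp : p.Prime := Fact.out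
  by_contra hk0
  refine hpR (Ideal.mem_of_dvd _ (RC_zk_dvd p z hz k hk hk0) (Ideal.pow_mem_of_mem _ h _ ?_))
  have := hpp.two_le
  omega

theorem RC_L2 (p : ℕ) [Fact p.Prime] (z : 𝓞 M) (hz : IsPrimitiveRoot z p) (k : ℕ) (hk : k < p)
    (R : Ideal (𝓞 M)) (hR : R.IsPrime) (hpR : (p : 𝓞 M) ∉ R) (a : Gal(M/K)) (ha : a • z = z) (haR : a • R = R)
    (b : 𝓞 M) (hb : a • b = z ^ k * b) (hbR : b ∉ R) (x : ℕ) (hx : b ^ p - (x : 𝓞 M) ^ p ∈ R) : k = 0 := by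
  have hpp : p.Prime := Fact.out
  rw [hz.pow_sub_pow_eq_prod_sub_mul _ _ hpp.pos, hR.prod_mem_iff] at hx
  obtain ⟨ξ, hξ, hx⟩ := hx
  haveI : NeZero p := ⟨hpp.ne_zero⟩
  rw [mem_nthRootsFinset hpp.pos] at hξ
  obtain ⟨t, -, rfl⟩ := hz.eq_pow_of_pow_eq_one hξ
  have h1 : a • (b - z ^ t * x) ∈ a • R := Ideal.smul_mem_pointwise_smul_iff.2 hx
  have hn : a • (x : 𝓞 M) = x := map_natCast (MulSemiringAction.toRingHom Gal(M/K) (𝓞 M) a) x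
  rw [haR, smul_sub, smul_mul', smul_pow', ha, hb, hn] at h1
  have h2 := R.sub_mem h1 hx
  have h3 : (z ^ k - 1) * b ∈ R := by
    convert h2 using 1; ring
  exact RC_zk_notMem p z hz k hk R hpR ((hR.mem_or_mem h3).resolve_right hbR)

theorem RC_L1 (p : ℕ) [Fact p.Prime] (z : 𝓞 M) (hz : IsPrimitiveRoot z p) (k : ℕ) (hk : k < p)
    (R : Ideal (𝓞 M)) (hR : R.IsPrime) (hpR : (p : 𝓞 M) ∉ R) (a : Gal(M/K)) (haR : a ∈ R.inertia Gal(M/K))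
    (y : 𝓞 M) (hy : a • y = z ^ k * y) (hyR : y ∉ R) : k = 0 := by
  have h1 : a • y - y ∈ R := haR y
  rw [hy] at h1
  have h3 : (z ^ k - 1) * y ∈ R := by
    convert h1 using 1; ring
  exact RC_zk_notMem p z hz k hk R hpR ((hR.mem_or_mem h3).resolve_right hyR)

theorem RC_L3 (p : ℕ) [Fact p.Prime] (hodd : Odd p) (z : 𝓞 M) (hz : IsPrimitiveRoot z p) (k : ℕ) (hk : k < p)
    (R : Ideal (𝓞 M)) (hR : R.IsPrime) (hpR : (p : 𝓞 M) ∈ R) (a : Gal(M/K)) (ha : a • z = z) (haR : a • R = R)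
    (b : 𝓞 M) (hb : a • b = z ^ k * b) (hx : (p : 𝓞 M) ^ p ∣ b ^ p - 1) : k = 0 := by
  classical
  have hpp : p.Prime := Fact.out
  have hp0 : (p : 𝓞 M) ≠ 0 := Nat.cast_ne_zero.2 hpp.ne_zero
  have hR0 : R ≠ ⊥ := by
    rintro rfl
    exact hp0 (by simpa using hpR)
  have hpr : Prime R := Ideal.prime_of_isPrime hR0 hR
  have hs0 : (Ideal.span {(p : 𝓞 M)}) ≠ 0 := by simpa [Ideal.span_singleton_eq_bot] using hpp.ne_zero
  have hfin : FiniteMultiplicity R (Ideal.span {(p : 𝓞 M)}) := FiniteMultiplicity.of_prime_left hpr hs0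
  have hv := hfin.emultiplicity_eq_multiplicity
  set v := multiplicity R (Ideal.span {(p : 𝓞 M)})
  have hmem : ∀ (x : 𝓞 M) (n : ℕ), x ∈ R ^ n ↔ (n : ℕ∞) ≤ emultiplicity R (Ideal.span {x}) := by
    intro x n
    rw [← pow_dvd_iff_le_emultiplicity, Ideal.dvd_span_singleton]
  have hv1 : 1 ≤ v := by
    have := (hmem p 1).1 (by simpa using hpR)
    rw [hv] at this
    exact_mod_cast this
  have hbR : b ∉ R := by
    intro h
    apply hR.one_notMem
    have h1 : b ^ p - 1 ∈ R := Ideal.mem_of_dvd _ hx (Ideal.pow_mem_of_mem _ hpR _ hpp.pos)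
    have h2 := R.sub_mem (Ideal.pow_mem_of_mem _ h p hpp.pos) h1
    simpa using h2
  have hprod : b ^ p - 1 ∈ R ^ (v * p) := by
    refine Ideal.mem_of_dvd _ hx ?_
    rw [pow_mul]
    exact Ideal.pow_mem_pow ((hmem _ _).2 (by rw [hv])) _
  have h1 : b ^ p - 1 = ∏ ξ ∈ nthRootsFinset p (1 : 𝓞 M), (b - ξ * 1) := by
    rw [← hz.pow_sub_pow_eq_prod_sub_mul _ _ hpp.pos, one_pow]
  have hex : ∃ ξ ∈ nthRootsFinset p (1 : 𝓞 M), b - ξ * 1 ∈ R ^ v := by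
    by_contra hcon
    push Not at hcon
    have hlt : ∀ ξ ∈ nthRootsFinset p (1 : 𝓞 M), emultiplicity R (Ideal.span {b - ξ * 1}) ≤ ((v - 1 : ℕ) : ℕ∞) := by
      intro ξ hξ
      have h2 := hcon ξ hξ
      rw [hmem, not_le] at h2
      rw [← ENat.lt_add_one_iff (ENat.coe_ne_top _)]
      have h3 : (((v - 1 : ℕ) : ℕ∞) + 1) = v := by
        norm_cast; omega
      rwa [h3]
    have h4 := (hmem _ _).1 hprod
    rw [h1, ← Ideal.prod_span_singleton, Finset.emultiplicity_prod hpr] at h4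
    have h5 := h4.trans (Finset.sum_le_sum hlt)
    rw [Finset.sum_const, hz.card_nthRootsFinset, nsmul_eq_mul] at h5
    have h6 : v * p ≤ p * (v - 1) := by exact_mod_cast h5
    rw [mul_comm v p] at h6
    have := Nat.le_of_mul_le_mul_left h6 hpp.pos
    omega
  obtain ⟨ξ, hξ, hx'⟩ := hex
  haveI : NeZero p := ⟨hpp.ne_zero⟩
  rw [mem_nthRootsFinset hpp.pos] at hξ
  obtain ⟨t, -, rfl⟩ := hz.eq_pow_of_pow_eq_one hξ
  have h2 : a • (b - z ^ t * 1) ∈ a • (R ^ v) := Ideal.smul_mem_pointwise_smul_iff.2 hx'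
  rw [RC_smul_pow, haR, smul_sub, smul_mul', smul_pow', ha, hb, smul_one] at h2
  have h3 : b * (z ^ k - 1) ∈ R ^ v := by
    convert (R ^ v).sub_mem h2 hx' using 1; ring
  have h4 : z ^ k - 1 ∈ R ^ v := (Ideal.IsPrime.mul_mem_pow R h3).resolve_left hbR
  by_contra hk0
  have h5 : (p : 𝓞 M) ∈ R ^ (v * (p - 1)) := by
    refine Ideal.mem_of_dvd _ (RC_zk_dvd p z hz k hk hk0) ?_
    rw [pow_mul]
    exact Ideal.pow_mem_pow h4 _
  rw [hmem, hv] at h5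
  have h6 : v * (p - 1) ≤ v := by exact_mod_cast h5
  have h7 : 2 ≤ p - 1 := by
    rcases hodd with ⟨r, hr⟩
    have := hpp.two_le
    omega
  nlinarith
end
end

section
section
open NumberField Pointwise

theorem RC_loc {K E M : Type*} [Field K] [NumberField K] [Field E] [NumberField E] [Field M] [NumberField M]
    [Algebra K M] [Algebra K E] [Algebra E M] [IsScalarTower K E M] [IsGalois K M] [IsGalois K E]
    (p : ℕ) [Fact p.Prime] (hodd : Odd p) (ζ : E) (hζ : IsPrimitiveRoot ζ p) (d : ℕ) (e : Fin d → ℕ)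
    (q : Fin d → Ideal (𝓞 K)) (β : Fin d → 𝓞 E) (hgood : ∀ i, RC_good p ζ (e i) (p ^ p) (q i) (β i))
    (hcross : ∀ i j, i ≠ j → ∀ Q : Ideal (𝓞 E), Q.IsPrime → Q.comap (algebraMap (𝓞 K) (𝓞 E)) = q i →
      β j ∉ Q ∧ ∃ x : ℕ, β j - x ^ p ∈ Q)
    (b : Fin d → 𝓞 M) (hb : ∀ i, b i ^ p = algebraMap (𝓞 E) (𝓞 M) (β i))
    (hfixE : ∀ g : Gal(M/K), g (algebraMap E M ζ) = algebraMap E M ζ → ∀ x : E, g (algebraMap E M x) = algebraMap E M x)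
    (Ψ : Gal(M/K) →* Multiplicative (Fin d → ZMod p))
    (h1 : ∀ g : Gal(M/K), (g ^ (p - 1)) (algebraMap E M ζ) = algebraMap E M ζ)
    (h2 : ∀ (g : Gal(M/K)) i, (g ^ (p - 1)) (b i : M) = (algebraMap E M ζ) ^ ((Ψ g).toAdd i).val * (b i : M)) :
    (∀ P : Ideal (𝓞 K), P.IsPrime → P ≠ ⊥ → (∀ i, P ≠ q i) → ∀ R : Ideal (𝓞 M), R.IsPrime →
      R.comap (algebraMap (𝓞 K) (𝓞 M)) = P → ∀ g ∈ R.inertia Gal(M/K), Ψ g = 1) ∧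
    (∀ i, ∀ R : Ideal (𝓞 M), R.IsPrime → R.comap (algebraMap (𝓞 K) (𝓞 M)) = q i → 
      ∀ g ∈ MulAction.stabilizer Gal(M/K) R, ∀ j, j ≠ i → (Ψ g).toAdd j = 0) ∧
    (∀ i, ∀ R : Ideal (𝓞 M), R.IsPrime → R.comap (algebraMap (𝓞 K) (𝓞 M)) = q i → 
      p ∣ Nat.card (R.inertia Gal(M/K))) := by
  have hpp : p.Prime := Fact.out
  haveI : NeZero p := ⟨hpp.ne_zero⟩
  have hinj : Function.Injective (algebraMap (𝓞 M) M) := IsFractionRing.injective (𝓞 M) M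
  have hlift : ∀ x : M, IsIntegral ℤ x → ∃ y : 𝓞 M, algebraMap (𝓞 M) M y = x := fun x hx => ⟨⟨x, hx⟩, rfl⟩
  have hzM : IsPrimitiveRoot (algebraMap E M ζ) p := hζ.map_of_injective (algebraMap E M).injective
  obtain ⟨z, hz0⟩ := hlift (algebraMap E M ζ) (IsIntegral.of_pow hpp.pos (by rw [hzM.pow_eq_one]; exact isIntegral_one))
  have hz : IsPrimitiveRoot z p := by
    rw [← hz0] at hzM
    exact hzM.of_map_of_injective hinj
  have hsm : ∀ (g : Gal(M/K)) (x : 𝓞 M), algebraMap (𝓞 M) M (g • x) = g (algebraMap (𝓞 M) M x) := fun g x => rfl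
  have haz : ∀ g : Gal(M/K), (g ^ (p - 1)) • z = z := by
    intro g
    apply hinj
    rw [hsm, hz0, h1]
  have hab : ∀ (g : Gal(M/K)) i, (g ^ (p - 1)) • b i = z ^ ((Ψ g).toAdd i).val * b i := by
    intro g i
    apply hinj
    rw [hsm, map_mul, map_pow, hz0]
    exact h2 g i
  have hval : ∀ (g : Gal(M/K)) i, ((Ψ g).toAdd i).val = 0 → (Ψ g).toAdd i = 0 := fun g i h => (ZMod.val_eq_zero _).1 h
  have htow : ∀ R : Ideal (𝓞 M), (R.comap (algebraMap (𝓞 E) (𝓞 M))).comap (algebraMap (𝓞 K) (𝓞 E)) =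
      R.comap (algebraMap (𝓞 K) (𝓞 M)) := by
    intro R
    rw [Ideal.comap_comap, ← IsScalarTower.algebraMap_eq]
  have hpq : ∀ i (R : Ideal (𝓞 M)), R.IsPrime → R.comap (algebraMap (𝓞 K) (𝓞 M)) = q i → (p : 𝓞 M) ∉ R := by
    intro i R hR hRq hpR
    refine (hgood i).2.2.1 ?_
    rw [← hRq, Ideal.mem_comap, map_natCast, Nat.cast_pow]
    exact Ideal.pow_mem_of_mem _ hpR _ hpp.pos
  refine ⟨?_, ?_, ?_⟩
  · intro P hP hP0 hPq R hR hRP g hg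
    apply Multiplicative.toAdd.injective
    funext i
    refine hval g i ?_
    have hg' : g ^ (p - 1) ∈ R.inertia Gal(M/K) := Subgroup.pow_mem _ hg _
    obtain ⟨-, -, -, -, hβ0, hm, -, hc, -⟩ := hgood i
    by_cases hpR : (p : 𝓞 M) ∈ R
    · refine RC_L3 p hodd z hz _ (ZMod.val_lt _) R hR hpR (g ^ (p - 1)) (haz g) (Ideal.inertia_le_stabilizer R hg') (b i) (hab g i) ?_
      have := map_dvd (algebraMap (𝓞 E) (𝓞 M)) hm
      rw [map_natCast, map_sub, map_one, ← hb, Nat.cast_pow] at this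
      exact this
    · have hQ : (R.comap (algebraMap (𝓞 E) (𝓞 M))).IsPrime := Ideal.IsPrime.comap _
      obtain ⟨c, hc0, u, hu, hcu⟩ := hc (R.comap (algebraMap (𝓞 E) (𝓞 M))) hQ 
        (RC_over_ne_bot (K := K) hP0 ((htow R).trans hRP)) (by rw [htow, hRP]; exact hPq i)
      have hyp : (((b i : 𝓞 M) : M) * algebraMap E M c) ^ p = algebraMap (𝓞 M) M (algebraMap (𝓞 E) (𝓞 M) u) := by
        have e1 : algebraMap (𝓞 M) M (algebraMap (𝓞 E) (𝓞 M) u) = algebraMap E M (u : E) := rfl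
        have e2 : (((b i : 𝓞 M) : M)) ^ p = algebraMap E M (β i : E) := by
          have := congrArg (algebraMap (𝓞 M) M) (hb i)
          rw [map_pow] at this
          exact this
        rw [e1, mul_pow, e2, ← map_pow, ← map_mul, hcu]
      obtain ⟨y, hy⟩ := hlift _ (IsIntegral.of_pow hpp.pos (by rw [hyp]; exact RingOfIntegers.isIntegral_coe _))
      refine RC_L1 p z hz _ (ZMod.val_lt _) R hR hpR (g ^ (p - 1)) hg' y ?_ ?_
      · apply hinj
        rw [hsm, map_mul, map_pow, hz0, hy, map_mul, hfixE _ (h1 g) c]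
        rw [h2, mul_assoc]
      · intro hyR
        apply hu
        rw [Ideal.mem_comap]
        have : y ^ p = algebraMap (𝓞 E) (𝓞 M) u := by
          apply hinj
          rw [map_pow, hy, hyp]
        rw [← this]
        exact Ideal.pow_mem_of_mem _ hyR _ hpp.pos
  · intro i R hR hRq g hg j hj
    refine hval g j ?_
    have hQ : (R.comap (algebraMap (𝓞 E) (𝓞 M))).IsPrime := Ideal.IsPrime.comap _
    obtain ⟨h3, x, h4⟩ := hcross i j hj.symm _ hQ ((htow R).trans hRq)
    refine RC_L2 p z hz _ (ZMod.val_lt _) R hR (hpq i R hR hRq) (g ^ (p - 1)) (haz g) (Subgroup.pow_mem _ hg (p - 1)) (b j) (hab g j) ?_ x ?_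
    · intro h
      apply h3
      rw [Ideal.mem_comap, ← hb]
      exact Ideal.pow_mem_of_mem _ h _ hpp.pos
    · rw [Ideal.mem_comap, map_sub, ← hb, map_pow, map_natCast] at h4
      exact h4
  · intro i R hR hRq
    obtain ⟨hq, hq0, -, -, hβ0, hm, -, -, hd⟩ := hgood i
    have hQ : (R.comap (algebraMap (𝓞 E) (𝓞 M))).IsPrime := Ideal.IsPrime.comap _
    set Q := R.comap (algebraMap (𝓞 E) (𝓞 M)) with hQdef
    have hQq := (htow R).trans hRq
    obtain ⟨v, hv, hv'⟩ := hd Q hQ hQq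
    rw [RC_card_inertia hq hq0 R hR hRq, RC_tower_e hR hQdef.symm hQq]
    refine Dvd.dvd.mul_left ?_ _
    have hQ0 : Q ≠ ⊥ := RC_over_ne_bot hq0 hQq
    have hR0 : R ≠ ⊥ := RC_over_ne_bot hq0 hRq
    haveI : R.LiesOver Q := ⟨hQdef⟩
    have hs : Ideal.span {β i} ≠ ⊥ := by simpa [Ideal.span_singleton_eq_bot] using hβ0
    have h5 := Ideal.IsDedekindDomain.emultiplicity_map_eq_ramificationIdx'_mul (v := Q) (w := R) (I := Ideal.span {β i}) hs
      (Ideal.prime_of_isPrime hQ0 hQ).irreducible (Ideal.prime_of_isPrime hR0 hR).irreducible hR0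
    rw [Ideal.map_span, Set.image_singleton, ← hb, ← Ideal.span_singleton_pow, 
      emultiplicity_pow (Ideal.prime_of_isPrime hR0 hR), hv'] at h5
    have hb0 : b i ≠ 0 := by
      intro h
      have := hb i
      rw [h, zero_pow hpp.ne_zero, eq_comm, map_eq_zero_iff _ (FaithfulSMul.algebraMap_injective (𝓞 E) (𝓞 M))] at this
      exact hβ0 this
    have hfin : FiniteMultiplicity R (Ideal.span {b i}) := FiniteMultiplicity.of_prime_left (Ideal.prime_of_isPrime hR0 hR) (by
      simpa [Ideal.span_singleton_eq_bot] using hb0)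
    rw [hfin.emultiplicity_eq_multiplicity] at h5
    have h6 : p * multiplicity R (Ideal.span {b i}) = Ideal.ramificationIdx' Q R * v := by exact_mod_cast h5
    exact (hpp.dvd_mul.1 (Dvd.intro _ h6)).resolve_right hv
end
end

section
section
open NumberField Pointwise

theorem RC_grp {G : Type*} [Group G] [Finite G] (p : ℕ) [Fact p.Prime] (d : ℕ)
    (Ψ : G →* Multiplicative (Fin d → ZMod p)) (h3 : ∀ g, Ψ g = 1 → g ^ (p - 1) = 1) :
    (∀ S : Subgroup G, (∀ g ∈ S, Ψ g = 1) → ¬ p ∣ Nat.card S) ∧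
    (∀ (D : Subgroup G) (i : Fin d), (∀ g ∈ D, ∀ j, j ≠ i → (Ψ g).toAdd j = 0) → ¬ p ^ 2 ∣ Nat.card D) := by
  have hpp : p.Prime := Fact.out
  have hS : ∀ S : Subgroup G, (∀ g ∈ S, Ψ g = 1) → ¬ p ∣ Nat.card S := by
    intro S hS hdvd
    obtain ⟨g, hg⟩ := exists_prime_orderOf_dvd_card' p hdvd
    have h4 := h3 g (hS g g.2)
    have h5 : orderOf (g : G) ∣ p - 1 := orderOf_dvd_of_pow_eq_one h4
    rw [Subgroup.orderOf_coe, hg] at h5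
    have h6 := hpp.two_le
    have := Nat.le_of_dvd (by omega) h5
    omega
  refine ⟨hS, ?_⟩
  intro D i hD hdvd
  let φ : D →* Multiplicative (ZMod p) :=
    ((AddMonoidHom.toMultiplicative (Pi.evalAddMonoidHom (fun _ : Fin d => ZMod p) i)).comp Ψ).comp D.subtype
  have hφ : ∀ g, (φ g).toAdd = (Ψ (g : G)).toAdd i := fun g => rfl
  have hk : ¬ p ∣ Nat.card φ.ker := by
    have := hS (φ.ker.map D.subtype) (by
      rintro g ⟨x, hx, rfl⟩
      apply Multiplicative.toAdd.injective
      funext j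
      by_cases hj : j = i
      · subst hj
        have h4 : φ x = 1 := hx
        have h5 := hφ x
        rw [h4] at h5
        exact h5.symm
      · exact hD _ x.2 j hj)
    rwa [Subgroup.card_map_of_injective D.subtype_injective] at this
  have h4 : Nat.card D = Nat.card φ.range * Nat.card φ.ker := by
    rw [Subgroup.card_eq_card_quotient_mul_card_subgroup φ.ker, Nat.card_congr (QuotientGroup.quotientKerEquivRange φ).toEquiv]
  rw [h4] at hdvd
  have h5 := (Nat.Coprime.pow_left 2 ((Nat.Prime.coprime_iff_not_dvd hpp).2 hk)).dvd_of_dvd_mul_right hdvd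
  have h6 : Nat.card φ.range ∣ p := by
    have := Subgroup.card_subgroup_dvd_card φ.range
    rwa [Nat.card_congr Multiplicative.toAdd, Nat.card_zmod] at this
  have h7 := Nat.le_of_dvd hpp.pos (h5.trans h6)
  have := hpp.two_le
  nlinarith

theorem RC_surj {G : Type*} [Group G] [Finite G] (p : ℕ) [Fact p.Prime] (d : ℕ)
    (Ψ : G →* Multiplicative (Fin d → ZMod p))
    (h : ∀ i, ∃ g, Ψ g ≠ 1 ∧ ∀ j, j ≠ i → (Ψ g).toAdd j = 0) : Function.Surjective Ψ := by
  classical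
  have hpp : p.Prime := Fact.out
  have h1 : ∀ i (c : ZMod p), Multiplicative.ofAdd (Pi.single i c : Fin d → ZMod p) ∈ Ψ.range := by
    intro i c
    obtain ⟨g, hg, hg'⟩ := h i
    have h2 : (Ψ g).toAdd i ≠ 0 := by
      intro h0
      apply hg
      apply Multiplicative.toAdd.injective
      funext j
      by_cases hj : j = i
      · subst hj; exact h0
      · exact hg' j hj
    refine ⟨g ^ (c * ((Ψ g).toAdd i)⁻¹).val, ?_⟩
    apply Multiplicative.toAdd.injective
    funext j
    rw [map_pow, toAdd_pow, toAdd_ofAdd, Pi.smul_apply, nsmul_eq_mul, ZMod.natCast_zmod_val]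
    by_cases hj : j = i
    · subst hj
      rw [Pi.single_eq_same, mul_assoc, inv_mul_cancel₀ h2, mul_one]
    · rw [hg' j hj, mul_zero, Pi.single_eq_of_ne hj]
  intro v
  have h2 : v = ∏ i, Multiplicative.ofAdd (Pi.single i (v.toAdd i) : Fin d → ZMod p) := by
    rw [← ofAdd_sum, Finset.univ_sum_single]
    rfl
  have h3 : v ∈ Ψ.range := by
    rw [h2]
    exact Subgroup.prod_mem _ fun i _ => h1 i _
  exact h3

theorem RC_assemble {K : Type*} {M : Type} [Field K] [NumberField K] [Field M] [NumberField M]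
    [Algebra K M] [IsGalois K M] 
    (p : ℕ) [Fact p.Prime] (d : ℕ) (q : Fin d → Ideal (𝓞 K)) (hq : ∀ i, (q i).IsPrime ∧ q i ≠ ⊥)
    (Ψ : Gal(M/K) →* Multiplicative (Fin d → ZMod p))
    (h3 : ∀ g, Ψ g = 1 → g ^ (p - 1) = 1)
    (l1 : ∀ P : Ideal (𝓞 K), P.IsPrime → P ≠ ⊥ → (∀ i, P ≠ q i) → ∀ R : Ideal (𝓞 M), R.IsPrime →
      R.comap (algebraMap (𝓞 K) (𝓞 M)) = P → ∀ g ∈ R.inertia Gal(M/K), Ψ g = 1)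
    (l2 : ∀ i, ∀ R : Ideal (𝓞 M), R.IsPrime → R.comap (algebraMap (𝓞 K) (𝓞 M)) = q i → 
      ∀ g ∈ MulAction.stabilizer Gal(M/K) R, ∀ j, j ≠ i → (Ψ g).toAdd j = 0)
    (l3 : ∀ i, ∀ R : Ideal (𝓞 M), R.IsPrime → R.comap (algebraMap (𝓞 K) (𝓞 M)) = q i → 
      p ∣ Nat.card (R.inertia Gal(M/K))) :
    ∃ (L : Type) (_ : Field L) (_ : Algebra K L) (_ : NumberField L), IsGalois K L ∧
      Nonempty ((L ≃ₐ[K] L) ≃* Multiplicative (Fin d → ZMod p)) ∧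
      (∀ i, ∀ Q : Ideal (𝓞 L), Q.IsPrime → Q.comap (algebraMap (𝓞 K) (𝓞 L)) = q i →
        Ideal.ramificationIdx' (q i) Q = p ∧ Ideal.inertiaDeg' (q i) Q = 1) ∧
      (∀ P : Ideal (𝓞 K), P.IsPrime → P ≠ ⊥ → (∀ i, P ≠ q i) → ∀ Q : Ideal (𝓞 L), Q.IsPrime →
        Q.comap (algebraMap (𝓞 K) (𝓞 L)) = P → Ideal.ramificationIdx' P Q = 1) := by
  have hpp : p.Prime := Fact.out
  haveI : NeZero p := ⟨hpp.ne_zero⟩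
  haveI : FiniteDimensional K M := Module.Finite.of_restrictScalars_finite ℚ K M
  obtain ⟨g1, g2⟩ := RC_grp p d Ψ h3
  have hsurj : Function.Surjective Ψ := by
    refine RC_surj p d Ψ fun i => ?_
    obtain ⟨R, hR, hRq⟩ := RC_exists_over (M := M) (q i) (hq i).1
    obtain ⟨g, hg⟩ := exists_prime_orderOf_dvd_card' p (l3 i R hR hRq)
    refine ⟨g, ?_, l2 i R hR hRq g (Ideal.inertia_le_stabilizer R g.2)⟩
    intro h4
    have h5 : orderOf (g : Gal(M/K)) ∣ p - 1 := orderOf_dvd_of_pow_eq_one (h3 g h4)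
    rw [Subgroup.orderOf_coe, hg] at h5
    have h6 := hpp.two_le
    have := Nat.le_of_dvd (by omega) h5
    omega
  let L := IntermediateField.fixedField Ψ.ker
  haveI : NumberField L := NumberField.of_module_finite K L
  haveI hG : IsGalois K L := inferInstanceAs (IsGalois K (IntermediateField.fixedField Ψ.ker))
  have hequiv : (L ≃ₐ[K] L) ≃* Multiplicative (Fin d → ZMod p) :=
    (IsGalois.normalAutEquivQuotient Ψ.ker).symm.trans (QuotientGroup.quotientKerEquivOfSurjective Ψ hsurj)
  have hcard : Nat.card Gal(L/K) = p ^ d := by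
    rw [Nat.card_congr hequiv.toEquiv, Nat.card_congr Multiplicative.toAdd, Nat.card_fun, Nat.card_zmod, Nat.card_fin]
  haveI : FiniteDimensional L M := inferInstance
  have hcardM : ¬ p ∣ Nat.card Gal(M/L) := by
    rw [IsGalois.card_aut_eq_finrank, IntermediateField.finrank_fixedField_eq_card]
    exact g1 _ fun g hg => hg
  refine ⟨L, inferInstance, inferInstance, inferInstance, hG, ⟨hequiv⟩, ?_, ?_⟩
  · intro i Q hQ hQq
    obtain ⟨R, hR, hRQ⟩ := RC_exists_over (M := M) Q hQ
    have hRq : R.comap (algebraMap (𝓞 K) (𝓞 M)) = q i := by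
      rw [IsScalarTower.algebraMap_eq (𝓞 K) (𝓞 L) (𝓞 M), ← Ideal.comap_comap, hRQ, hQq]
    have hQ0 : Q ≠ ⊥ := RC_over_ne_bot (hq i).2 hQq
    have a1 := l3 i R hR hRq
    rw [RC_card_inertia (hq i).1 (hq i).2 R hR hRq, RC_tower_e hR hRQ hQq] at a1
    have a2 := RC_ef_dvd hQ hQ0 R hR hRQ
    have a3 : p ∣ Ideal.ramificationIdx' (q i) Q := (hpp.dvd_mul.1 a1).resolve_right fun h => 
      hcardM ((h.trans (Dvd.intro _ rfl)).trans a2)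
    have a4 := RC_ef_dvd (hq i).1 (hq i).2 Q hQ hQq
    rw [hcard, Nat.dvd_prime_pow hpp] at a4
    obtain ⟨t, ht, a4⟩ := a4
    have a5 := g2 _ i (l2 i R hR hRq)
    rw [RC_card_stab (hq i).1 (hq i).2 R hR hRq, RC_tower_e hR hRQ hQq, RC_tower_f hR (hq i).2 hRQ hQq, mul_mul_mul_comm, a4] at a5
    have a6 : t < 2 := by
      by_contra h
      exact a5 (Dvd.dvd.mul_right (pow_dvd_pow p (by omega)) _)
    have a7 : t ≠ 0 := by
      rintro rfl
      rw [pow_zero] at a4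
      exact hpp.one_lt.ne' (Nat.dvd_one.1 (a3.trans (Dvd.intro _ a4)))
    have a8 : t = 1 := by omega
    rw [a8, pow_one] at a4
    have a9 : Ideal.ramificationIdx' (q i) Q = p := Nat.dvd_antisymm (Dvd.intro _ a4) a3
    refine ⟨a9, ?_⟩
    rw [a9] at a4
    exact Nat.eq_of_mul_eq_mul_left hpp.pos (by rw [a4, mul_one])
  · intro P hP hP0 hPq Q hQ hQP
    obtain ⟨R, hR, hRQ⟩ := RC_exists_over (M := M) Q hQ
    have hRP : R.comap (algebraMap (𝓞 K) (𝓞 M)) = P := by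
      rw [IsScalarTower.algebraMap_eq (𝓞 K) (𝓞 L) (𝓞 M), ← Ideal.comap_comap, hRQ, hQP]
    have a1 := g1 _ (l1 P hP hP0 hPq R hR hRP)
    rw [RC_card_inertia hP hP0 R hR hRP, RC_tower_e hR hRQ hQP] at a1
    have a4 := RC_ef_dvd hP hP0 Q hQ hQP
    rw [hcard] at a4
    have a5 := (Dvd.intro _ rfl : Ideal.ramificationIdx' P Q ∣ _).trans a4
    rw [Nat.dvd_prime_pow hpp] at a5
    obtain ⟨t, -, a5⟩ := a5
    rcases Nat.eq_zero_or_pos t with rfl | ht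
    · simpa using a5
    · exfalso
      apply a1
      rw [a5]
      exact Dvd.dvd.mul_right (dvd_pow_self p ht.ne') _
end
end

section
section
open NumberField Polynomial

theorem RC_M {K : Type*} {E : Type} [Field K] [NumberField K] [Field E] [NumberField E] [Algebra K E] [IsGalois K E]
    (p : ℕ) [Fact p.Prime] (ζ : E) (hζ : IsPrimitiveRoot ζ p)
    (hE : ∀ σ : Gal(E/K), σ ζ = ζ → σ = 1) (d : ℕ) (β : Fin d → 𝓞 E) (hβ0 : ∀ i, β i ≠ 0)
    (hγ : ∀ i (σ : Gal(E/K)) (k : ℕ), σ ζ = ζ ^ k → ∃ γ : E, σ (β i : E) = (β i : E) ^ k * γ ^ p) :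
    ∃ (M : Type) (_ : Field M) (_ : NumberField M) (_ : Algebra K M) (_ : Algebra E M) (_ : IsScalarTower K E M)
      (_ : IsGalois K M) (b : Fin d → 𝓞 M), (∀ i, b i ^ p = algebraMap (𝓞 E) (𝓞 M) (β i)) ∧
      (∀ g : Gal(M/K), g (algebraMap E M ζ) = algebraMap E M ζ → (∀ i, g (b i : M) = (b i : M)) → g = 1) := by
  have hpp : p.Prime := Fact.out
  haveI : NeZero p := ⟨hpp.ne_zero⟩
  let f : E[X] := ∏ j, (X ^ p - C (β j : E))
  have hf : f ≠ 0 := Finset.prod_ne_zero_iff.2 fun j _ => X_pow_sub_C_ne_zero hpp.pos _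
  obtain ⟨F, _, _, _, _, _, _, hsp⟩ := RC_B0 (K := K) f hf
  have hf' : f.map (algebraMap E F) ≠ 0 := by rwa [Polynomial.map_ne_zero_iff (algebraMap E F).injective]
  have hc : ∀ j, ∃ c : F, c ^ p = algebraMap E F (β j) := by
    intro j
    have h1 : ((X ^ p - C (β j : E)).map (algebraMap E F)).Splits := hsp.of_dvd hf' (Polynomial.map_dvd _ 
      (Finset.dvd_prod_of_mem _ (Finset.mem_univ j)))
    obtain ⟨c, hc⟩ := h1.exists_eval_eq_zero (by
      rw [degree_map, degree_X_pow_sub_C hpp.pos]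
      exact_mod_cast hpp.ne_zero)
    exact ⟨c, by simpa [sub_eq_zero] using hc⟩
  choose c hc using hc
  have hzF : IsPrimitiveRoot (algebraMap E F ζ) p := hζ.map_of_injective (algebraMap E F).injective
  have hcomm : ∀ (ρ : Gal(F/K)) (x : E), algebraMap E F (AlgEquiv.restrictNormalHom E ρ x) = ρ (algebraMap E F x) :=
    fun ρ x => AlgEquiv.restrictNormal_commutes ρ E x
  have hcne : ∀ i, c i ≠ 0 := by
    intro i h
    have h1 := hc i
    rw [h, zero_pow hpp.ne_zero, eq_comm, map_eq_zero] at h1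
    exact hβ0 i (by simpa using h1)
  have hG : ∀ (g : Gal(F/K)) i, ∃ (s k : ℕ) (γ : E), g (c i) = (algebraMap E F ζ) ^ s * (c i) ^ k * algebraMap E F γ := by
    intro g i
    have hk := (hzF.autToPow_spec K g).symm
    set k := ((hzF.autToPow K g : ZMod p)).val
    obtain ⟨γ, hγ'⟩ := hγ i (AlgEquiv.restrictNormalHom E g) k ((algebraMap E F).injective (by rw [hcomm, map_pow]; exact hk))
    have h2 := congrArg (algebraMap E F) hγ'
    rw [hcomm, map_mul, map_pow, map_pow, ← hc, map_pow] at h2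
    have hne : (c i) ^ k * algebraMap E F γ ≠ 0 := by
      intro h0
      have h3 : ((c i) ^ p) ^ k * (algebraMap E F γ) ^ p = 0 := by
        rw [← pow_mul, mul_comm p k, pow_mul, ← mul_pow, h0, zero_pow hpp.ne_zero]
      rw [h3, pow_eq_zero_iff hpp.ne_zero, map_eq_zero] at h2
      exact hcne i h2
    have h1 : (g (c i) / ((c i) ^ k * algebraMap E F γ)) ^ p = 1 := by
      rw [div_pow, h2, mul_pow, ← pow_mul, ← pow_mul, mul_comm p k, div_self]
      rw [pow_mul, ← mul_pow]
      exact pow_ne_zero _ hne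
    obtain ⟨s, hs, hs'⟩ := hzF.eq_pow_of_pow_eq_one h1
    exact ⟨s, k, γ, by rw [mul_assoc, hs', div_mul_cancel₀ _ hne]⟩
  let N : Subgroup Gal(F/K) :=
    { carrier := {g | (∀ x : E, g (algebraMap E F x) = algebraMap E F x) ∧ ∀ i, g (c i) = c i}
      one_mem' := ⟨fun _ => rfl, fun _ => rfl⟩
      mul_mem' := fun {g h} hg hh => ⟨fun x => by
        show g (h _) = _
        rw [hh.1, hg.1], fun i => by
        show g (h _) = _
        rw [hh.2, hg.2]⟩
      inv_mem' := fun {g} hg => ⟨fun x => (AlgEquiv.symm_apply_eq g).2 (hg.1 x).symm,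
        fun i => (AlgEquiv.symm_apply_eq g).2 (hg.2 i).symm⟩ }
  have hN : ∀ g, g ∈ N ↔ (∀ x : E, g (algebraMap E F x) = algebraMap E F x) ∧ ∀ i, g (c i) = c i := fun g => Iff.rfl
  haveI : N.Normal := by
    constructor
    intro n hn g
    have key : ∀ x, n (g⁻¹ x) = g⁻¹ x → (g * n * g⁻¹) x = x := by
      intro x hx
      show g (n (g⁻¹ x)) = x
      rw [hx]
      exact g.apply_symm_apply x
    refine ⟨fun x => key _ ?_, fun i => key _ ?_⟩
    · rw [← hcomm]
      exact hn.1 _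
    · obtain ⟨s, k, γ, h⟩ := hG g⁻¹ i
      rw [h, map_mul, map_mul, map_pow, map_pow, hn.1, hn.1, hn.2]
  haveI : FiniteDimensional K F := Module.Finite.of_restrictScalars_finite ℚ K F
  let M := IntermediateField.fixedField N
  haveI : NumberField M := NumberField.of_module_finite K M
  haveI hGal : IsGalois K M := inferInstanceAs (IsGalois K (IntermediateField.fixedField N))
  have hmem : ∀ x : F, x ∈ M ↔ ∀ g ∈ N, g x = x := fun x => IntermediateField.mem_fixedField_iff _ _
  letI : Algebra E M := ((algebraMap E F).codRestrict M.toSubfield (fun x => (hmem _).2 fun g hg => hg.1 x)).toAlgebra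
  have hEM : ∀ x : E, ((algebraMap E M x : M) : F) = algebraMap E F x := fun x => rfl
  haveI hst : IsScalarTower K E M := IsScalarTower.of_algebraMap_eq fun x => by
    apply Subtype.ext
    rw [hEM, ← IsScalarTower.algebraMap_apply]
    rfl
  have hcM : ∀ i, ∃ y : M, (y : F) = c i := fun i => ⟨⟨c i, (hmem _).2 fun g hg => hg.2 i⟩, rfl⟩
  choose c' hc' using hcM
  have hcp : ∀ i, c' i ^ p = algebraMap E M (β i) := by
    intro i
    apply Subtype.ext
    rw [hEM, ← hc, ← hc']
    rfl
  have hlift : ∀ x : M, IsIntegral ℤ x → ∃ y : 𝓞 M, algebraMap (𝓞 M) M y = x := fun x hx => ⟨⟨x, hx⟩, rfl⟩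
  choose b hb using fun i => hlift (c' i) (IsIntegral.of_pow hpp.pos (by
    rw [hcp]
    exact (β i).2.map (algebraMap E M).toIntAlgHom))
  refine ⟨M, inferInstance, inferInstance, inferInstance, inferInstance, hst, hGal, b, ?_, ?_⟩
  · intro i
    apply IsFractionRing.injective (𝓞 M) M
    rw [map_pow, hb, hcp]
    rfl
  · intro g hgz hgb
    obtain ⟨G, rfl⟩ := AlgEquiv.restrictNormalHom_surjective (F := K) (K₁ := M) F g
    have hGc : ∀ x : M, ((AlgEquiv.restrictNormalHom M G x : M) : F) = G x := fun x => AlgEquiv.restrictNormal_commutes G M x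
    have hGN : G ∈ N := by
      refine ⟨fun x => ?_, fun i => ?_⟩
      · rw [← hcomm, hE (AlgEquiv.restrictNormalHom E G)]
        · rfl
        · apply (algebraMap E F).injective
          rw [hcomm, ← hEM, ← hGc, hgz]
      · have := hgb i
        have h2 := congrArg (fun y : M => (y : F)) this
        change ((AlgEquiv.restrictNormalHom M G (algebraMap (𝓞 M) M (b i)) : M) : F) = ((algebraMap (𝓞 M) M (b i) : M) : F) at h2
        rw [hGc, hb, hc'] at h2
        exact h2
    ext x
    rw [hGc]
    exact (hmem x).1 x.2 G hGN

theorem RC_E (K : Type*) [Field K] [NumberField K] (p : ℕ) [Fact p.Prime] :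
    ∃ (E : Type) (_ : Field E) (_ : NumberField E) (_ : Algebra K E) (_ : IsGalois K E) (ζ : E),
      IsPrimitiveRoot ζ p ∧ ∀ σ : Gal(E/K), σ ζ = ζ → σ = 1 := by
  have hpp : p.Prime := Fact.out
  haveI : NeZero p := ⟨hpp.ne_zero⟩
  let Ω := AlgebraicClosure ℚ
  letI : Algebra K Ω := (IsAlgClosed.lift : K →ₐ[ℚ] Ω).toRingHom.toAlgebra
  haveI : IsScalarTower ℚ K Ω := IsScalarTower.of_algebraMap_eq' (Subsingleton.elim _ _)
  haveI : Algebra.IsAlgebraic ℚ Ω := by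
    have h := AlgebraicClosure.isAlgebraic ℚ
    convert h
    · rfl
    · exact Subsingleton.elim _ _
  haveI : Algebra.IsAlgebraic K Ω := Algebra.IsAlgebraic.tower_top (K := ℚ) K
  haveI : Algebra.IsIntegral K Ω := Algebra.IsAlgebraic.isIntegral
  obtain ⟨z, hz⟩ := HasEnoughRootsOfUnity.exists_primitiveRoot Ω p
  let E := IntermediateField.adjoin K {z}
  haveI : IsCyclotomicExtension {p} K E := hz.intermediateField_adjoin_isCyclotomicExtension K
  haveI : FiniteDimensional K E := IsCyclotomicExtension.finiteDimensional {p} K E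
  haveI : NumberField E := NumberField.of_module_finite K E
  haveI : IsGalois K E := IsCyclotomicExtension.isGalois {p} K E
  have hζ : IsPrimitiveRoot (⟨z, IntermediateField.mem_adjoin_simple_self K z⟩ : E) p :=
    IsPrimitiveRoot.of_map_of_injective (f := algebraMap E Ω) hz (algebraMap E Ω).injective
  refine ⟨E, inferInstance, inferInstance, inferInstance, inferInstance, _, hζ, ?_⟩
  intro σ hσ
  apply hζ.autToPow_injective K
  have h1 := hζ.autToPow_spec K σ
  rw [hσ] at h1
  rw [map_one]
  apply Units.ext
  have h2 := RC_primroot_pow hζ hpp.ne_zero (h1.trans (pow_one _).symm)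
  rw [ZMod.natCast_zmod_val] at h2
  rw [h2]; simp
end
end

open NumberField
/-- Let `p` be an odd prime and `K` a number field containing no primitive `p`-th root of
unity; let `d ≥ 1` and `n₁, …, n_d ≥ 1`.  Then there exist a finite Galois extension
`L/K` with group `(ℤ/p)^d` and distinct nonzero primes `𝔮₁, …, 𝔮_d` of `𝓞_K` such that
`p^{nᵢ} ∣ N(𝔮ᵢ) - 1` for each `i`, each prime of `𝓞_L` above `𝔮ᵢ` has ramification
index `p` and residue degree `1` over `𝔮ᵢ`, and every other nonzero prime of `𝓞_K` is
unramified in `𝓞_L`. -/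
theorem stmt_18 (p : ℕ) (hp : p.Prime) (hodd : Odd p)
    (K : Type*) [Field K] [NumberField K]
    (hmu : ∀ ζ : K, ¬ IsPrimitiveRoot ζ p)
    (d : ℕ) (hd : 1 ≤ d) (e : Fin d → ℕ) (he : ∀ i, 1 ≤ e i) :
    ∃ (L : Type) (_ : Field L) (_ : Algebra K L) (_ : NumberField L),
      IsGalois K L ∧
      Nonempty ((L ≃ₐ[K] L) ≃* Multiplicative (Fin d → ZMod p)) ∧
      ∃ q : Fin d → Ideal (𝓞 K),
        Function.Injective q ∧
        (∀ i, (q i).IsPrime ∧ q i ≠ ⊥) ∧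
        (∀ i, p ^ (e i) ∣ Nat.card (𝓞 K ⧸ q i) - 1) ∧
        (∀ i, ∀ Q : Ideal (𝓞 L), Q.IsPrime → Q ≠ ⊥ →
          Q.comap (algebraMap (𝓞 K) (𝓞 L)) = q i →
            Ideal.ramificationIdx' (q i) Q = p ∧
            Ideal.inertiaDeg' (q i) Q = 1) ∧
        (∀ P : Ideal (𝓞 K), P.IsPrime → P ≠ ⊥ → (∀ i, P ≠ q i) →
          ∀ Q : Ideal (𝓞 L), Q.IsPrime → Q ≠ ⊥ →
            Q.comap (algebraMap (𝓞 K) (𝓞 L)) = P →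
              Ideal.ramificationIdx' P Q = 1) := by
  haveI : Fact p.Prime := ⟨hp⟩
  obtain ⟨E, _, _, _, _, ζ, hζ, hE⟩ := RC_E K p
  obtain ⟨q, β, hgood, hcross⟩ := RC_family (K := K) p hodd ζ hζ (p ^ p) (pow_ne_zero _ hp.ne_zero) d e he
  obtain ⟨M, _, _, _, _, _, _, b, hb, hgen⟩ := RC_M (K := K) p ζ hζ hE d β (fun i => (hgood i).2.2.2.2.1)
    (fun i => (hgood i).2.2.2.2.2.2.1)
  obtain ⟨hfixE, -, Ψ, h1, h2, h3⟩ := RC_Psi (K := K) p ζ hζ hE d β (fun i => (hgood i).2.2.2.2.1)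
    (fun i => (hgood i).2.2.2.2.2.2.1) b hb hgen
  obtain ⟨l1, l2, l3⟩ := RC_loc (K := K) p hodd ζ hζ d e q β hgood hcross b hb hfixE Ψ h1 h2
  obtain ⟨L, i1, i2, i3, hG, hequiv, k1, k2⟩ := RC_assemble p d q (fun i => ⟨(hgood i).1, (hgood i).2.1⟩) Ψ h3 l1 l2 l3
  refine ⟨L, i1, i2, i3, hG, hequiv, q, ?_, fun i => ⟨(hgood i).1, (hgood i).2.1⟩, fun i => (hgood i).2.2.2.1, 
    fun i Q hQ _ h => k1 i Q hQ h, fun P hP hP0 hPq Q hQ _ h => k2 P hP hP0 hPq Q hQ h⟩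
  intro i j hij
  by_contra hne
  obtain ⟨Q, hQ, hQq⟩ := RC_exists_over (M := E) (q i) (hgood i).1
  refine (hcross i j hne Q hQ hQq).1 ?_
  obtain ⟨v, hv, hv'⟩ := (hgood j).2.2.2.2.2.2.2.2 Q hQ (hQq.trans hij)
  have hv1 : 1 ≤ v := by
    rcases Nat.eq_zero_or_pos v with rfl | h
    · exact absurd (dvd_zero p) hv
    · exact h
  have h5 : Q ^ 1 ∣ Ideal.span {β j} := by
    rw [pow_dvd_iff_le_emultiplicity, hv']
    exact_mod_cast hv1
  rw [pow_one, Ideal.dvd_span_singleton] at h5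
  exact h5
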